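/- There exists a real constant c such that for every A > 0 there exist x₀ = x₀(A) and C = C(A) with the following property: for all real x > x₀, all real Q with 1 ≤ Q ≤ x, and all real R with 2 ≤ R ≤ (log x)^A, | Σ_{q ≤ Q} Σ_{a=1}^{q} (ψ(x;q,a) − ρ(x;q,a))² − Q x log(x/R) + c Q x | ≤ C ( Q x R^{−1/2} + x² (log x)² R^{−1} ). -/

import Mathlib

open Finset

/-- `ψ(x;q,a) = Σ_{n ≤ x, n ≡ a (mod q)} Λ(n)`. -/
noncomputable def psi (x : ℝ) (q a : ℕ) : ℝ :=
  ∑ n ∈ (Finset.Icc 1 ⌊x⌋₊).filter (fun n => n % q = a % q),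
    ArithmeticFunction.vonMangoldt n

/-- The Ramanujan sum `c_r(n) = Σ_{1 ≤ b ≤ r, (b,r)=1} e(bn/r)` (a real number). -/
noncomputable def ramanujanSum (r n : ℕ) : ℝ :=
  (∑ b ∈ (Finset.Icc 1 r).filter (fun b => Nat.gcd b r = 1),
    Complex.exp (2 * Real.pi * Complex.I * b * n / r)).re

/-- `Ξ_R(n) = Σ_{r ≤ R} (μ(r)/φ(r)) c_r(n)`. -/
noncomputable def XiR (R : ℝ) (n : ℕ) : ℝ :=
  ∑ r ∈ Finset.Icc 1 ⌊R⌋₊,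
    ((ArithmeticFunction.moebius r : ℤ) : ℝ) / (Nat.totient r : ℝ) * ramanujanSum r n

/-- `ρ(x;q,a) = Σ_{n ≤ x, n ≡ a (mod q)} Ξ_R(n)`. -/
noncomputable def rhoR (x R : ℝ) (q a : ℕ) : ℝ :=
  ∑ n ∈ (Finset.Icc 1 ⌊x⌋₊).filter (fun n => n % q = a % q), XiR R n

namespace Vaughan
open MeasureTheory Filter Topology Asymptotics

/-- The discrepancy `∑_{M < k ≤ u} f k - κ (u - M)`, set to `0` for `u ≤ M`. -/
noncomputable def discrepancy (f : ℕ → ℂ) (κ : ℂ) (M : ℕ) (u : ℝ) : ℂ :=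
  Set.indicator (Set.Ioi (M : ℝ)) (fun u => ∑ k ∈ Ioc M ⌊u⌋₊, f k - κ * (u - M)) u

lemma norm_discrepancy_le {f : ℕ → ℂ} {κ : ℂ} {M : ℕ} {B : ℝ} (hB : 0 ≤ B) (hκ : ‖κ‖ ≤ 1)
    (h : ∀ n, M ≤ n → ‖∑ k ∈ Ioc M n, f k - κ * (n - M)‖ ≤ B) (u : ℝ) :
    ‖discrepancy f κ M u‖ ≤ B + 1 := by
  unfold discrepancy
  by_cases hu : u ∈ Set.Ioi (M : ℝ)
  · rw [Set.indicator_of_mem hu]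
    have hu' : (M : ℝ) < u := hu
    have h0 : 0 ≤ u := (Nat.cast_nonneg M).trans hu'.le
    have hM : M ≤ ⌊u⌋₊ := Nat.le_floor hu'.le
    have h1 := h _ hM
    have h2 : ‖κ * ((⌊u⌋₊ : ℂ) - u)‖ ≤ 1 := by
      rw [norm_mul]
      have : ‖((⌊u⌋₊ : ℂ) - u)‖ ≤ 1 := by
        have : ((⌊u⌋₊ : ℂ) - u) = (((⌊u⌋₊ : ℝ) - u : ℝ) : ℂ) := by push_cast; rfl
        rw [this, Complex.norm_real, Real.norm_eq_abs, abs_le]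
        constructor <;> linarith [Nat.floor_le h0, Nat.lt_floor_add_one u]
      nlinarith [norm_nonneg κ, norm_nonneg ((⌊u⌋₊ : ℂ) - u)]
    calc _ = ‖(∑ k ∈ Ioc M ⌊u⌋₊, f k - κ * (⌊u⌋₊ - M)) + κ * ((⌊u⌋₊ : ℂ) - u)‖ := by
            congr 1; ring
      _ ≤ B + 1 := (norm_add_le _ _).trans (add_le_add h1 h2)
  · rw [Set.indicator_of_notMem hu, norm_zero]; linarith

lemma measurable_discrepancy (f : ℕ → ℂ) (κ : ℂ) (M : ℕ) :
    Measurable (discrepancy f κ M) := by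
  unfold discrepancy
  refine Measurable.indicator ?_ measurableSet_Ioi
  refine Measurable.sub ?_ (by fun_prop)
  exact (measurable_from_nat (f := fun n => ∑ k ∈ Ioc M n, f k)).comp Nat.measurable_floor

lemma differentiableAt_mellin_discrepancy {f : ℕ → ℂ} {κ : ℂ} {M : ℕ} {B : ℝ} (hM : 1 ≤ M)
    (hB : 0 ≤ B) (hκ : ‖κ‖ ≤ 1)
    (h : ∀ n, M ≤ n → ‖∑ k ∈ Ioc M n, f k - κ * (n - M)‖ ≤ B) {s : ℂ} (hs : s.re < 0) :
    DifferentiableAt ℂ (mellin (discrepancy f κ M)) s := by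
  have hb := norm_discrepancy_le hB hκ h
  refine mellin_differentiableAt_of_isBigO_rpow (a := 0) (b := s.re - 1) ?_ ?_ hs ?_ (by linarith)
  · refine LocallyIntegrable.locallyIntegrableOn ?_ _
    refine (locallyIntegrable_const (B + 1)).mono
      (measurable_discrepancy f κ M).aestronglyMeasurable (Eventually.of_forall fun x => ?_)
    rw [Real.norm_of_nonneg (by linarith)]
    exact hb x
  · simp only [neg_zero, Real.rpow_zero]
    exact IsBigO.of_bound (B + 1) (Eventually.of_forall fun x => by simpa using hb x)
  · refine IsBigO.of_bound 1 ?_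
    filter_upwards [Ioo_mem_nhdsGT (show (0:ℝ) < 1 by norm_num)] with x hx
    have : x ∉ Set.Ioi (M : ℝ) := by
      have : (1:ℝ) ≤ M := by exact_mod_cast hM
      simp only [Set.mem_Ioi, not_lt]; linarith [hx.2]
    simp only [discrepancy, Set.indicator_of_notMem this, norm_zero]
    positivity

lemma norm_mellin_discrepancy_le {f : ℕ → ℂ} {κ : ℂ} {M : ℕ} {B : ℝ} (hM : 1 ≤ M)
    (hB : 0 ≤ B) (hκ : ‖κ‖ ≤ 1)
    (h : ∀ n, M ≤ n → ‖∑ k ∈ Ioc M n, f k - κ * (n - M)‖ ≤ B) {s : ℂ} (hs : 0 < s.re) :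
    ‖mellin (discrepancy f κ M) (-s)‖ ≤ (B + 1) * (M : ℝ) ^ (-s.re) / s.re := by
  have hM' : (0:ℝ) < M := by exact_mod_cast hM
  have hb := norm_discrepancy_le hB hκ h
  have e1 : mellin (discrepancy f κ M) (-s) = ∫ t in Set.Ioi (M : ℝ),
      (t : ℂ) ^ (-s - 1) • discrepancy f κ M t := by
    unfold mellin
    rw [← setIntegral_eq_of_subset_of_forall_sdiff_eq_zero measurableSet_Ioi
      (Set.Ioi_subset_Ioi hM'.le)]
    intro x hx
    simp [discrepancy, Set.indicator_of_notMem hx.2]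
  rw [e1]
  have hi := integrableOn_Ioi_rpow_of_lt (a := -s.re - 1) (by linarith) hM'
  calc _ ≤ ∫ t in Set.Ioi (M : ℝ), (B + 1) * t ^ (-s.re - 1) := by
        refine norm_integral_le_of_norm_le (hi.const_mul _) ?_
        refine (ae_restrict_iff' measurableSet_Ioi).2 (Eventually.of_forall fun t ht => ?_)
        have ht' : 0 < t := hM'.trans ht
        rw [norm_smul, Complex.norm_cpow_eq_rpow_re_of_pos ht', mul_comm]
        simp only [Complex.sub_re, Complex.neg_re, Complex.one_re]
        gcongr
        exact hb t
    _ = _ := by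
        rw [integral_const_mul, integral_Ioi_rpow_of_lt (by linarith) hM']
        have : -s.re - 1 + 1 = -s.re := by ring
        rw [this]; field_simp

lemma LSeries_eq_of_discrepancy {f : ℕ → ℂ} {κ : ℂ} {M : ℕ} {B : ℝ} (hM : 1 ≤ M)
    (hB : 0 ≤ B) (hκ : ‖κ‖ ≤ 1) (hf : ∀ n, ‖f n‖ ≤ 1)
    (h : ∀ n, M ≤ n → ‖∑ k ∈ Ioc M n, f k - κ * (n - M)‖ ≤ B) {s : ℂ} (hs : 1 < s.re) :
    LSeries f s = ∑ n ∈ Icc 1 M, f n * (n : ℂ) ^ (-s) + κ * (M : ℂ) ^ (1 - s) / (s - 1)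
      + s * mellin (discrepancy f κ M) (-s) := by
  have hM' : (0:ℝ) < M := by exact_mod_cast hM
  have hM1 : (1:ℝ) ≤ M := by exact_mod_cast hM
  have hs0 : s ≠ 0 := by rintro rfl; simp at hs; linarith
  have hs1 : s - 1 ≠ 0 := by
    intro h; rw [sub_eq_zero] at h; rw [h] at hs; simp at hs
  set g : ℕ → ℂ := fun n => if n ≤ M then 0 else f n with hg
  have hgn : ∀ n, ‖g n‖ ≤ 1 := fun n => by
    simp only [hg]; split_ifs <;> simp [hf]
  have hO : (fun n ↦ ∑ k ∈ Icc 1 n, ‖g k‖) =O[atTop] fun n ↦ (n : ℝ) ^ (1:ℝ) := by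
    refine IsBigO.of_bound 1 (Eventually.of_forall fun n => ?_)
    rw [Real.norm_of_nonneg (by positivity), Real.rpow_one, one_mul, Real.norm_of_nonneg (by positivity)]
    calc _ ≤ ∑ k ∈ Icc 1 n, (1:ℝ) := sum_le_sum fun k _ => hgn k
      _ = n := by simp
  have h1 := LSeries_eq_mul_integral' g zero_le_one hs hO
  have hsf : LSeriesSummable f s := LSeriesSummable_of_bounded_of_one_lt_re (m := 1)
    (fun n _ => hf n) hs
  have hsg : LSeriesSummable g s := LSeriesSummable_of_bounded_of_one_lt_re (m := 1)
    (fun n _ => hgn n) hs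
  have h2 : LSeries f s = ∑ n ∈ Icc 1 M, f n * (n : ℂ) ^ (-s) + LSeries g s := by
    have : LSeries f s - LSeries g s = ∑ n ∈ Icc 1 M, f n * (n : ℂ) ^ (-s) := by
      unfold LSeries
      rw [← Summable.tsum_sub hsf hsg, tsum_eq_sum (s := Icc 1 M)]
      · refine sum_congr rfl fun n hn => ?_
        have := mem_Icc.1 hn
        rw [LSeries.term_of_ne_zero (by omega), LSeries.term_of_ne_zero (by omega)]
        simp only [hg, if_pos this.2]
        rw [Complex.cpow_neg]; simp [div_eq_mul_inv]
      · intro n hn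
        rcases Nat.eq_zero_or_pos n with rfl | h0
        · simp
        · rw [LSeries.term_of_ne_zero (by omega), LSeries.term_of_ne_zero (by omega)]
          have : ¬ n ≤ M := by intro h; exact hn (mem_Icc.2 ⟨h0, h⟩)
          simp [hg, this]
    rw [← this]; ring
  rw [h2, add_assoc]
  congr 1
  rw [h1]
  have hsumg : ∀ t : ℝ, (M : ℝ) < t → ∑ k ∈ Icc 1 ⌊t⌋₊, g k = discrepancy f κ M t + κ * (t - M) := by
    intro t ht
    have e : ∑ k ∈ Icc 1 ⌊t⌋₊, g k = ∑ k ∈ Ioc M ⌊t⌋₊, f k := by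
      rw [← sum_subset (s₁ := Ioc M ⌊t⌋₊) (f := g)]
      · refine sum_congr rfl fun k hk => ?_
        have := mem_Ioc.1 hk
        simp only [hg]; rw [if_neg (by omega)]
      · intro k hk; have := mem_Ioc.1 hk; exact mem_Icc.2 ⟨by omega, this.2⟩
      · intro k hk hk'
        have := mem_Icc.1 hk
        simp only [mem_Ioc, not_and] at hk'
        simp only [hg]; rw [if_pos]; by_contra hh; exact hk' (by omega) this.2
    rw [e, discrepancy, Set.indicator_of_mem (by exact ht)]; ring
  have e2 : ∫ t in Set.Ioi (1 : ℝ), (∑ k ∈ Icc 1 ⌊t⌋₊, g k) * (t:ℂ) ^ (-(s + 1)) =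
      ∫ t in Set.Ioi (M : ℝ), (∑ k ∈ Icc 1 ⌊t⌋₊, g k) * (t:ℂ) ^ (-(s + 1)) := by
    rw [← setIntegral_eq_of_subset_of_forall_sdiff_eq_zero measurableSet_Ioi
      (Set.Ioi_subset_Ioi hM1)]
    intro x hx
    have hx2 : x ≤ M := by simpa using hx.2
    have : ⌊x⌋₊ ≤ M := by
      have := Nat.floor_le_floor hx2; simpa using this
    rw [sum_eq_zero, zero_mul]
    intro k hk
    have := mem_Icc.1 hk
    simp only [hg]; rw [if_pos (by omega)]
  have e3 : mellin (discrepancy f κ M) (-s) = ∫ t in Set.Ioi (M : ℝ),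
      (t : ℂ) ^ (-s - 1) • discrepancy f κ M t := by
    unfold mellin
    rw [← setIntegral_eq_of_subset_of_forall_sdiff_eq_zero measurableSet_Ioi
      (Set.Ioi_subset_Ioi hM'.le)]
    intro x hx
    simp [discrepancy, Set.indicator_of_notMem hx.2]
  have hb := norm_discrepancy_le hB hκ h
  have i1 : IntegrableOn (fun t : ℝ => (t : ℂ) ^ (-s - 1) • discrepancy f κ M t)
      (Set.Ioi (M:ℝ)) := by
    have hi := (integrableOn_Ioi_cpow_of_lt (a := -s - 1) (by simp; linarith) hM')
    have := hi.bdd_mul (c := B + 1) (measurable_discrepancy f κ M).aestronglyMeasurable.restrict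
      (Eventually.of_forall fun x => hb x)
    refine this.congr (Eventually.of_forall fun x => ?_)
    simp [mul_comm]
  have hi0 := (integrableOn_Ioi_cpow_of_lt (a := -s) (by simp; linarith) hM')
  have hi1 := (integrableOn_Ioi_cpow_of_lt (a := -s - 1) (by simp; linarith) hM')
  have i2 : IntegrableOn (fun t : ℝ => κ * ((t : ℂ) ^ (-s) - M * (t : ℂ) ^ (-s - 1)))
      (Set.Ioi (M:ℝ)) := (hi0.sub (hi1.const_mul _)).const_mul _
  have e4 : ∫ t in Set.Ioi (M : ℝ), (∑ k ∈ Icc 1 ⌊t⌋₊, g k) * (t:ℂ) ^ (-(s + 1)) =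
      ∫ t in Set.Ioi (M : ℝ), ((t : ℂ) ^ (-s - 1) • discrepancy f κ M t
        + κ * ((t : ℂ) ^ (-s) - M * (t : ℂ) ^ (-s - 1))) := by
    refine setIntegral_congr_fun measurableSet_Ioi fun t ht => ?_
    have ht0 : (t:ℂ) ≠ 0 := by
      have : 0 < t := hM'.trans ht
      exact_mod_cast this.ne'
    have : (t:ℂ) ^ (-s) = t * (t:ℂ) ^ (-s - 1) := by
      rw [Complex.cpow_sub _ _ ht0, Complex.cpow_one]; field_simp
    simp only [smul_eq_mul]
    rw [hsumg t ht, this, show -(s+1) = -s - 1 by ring]; ring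
  rw [e2, e4, integral_add i1 i2, ← e3, mul_add, add_comm]
  congr 1
  rw [integral_const_mul, integral_sub hi0 (hi1.const_mul _), integral_const_mul,
    integral_Ioi_cpow_of_lt (by simp; linarith) hM', integral_Ioi_cpow_of_lt (by simp; linarith) hM']
  have hMc : (M:ℂ) ≠ 0 := by exact_mod_cast hM'.ne'
  have : -s + 1 ≠ 0 := by intro h; apply hs1; linear_combination -h
  simp only [Complex.ofReal_natCast]
  rw [show -s - 1 + 1 = -s by ring, show -s + 1 = 1 - s by ring, Complex.cpow_sub _ _ hMc,
    Complex.cpow_one, Complex.cpow_neg]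
  have h3 : 1 - s ≠ 0 := by intro h; apply hs1; linear_combination -h
  have h4 : (M:ℂ)^s ≠ 0 := by simp [Complex.cpow_eq_zero_iff, hMc]
  field_simp
  ring

end Vaughan

namespace Vaughan
open MeasureTheory Filter Topology Asymptotics DirichletCharacter

/-- The mean value of a Dirichlet character over a period. -/
noncomputable def charMean {N : ℕ} (χ : DirichletCharacter ℂ N) : ℂ :=
  (∑ n ∈ range N, χ n) / N

lemma charMean_norm_le {N : ℕ} (χ : DirichletCharacter ℂ N) : ‖charMean χ‖ ≤ 1 := by
  unfold charMean
  rw [norm_div, Complex.norm_natCast]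
  refine div_le_one_of_le₀ ?_ (Nat.cast_nonneg _)
  refine (norm_sum_le _ _).trans ?_
  calc _ ≤ ∑ n ∈ range N, (1:ℝ) := sum_le_sum fun n _ => χ.norm_le_one _
    _ = N := by simp

lemma sum_range_zmod {N : ℕ} [NeZero N] (f : ZMod N → ℂ) :
    ∑ n ∈ range N, f n = ∑ a : ZMod N, f a := by
  refine sum_bij' (fun n _ => (n : ZMod N)) (fun a _ => a.val) ?_ ?_ ?_ ?_ ?_
  · simp
  · intro a _; simpa using ZMod.val_lt a
  · intro n hn; exact ZMod.val_cast_of_lt (mem_range.1 hn)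
  · intro a _; simp
  · simp

lemma charMean_eq_zero {N : ℕ} [NeZero N] {χ : DirichletCharacter ℂ N} (hχ : χ ≠ 1) :
    charMean χ = 0 := by
  unfold charMean
  rw [sum_range_zmod (fun a => χ a), MulChar.sum_eq_zero_of_ne_one hχ, zero_div]

lemma char_sum_range {N : ℕ} [NeZero N] (χ : DirichletCharacter ℂ N) (m : ℕ) :
    ‖∑ n ∈ range m, χ n - charMean χ * m‖ ≤ 2 * N := by
  induction m using Nat.strong_induction_on with
  | _ m ih =>
    have hN : 0 < N := Nat.pos_of_ne_zero (NeZero.ne N)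
    have hN' : (N:ℂ) ≠ 0 := by exact_mod_cast hN.ne'
    rcases lt_or_ge m N with hm | hm
    · have h1 : ‖∑ n ∈ range m, χ n‖ ≤ m := by
        refine (norm_sum_le _ _).trans ?_
        calc _ ≤ ∑ n ∈ range m, (1:ℝ) := sum_le_sum fun n _ => χ.norm_le_one _
          _ = m := by simp
      have h2 : ‖charMean χ * m‖ ≤ m := by
        rw [norm_mul, Complex.norm_natCast]
        exact mul_le_of_le_one_left (Nat.cast_nonneg _) (charMean_norm_le χ)
      have h3 : (m:ℝ) ≤ N := by exact_mod_cast hm.le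
      refine (norm_sub_le _ _).trans ?_
      linarith
    · obtain ⟨k, rfl⟩ := Nat.exists_eq_add_of_le hm
      have := ih k (by omega)
      convert this using 2
      rw [sum_range_add]
      have : ∀ x, χ ((N + x : ℕ) : ZMod N) = χ x := by intro x; simp
      simp only [this]
      have : ∑ n ∈ range N, χ n = charMean χ * N := by
        unfold charMean; field_simp
      rw [this]; push_cast; ring

lemma char_sum_Ioc {N : ℕ} [NeZero N] (χ : DirichletCharacter ℂ N) {M n : ℕ} (h : M ≤ n) :
    ‖∑ k ∈ Ioc M n, χ k - charMean χ * (n - M)‖ ≤ 4 * N := by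
  have e : ∑ k ∈ Ioc M n, χ k = ∑ k ∈ range (n+1), χ k - ∑ k ∈ range (M+1), χ k := by
    rw [range_eq_Ico, range_eq_Ico, ← sum_Ico_consecutive _ (Nat.zero_le (M+1)) (by omega : M + 1 ≤ n + 1)]
    have : Ioc M n = Ico (M+1) (n+1) := by ext; simp only [mem_Ioc, mem_Ico]; omega
    rw [this]; ring
  have h1 := char_sum_range χ (n+1)
  have h2 := char_sum_range χ (M+1)
  rw [e]
  calc _ = ‖(∑ k ∈ range (n+1), χ k - charMean χ * ((n+1 : ℕ):ℂ)) -
        (∑ k ∈ range (M+1), χ k - charMean χ * ((M+1 : ℕ):ℂ))‖ := by congr 1; push_cast; ring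
    _ ≤ _ := (norm_sub_le _ _).trans (by linarith)

/-- `L(s, χ)` for `χ` nontrivial, and `(s - 1) / s * L(s, χ)` for `χ` trivial. -/
noncomputable def regL {N : ℕ} [NeZero N] (χ : DirichletCharacter ℂ N) (s : ℂ) : ℂ :=
  open Classical in if χ = 1 then LFunctionTrivChar₁ N s / s else LFunction χ s

variable {N : ℕ} [NeZero N] (χ : DirichletCharacter ℂ N)

lemma regL_of_ne {χ : DirichletCharacter ℂ N} (h : χ ≠ 1) : regL χ = LFunction χ := by
  funext s; simp [regL, h]

lemma regL_one : regL (1 : DirichletCharacter ℂ N) = fun s => LFunctionTrivChar₁ N s / s := by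
  funext s; simp [regL]

lemma regL_one_of_ne {s : ℂ} (hs : s ≠ 1) :
    regL (1 : DirichletCharacter ℂ N) s = (s - 1) / s * LFunctionTrivChar N s := by
  rw [regL_one]
  simp only [LFunctionTrivChar₁, Function.update_of_ne hs]
  ring

lemma differentiableAt_regL {s : ℂ} (hs : s ≠ 0) : DifferentiableAt ℂ (regL χ) s := by
  by_cases h : χ = 1
  · subst h
    rw [regL_one]
    exact (differentiable_LFunctionTrivChar₁ N s).div differentiableAt_id hs
  · rw [regL_of_ne h]; exact differentiable_LFunction h s

lemma LFunction_eq_of_re_pos {M : ℕ} (hM : 1 ≤ M) {s : ℂ} (hs : 0 < s.re) (hs1 : s ≠ 1) :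
    LFunction χ s = ∑ n ∈ Icc 1 M, χ n * (n : ℂ) ^ (-s) +
      charMean χ * (M : ℂ) ^ (1 - s) / (s - 1)
      + s * mellin (discrepancy (fun n => χ n) (charMean χ) M) (-s) := by
  classical
  have hM' : (M:ℂ) ≠ 0 := by exact_mod_cast (by omega : M ≠ 0)
  let Z : ℂ → ℂ := fun s => if χ = 1 then LFunctionTrivChar₁ N s else (s - 1) * LFunction χ s
  have hZ : ∀ s ≠ 1, Z s = (s - 1) * LFunction χ s := by
    intro s hs
    by_cases h : χ = 1
    · simp only [Z, h, if_true, LFunctionTrivChar₁, Function.update_of_ne hs, LFunctionTrivChar]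
    · simp only [Z, h, if_false]
  have hZd : Differentiable ℂ Z := by
    by_cases h : χ = 1
    · simp only [Z, h, if_true]; exact differentiable_LFunctionTrivChar₁ N
    · simp only [Z, h, if_false]
      exact (differentiable_id.sub_const _).mul (differentiable_LFunction h)
  let W : ℂ → ℂ := fun s => (s - 1) * ∑ n ∈ Icc 1 M, χ n * (n : ℂ) ^ (-s) +
      charMean χ * (M : ℂ) ^ (1 - s)
      + (s - 1) * (s * mellin (discrepancy (fun n => χ n) (charMean χ) M) (-s))
  have hB : ∀ n, M ≤ n → ‖∑ k ∈ Ioc M n, (fun n : ℕ => χ n) k - charMean χ * (n - M)‖ ≤ 4 * N :=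
    fun n hn => char_sum_Ioc χ hn
  let U : Set ℂ := {s | 0 < s.re}
  have hU : IsOpen U := isOpen_lt continuous_const Complex.continuous_re
  have hWd : DifferentiableOn ℂ W U := by
    intro s hs
    have hm : DifferentiableAt ℂ (mellin (discrepancy (fun n => χ n) (charMean χ) M)) (-s) :=
      differentiableAt_mellin_discrepancy hM (by positivity) (charMean_norm_le χ) hB
        (by have : 0 < s.re := hs
            simpa using this)
    have hm' : DifferentiableAt ℂ
        (fun s => mellin (discrepancy (fun n => χ n) (charMean χ) M) (-s)) s :=
      hm.comp s differentiableAt_id.neg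
    have h1 : DifferentiableAt ℂ (fun s : ℂ => ∑ n ∈ Icc 1 M, χ n * (n : ℂ) ^ (-s)) s := by
      refine DifferentiableAt.fun_sum fun n hn => ?_
      have : (n:ℂ) ≠ 0 := by
        have := (mem_Icc.1 hn).1
        exact_mod_cast (by omega : n ≠ 0)
      exact ((differentiableAt_id.neg).const_cpow (Or.inl this)).const_mul _
    have h2 : DifferentiableAt ℂ (fun s : ℂ => (M : ℂ) ^ (1 - s)) s :=
      (differentiableAt_id.const_sub 1).const_cpow (Or.inl hM')
    have h3 : DifferentiableAt ℂ (fun s : ℂ => s - 1) s := by fun_prop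
    exact (((h3.mul h1).add (h2.const_mul _)).add
      (h3.mul (differentiableAt_id.mul hm'))).differentiableWithinAt
  have heq : Set.EqOn Z W U := by
    refine AnalyticOnNhd.eqOn_of_preconnected_of_eventuallyEq (z₀ := 2)
      (hZd.differentiableOn.analyticOnNhd hU) (hWd.analyticOnNhd hU)
      (convex_halfSpace_re_gt 0).isPreconnected (by simp [U]) ?_
    have : {s : ℂ | 1 < s.re} ∈ 𝓝 (2:ℂ) :=
      (isOpen_lt continuous_const Complex.continuous_re).mem_nhds (by simp)
    filter_upwards [this] with s hs
    have hs1 : s ≠ 1 := by rintro rfl; simp at hs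
    rw [hZ s hs1, LFunction_eq_LSeries χ hs, LSeries_eq_of_discrepancy hM
      (B := 4 * N) (by positivity) (charMean_norm_le χ) (fun n => χ.norm_le_one _) hB hs]
    have : s - 1 ≠ 0 := sub_ne_zero.2 hs1
    simp only [W]; field_simp
  have := heq hs
  rw [hZ s hs1] at this
  have h1 : s - 1 ≠ 0 := sub_ne_zero.2 hs1
  rw [← mul_right_inj' h1, this]
  simp only [W]; field_simp

/-- The analytic conductor of `s` at level `N`. -/
noncomputable def cond (N : ℕ) (s : ℂ) : ℝ := N * (|s.im| + 2)

lemma two_le_cond (s : ℂ) : 2 ≤ cond N s := by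
  have : (1:ℝ) ≤ N := by exact_mod_cast Nat.pos_of_ne_zero (NeZero.ne N)
  unfold cond
  nlinarith [abs_nonneg s.im]

lemma sum_Icc_rpow_le {ε : ℝ} (hε : 0 < ε) {M : ℕ} (hM : 1 ≤ M) :
    ∑ n ∈ Icc 1 M, (n : ℝ) ^ (-1 + ε) ≤ (1 + 1 / ε) * (M : ℝ) ^ (2 * ε) := by
  have hM' : (1:ℝ) ≤ M := by exact_mod_cast hM
  have h0 : (0:ℝ) ≤ (M:ℝ) ^ ε := by positivity
  have h1 : ∑ n ∈ Icc 1 M, (n : ℝ) ^ (-1 + ε) ≤ (M : ℝ) ^ ε * ∑ n ∈ Icc 1 M, (n : ℝ)⁻¹ := by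
    rw [mul_sum]
    refine sum_le_sum fun n hn => ?_
    have hn := mem_Icc.1 hn
    have hn' : (0:ℝ) < n := by exact_mod_cast hn.1
    rw [Real.rpow_add hn', Real.rpow_neg_one, mul_comm]
    gcongr
    exact_mod_cast hn.2
  have h2 : ∑ n ∈ Icc 1 M, (n : ℝ)⁻¹ ≤ 1 + Real.log M := by
    have := harmonic_le_one_add_log M
    rw [harmonic_eq_sum_Icc] at this
    push_cast at this
    exact this
  have h3 : Real.log M ≤ (M:ℝ) ^ ε / ε := Real.log_le_rpow_div (by linarith) hε
  have h4 : 1 ≤ (M:ℝ) ^ ε := Real.one_le_rpow hM' hε.le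
  calc _ ≤ (M : ℝ) ^ ε * ((M:ℝ)^ε + (M:ℝ) ^ ε / ε) :=
        h1.trans (mul_le_mul_of_nonneg_left (by linarith) h0)
    _ = _ := by rw [two_mul, Real.rpow_add (by linarith)]; ring

lemma regL_bound_aux {ε : ℝ} (hε : 0 < ε) (hε' : ε ≤ 1 / 4) {s : ℂ} (h1 : 1 - ε ≤ s.re)
    (h4 : s.re ≤ 4) (hs1 : s ≠ 1) :
    ‖regL χ s‖ ≤ (3 * (1 + 1 / ε) + 44) * (2 * cond N s) ^ (2 * ε) := by
  have hX := two_le_cond (N := N) s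
  set M : ℕ := ⌈cond N s⌉₊ with hMdef
  have hXM : cond N s ≤ M := Nat.le_ceil _
  have hMX : (M:ℝ) ≤ 2 * cond N s := by
    have := Nat.ceil_lt_add_one (show 0 ≤ cond N s by linarith)
    linarith
  have hM2 : (2:ℝ) ≤ M := hX.trans hXM
  have hM : 1 ≤ M := by
    have : (1:ℝ) ≤ M := by linarith
    exact_mod_cast this
  have hM0 : (0:ℝ) < M := by linarith
  have hN1 : (1:ℝ) ≤ N := by exact_mod_cast Nat.pos_of_ne_zero (NeZero.ne N)
  have hre : 0 < s.re := by linarith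
  have hs0 : s ≠ 0 := by rintro rfl; simp at hre
  have key := LFunction_eq_of_re_pos χ hM hre hs1
  set A := ∑ n ∈ Icc 1 M, χ n * (n : ℂ) ^ (-s) with hA
  set D := s * mellin (discrepancy (fun n => χ n) (charMean χ) M) (-s) with hD
  have hY : (M:ℝ) ^ ε ≤ (M:ℝ) ^ (2 * ε) :=
    Real.rpow_le_rpow_of_exponent_le (by linarith) (by linarith)
  have bA : ‖A‖ ≤ (1 + 1 / ε) * (M : ℝ) ^ (2 * ε) := by
    refine le_trans (norm_sum_le _ _) (le_trans (sum_le_sum fun n hn => ?_) (sum_Icc_rpow_le hε hM))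
    have hn := mem_Icc.1 hn
    have hn' : (1:ℝ) ≤ n := by exact_mod_cast hn.1
    rw [norm_mul, Complex.norm_natCast_cpow_of_pos hn.1]
    calc _ ≤ 1 * (n:ℝ) ^ (-s).re := by gcongr; exact χ.norm_le_one _
      _ ≤ _ := by
        rw [one_mul]
        exact Real.rpow_le_rpow_of_exponent_le hn' (by simp; linarith)
  have bs : ‖s‖ ≤ 2 * (|s.im| + 2) := by
    have := Complex.norm_le_abs_re_add_abs_im s
    rw [abs_of_pos hre] at this
    linarith [abs_nonneg s.im]
  have bD : ‖D‖ ≤ 14 * (M:ℝ) ^ (2 * ε) := by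
    have hm := norm_mellin_discrepancy_le (f := fun n => χ n) (κ := charMean χ) (B := 4 * N) hM
      (by positivity) (charMean_norm_le χ) (fun n hn => char_sum_Ioc χ hn) hre
    rw [hD, norm_mul]
    have e1 : (M:ℝ) ^ (-s.re) ≤ (M:ℝ) ^ (-1 + ε) :=
      Real.rpow_le_rpow_of_exponent_le (by linarith) (by linarith)
    have e2 : (M:ℝ) ^ (-1 + ε) = (M:ℝ)⁻¹ * (M:ℝ) ^ ε := by
      rw [Real.rpow_add hM0, Real.rpow_neg_one]
    have e3 : (s.re)⁻¹ ≤ 4 / 3 := by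
      rw [inv_le_comm₀ hre (by norm_num)]; norm_num; linarith
    have e4 : ‖s‖ * (4 * N + 1) ≤ 10 * M := by
      calc ‖s‖ * (4 * N + 1) ≤ (2 * (|s.im| + 2)) * (5 * N) := by gcongr; linarith
        _ = 10 * cond N s := by unfold cond; ring
        _ ≤ _ := by linarith
    calc _ ≤ ‖s‖ * ((4 * N + 1) * (M : ℝ) ^ (-s.re) / s.re) := by gcongr
      _ = (‖s‖ * (4 * N + 1)) * (M : ℝ) ^ (-s.re) * (s.re)⁻¹ := by rw [div_eq_mul_inv]; ring
      _ ≤ (10 * M) * ((M:ℝ)⁻¹ * (M:ℝ) ^ ε) * (4 / 3) := by rw [← e2]; gcongr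
      _ = 40 / 3 * (M:ℝ) ^ ε := by field_simp; norm_num
      _ ≤ _ := by nlinarith [Real.rpow_nonneg hM0.le ε]
  have bY : (M:ℝ) ^ (2 * ε) ≤ (2 * cond N s) ^ (2 * ε) :=
    Real.rpow_le_rpow hM0.le hMX (by linarith)
  have hYpos : 0 ≤ (M:ℝ) ^ (2 * ε) := by positivity
  have hεi : 0 ≤ 1 / ε := by positivity
  suffices ‖regL χ s‖ ≤ (3 * (1 + 1 / ε) + 44) * (M:ℝ) ^ (2 * ε) from
    this.trans (mul_le_mul_of_nonneg_left bY (by linarith))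
  by_cases hχ : χ = 1
  · have hsn : 3 / 4 ≤ ‖s‖ := by
      have := Complex.abs_re_le_norm s
      rw [abs_of_pos hre] at this
      linarith
    have e1 : ‖(s - 1) / s‖ ≤ 3 := by
      rw [norm_div, div_le_iff₀ (by linarith)]
      have := norm_sub_le s 1
      rw [norm_one] at this
      linarith
    have e2 : regL χ s = (s - 1) / s * (A + D) + charMean χ * (M : ℂ) ^ (1 - s) / s := by
      subst hχ
      rw [regL_one_of_ne hs1, LFunctionTrivChar, key]
      have : s - 1 ≠ 0 := sub_ne_zero.2 hs1
      field_simp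
      ring
    have e3 : ‖charMean χ * (M : ℂ) ^ (1 - s) / s‖ ≤ 2 * (M:ℝ) ^ (2 * ε) := by
      rw [norm_div, norm_mul, Complex.norm_natCast_cpow_of_pos hM, div_le_iff₀ (by linarith)]
      have h5 : (M:ℝ) ^ (1 - s).re ≤ (M:ℝ) ^ (2 * ε) :=
        Real.rpow_le_rpow_of_exponent_le (by linarith) (by simp; linarith)
      calc _ ≤ 1 * (M:ℝ) ^ (2 * ε) := by gcongr; exact charMean_norm_le χ
        _ ≤ _ := by nlinarith
    rw [e2]
    refine (norm_add_le _ _).trans ?_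
    rw [norm_mul]
    have e5 : ‖(s - 1) / s‖ * ‖A + D‖ ≤ 3 * ‖A + D‖ := by gcongr
    have := norm_add_le A D
    nlinarith
  · rw [regL_of_ne hχ, key, charMean_eq_zero hχ, zero_mul, zero_div, add_zero]
    refine (norm_add_le _ _).trans ?_
    nlinarith

/-- Convexity-type bound near the line `Re s = 1`, uniform in the character. -/
theorem exists_regL_bound {ε : ℝ} (hε : 0 < ε) (hε' : ε ≤ 1 / 4) :
    ∃ C : ℝ, 1 ≤ C ∧ ∀ (N : ℕ) [NeZero N] (χ : DirichletCharacter ℂ N) (s : ℂ),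
      1 - ε ≤ s.re → s.re ≤ 4 → ‖regL χ s‖ ≤ C * (cond N s) ^ (2 * ε) := by
  refine ⟨2 ^ (2 * ε) * (3 * (1 + 1 / ε) + 44), ?_, ?_⟩
  · have h1 : (1:ℝ) ≤ 2 ^ (2 * ε) := Real.one_le_rpow (by norm_num) (by linarith)
    have : 0 ≤ 1 / ε := by positivity
    nlinarith
  · intro N _ χ s h1 h4
    have hX := two_le_cond (N := N) s
    have e : ∀ s : ℂ, 2 ^ (2 * ε) * (3 * (1 + 1 / ε) + 44) * (cond N s) ^ (2 * ε) =
        (3 * (1 + 1 / ε) + 44) * (2 * cond N s) ^ (2 * ε) := by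
      intro s
      rw [Real.mul_rpow (by norm_num) (by linarith [two_le_cond (N := N) s])]; ring
    rw [e]
    by_cases hs1 : s = 1
    · subst hs1
      -- approach `1` along the real axis
      have hc : ContinuousAt (fun s => ‖regL χ s‖) 1 :=
        (differentiableAt_regL χ one_ne_zero).continuousAt.norm
      have hl : Tendsto (fun x : ℝ => ((1:ℂ) + x)) (𝓝[>] 0) (𝓝 1) := by
        have : Continuous (fun x : ℝ => ((1:ℂ) + x)) := by fun_prop
        have := this.tendsto 0
        simp only [Complex.ofReal_zero, add_zero] at this
        exact this.mono_left nhdsWithin_le_nhds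
      refine le_of_tendsto (hc.tendsto.comp hl) ?_
      filter_upwards [Ioo_mem_nhdsGT (show (0:ℝ) < 1 by norm_num)] with x hx
      have := regL_bound_aux χ hε hε' (s := 1 + x) (by simp; linarith [hx.1])
        (by simp; linarith [hx.2]) (by simpa using hx.1.ne')
      simpa [cond] using this
    · exact regL_bound_aux χ hε hε' h1 h4 hs1

end Vaughan

namespace Vaughan
open MeasureTheory Filter Topology Asymptotics DirichletCharacter
open scoped ComplexOrder Nat

lemma iteratedDeriv_sub_one_inv (m : ℕ) :
    iteratedDeriv m (fun s : ℂ => (s - 1)⁻¹) 2 = (-1) ^ m * m ! := by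
  have := congrFun (iteratedDeriv_comp_sub_const m (fun s : ℂ => s⁻¹) 1) 2
  rw [this, iteratedDeriv_eq_iterate]
  have h := congrFun (iter_deriv_inv' (𝕜 := ℂ) m) (2 - 1)
  change deriv^[m] Inv.inv _ = _
  rw [h]; norm_num

/-- Estermann's inequality: a Dirichlet series with non-negative coefficients and a simple pole at
`1` whose continuation is non-positive at some `β < 1` has a residue that is not too small. -/
theorem residue_lower_bound {g : ℂ → ℂ} {a : ℕ → ℂ} (ha : ∀ n, 0 ≤ a n) (ha1 : a 1 = 1)
    (hsum : ∀ s : ℂ, 1 < s.re → LSeriesSummable a s)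
    (hg : DifferentiableOn ℂ g {s | 0 < s.re}) {B : ℝ} (hB1 : 1 ≤ B)
    (hB : ∀ s : ℂ, 3 / 4 ≤ s.re → s.re ≤ 4 → |s.im| ≤ 2 → ‖g s‖ ≤ B)
    (heq : ∀ s : ℂ, 1 < s.re → g s = (s - 1) * LSeries a s) {β : ℝ} (hβ : 7 / 8 ≤ β)
    (hβ1 : β < 1) (hgβ : 0 ≤ (g β).re) :
    (1 - β) / 6 * (160 * B) ^ (-(10 * (1 - β))) ≤ (g 1).re := by
  set U : Set ℂ := {s | 0 < s.re} with hUdef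
  have hU : IsOpen U := isOpen_lt continuous_const Complex.continuous_re
  have h1U : (1:ℂ) ∈ U := by simp [U]
  set h : ℂ → ℂ := dslope g 1 with hh
  have hhd : DifferentiableOn ℂ h U :=
    (Complex.differentiableOn_dslope (hU.mem_nhds h1U)).2 hg
  have hhe : ∀ s : ℂ, s ≠ 1 → h s = (s - 1)⁻¹ * (g s - g 1) := by
    intro s hs
    rw [hh, dslope_of_ne _ hs, slope_def_field]
    field_simp
  set l : ℂ := g 1 with hl
  have hball : Metric.closedBall (2:ℂ) (5 / 4) ⊆ U := by
    intro s hs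
    have h1 := Complex.abs_re_le_norm (s - 2)
    rw [Metric.mem_closedBall, dist_eq_norm] at hs
    have := abs_le.1 (h1.trans hs)
    simp only [Complex.sub_re, Complex.re_ofNat] at this
    simp only [U, Set.mem_ofPred_eq]; linarith
  -- Taylor coefficients of `h` at `2`
  have hdc : DiffContOnCl ℂ h (Metric.ball (2:ℂ) (5 / 4)) := by
    refine DifferentiableOn.diffContOnCl ?_
    rw [closure_ball _ (by norm_num)]
    exact hhd.mono hball
  have hcoef : ∀ m, ‖iteratedDeriv m h 2‖ ≤ m ! * (8 * B) / (5 / 4) ^ m := by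
    intro m
    refine Complex.norm_iteratedDeriv_le_of_forall_mem_sphere_norm_le m (by norm_num) hdc ?_
    intro z hz
    rw [mem_sphere_iff_norm] at hz
    have h1 := abs_le.1 ((Complex.abs_re_le_norm (z - 2)).trans hz.le)
    have h2 := (Complex.abs_im_le_norm (z - 2)).trans hz.le
    simp only [Complex.sub_re, Complex.re_ofNat] at h1
    simp only [Complex.sub_im, Complex.im_ofNat, sub_zero] at h2
    have hz1 : 1 / 4 ≤ ‖z - 1‖ := by
      have := norm_sub_norm_le (z - 2) (-1)
      rw [hz, norm_neg, norm_one, show z - 2 - -1 = z - 1 by ring] at this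
      linarith
    have hne : z ≠ 1 := by rintro rfl; norm_num at hz1
    rw [hhe z hne, norm_mul, norm_inv]
    have b1 := hB z (by linarith) (by linarith) (by linarith)
    have b2 := hB 1 (by norm_num) (by norm_num) (by norm_num)
    have b3 : ‖g z - l‖ ≤ 2 * B := (norm_sub_le _ _).trans (by linarith)
    have b4 : ‖z - 1‖⁻¹ ≤ 4 := by
      rw [inv_le_comm₀ (by linarith) (by norm_num)]; linarith
    calc _ ≤ 4 * (2 * B) := by gcongr
      _ = _ := by ring
  have hf : AnalyticAt ℂ (LSeries a) 2 := by
    have : DifferentiableOn ℂ (LSeries a) {s | 1 < s.re} := by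
      have h1 : DifferentiableOn ℂ (fun s => (s - 1)⁻¹ * g s) {s | 1 < s.re} := by
        intro s hs
        have hs' : (1:ℝ) < s.re := hs
        have : s - 1 ≠ 0 := sub_ne_zero.2 (by rintro rfl; simp at hs')
        have h0 : (0:ℝ) < s.re := by linarith
        have := (hg.differentiableAt (hU.mem_nhds h0))
        exact (DifferentiableAt.mul (DifferentiableAt.inv (by fun_prop) (by assumption))
          this).differentiableWithinAt
      refine h1.congr fun s hs => ?_
      have hs' : (1:ℝ) < s.re := hs
      have : s - 1 ≠ 0 := sub_ne_zero.2 (by rintro rfl; simp at hs')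
      rw [heq s hs]; field_simp
    exact this.analyticAt ((isOpen_lt continuous_const Complex.continuous_re).mem_nhds
      (by simp))
  have hcoef2 : ∀ m, iteratedDeriv m h 2 = iteratedDeriv m (LSeries a) 2 - l * ((-1) ^ m * m !) := by
    intro m
    have hev : h =ᶠ[𝓝 2] fun s => LSeries a s - l * (s - 1)⁻¹ := by
      have : {s : ℂ | 1 < s.re} ∈ 𝓝 (2:ℂ) :=
        (isOpen_lt continuous_const Complex.continuous_re).mem_nhds (by simp)
      filter_upwards [this] with s hs
      have hs' : (1:ℝ) < s.re := hs
      have hne : s ≠ 1 := by rintro rfl; simp at hs'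
      have : s - 1 ≠ 0 := sub_ne_zero.2 hne
      rw [hhe s hne, heq s hs]; field_simp
    have h3 : ContDiffAt ℂ m (fun s : ℂ => (s - 1)⁻¹) 2 :=
      ContDiffAt.inv (by fun_prop) (by norm_num)
    rw [hev.iteratedDeriv_eq, iteratedDeriv_fun_sub hf.contDiffAt (contDiffAt_const.mul h3),
      iteratedDeriv_const_mul l h3, iteratedDeriv_sub_one_inv]
  have habs : LSeries.abscissaOfAbsConv a < (2:ℝ) := by
    refine lt_of_le_of_lt (LSeries.abscissaOfAbsConv_le_of_forall_lt_LSeriesSummable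
      (x := 1) fun y hy => hsum y (by simpa using hy)) ?_
    exact_mod_cast one_lt_two
  have hb : ∀ m, 0 ≤ ((-1) ^ m * iteratedDeriv m (LSeries a) 2).re := by
    intro m
    have := LSeries.iteratedDeriv_alternating ha habs m
    exact (Complex.le_def.1 (by simpa using this)).1
  have hb0 : 1 ≤ (LSeries a 2).re := by
    have hs := (hsum 2 (by simp)).hasSum
    have hs' := Complex.hasSum_re hs
    have := hs'.summable.le_tsum 1 (fun n _ => ?_)
    · rw [hs'.tsum_eq] at this
      simp only [LSeries.term, one_ne_zero, if_false, ha1, Nat.cast_one, Complex.one_cpow,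
        div_one, Complex.one_re] at this
      exact this
    · have := LSeries.term_nonneg (ha n) 2 
      have := (Complex.le_def.1 this).1
      simpa using this
  -- the expansion at `β`
  set y : ℝ := 2 - β with hy
  have hβball : (β:ℂ) ∈ Metric.ball (2:ℂ) (5 / 4) := by
    rw [Metric.mem_ball, dist_eq_norm, show (β:ℂ) - 2 = ((β - 2 : ℝ) : ℂ) by push_cast; ring,
      Complex.norm_real, Real.norm_eq_abs, abs_lt]
    constructor <;> linarith
  have hT := Complex.hasSum_taylorSeries_on_ball (hdc.differentiableOn) hβball
  set t : ℕ → ℝ := fun m =>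
    ((m ! : ℂ)⁻¹ • ((β:ℂ) - 2) ^ m • iteratedDeriv m h 2).re with ht
  have hTr : HasSum t (h β).re := Complex.hasSum_re hT
  have hpow : ∀ m, ((β:ℂ) - 2) ^ m = (-1) ^ m * ((y ^ m : ℝ) : ℂ) := by
    intro m
    rw [hy]; push_cast; rw [← mul_pow]; ring
  have ht1 : ∀ m, t m = (m ! : ℝ)⁻¹ * y ^ m * ((-1) ^ m * iteratedDeriv m (LSeries a) 2).re
      - l.re * y ^ m := by
    intro m
    have hm : (m ! : ℂ) ≠ 0 := by exact_mod_cast Nat.factorial_ne_zero m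
    have h1 : ((-1:ℂ)) ^ m * (-1) ^ m = 1 := by rw [← mul_pow]; norm_num
    have : (m ! : ℂ)⁻¹ • ((β:ℂ) - 2) ^ m • iteratedDeriv m h 2 =
        (((m ! : ℝ)⁻¹ * y ^ m : ℝ) : ℂ) * ((-1) ^ m * iteratedDeriv m (LSeries a) 2)
          - (y ^ m : ℝ) * l := by
      rw [hcoef2, hpow, smul_eq_mul, smul_eq_mul]
      push_cast
      have : (m ! : ℂ)⁻¹ * ((-1) ^ m * (y:ℂ) ^ m * (iteratedDeriv m (LSeries a) 2 -
        l * ((-1) ^ m * (m ! : ℂ)))) =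
          (m ! : ℂ)⁻¹ * (y:ℂ)^m * ((-1) ^ m * iteratedDeriv m (LSeries a) 2) -
            ((-1:ℂ) ^ m * (-1) ^ m) * ((m ! : ℂ)⁻¹ * (m ! : ℂ)) * ((y:ℂ) ^ m * l) := by ring
      rw [this, h1, inv_mul_cancel₀ hm]; ring
    simp only [ht]
    rw [this, Complex.sub_re, Complex.re_ofReal_mul, Complex.re_ofReal_mul]
    ring
  have hy1 : 1 < y := by linarith
  have hy2 : y ≤ 9 / 8 := by linarith
  have htb : ∀ m, |t m| ≤ 8 * B * (9 / 10) ^ m := by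
    intro m
    refine (Complex.abs_re_le_norm _).trans ?_
    rw [norm_smul, norm_smul, norm_inv, Complex.norm_natCast, hpow, norm_mul, norm_pow, norm_neg,
      norm_one, one_pow, one_mul, Complex.norm_real, Real.norm_eq_abs, abs_of_nonneg (by positivity)]
    have hm : (0:ℝ) < m ! := by exact_mod_cast Nat.factorial_pos m
    calc _ ≤ (m ! : ℝ)⁻¹ * (y ^ m * (m ! * (8 * B) / (5 / 4) ^ m)) := by
          gcongr; exact hcoef m
      _ = 8 * B * (y / (5 / 4)) ^ m := by rw [div_pow y]; field_simp
      _ ≤ _ := by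
        have : y / (5 / 4) ≤ 9 / 10 := by rw [div_le_iff₀ (by norm_num)]; linarith
        gcongr
  set M : ℕ := ⌈Real.log (160 * B) * 10⌉₊ with hM
  have hlB : 1 ≤ Real.log (160 * B) := by
    rw [Real.le_log_iff_exp_le (by linarith)]
    have := Real.exp_one_lt_d9; linarith
  have hM1 : Real.log (160 * B) * 10 ≤ M := Nat.le_ceil _
  have hM2 : (M:ℝ) ≤ Real.log (160 * B) * 10 + 1 := (Nat.ceil_lt_add_one (by linarith)).le
  have hMpos : 0 < M := by
    have : (0:ℝ) < M := by linarith
    exact_mod_cast this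
  have h9 : 160 * B * (9 / 10) ^ M ≤ 1 := by
    have e1 : ((9:ℝ) / 10) ^ M ≤ Real.exp (-(M / 10)) := by
      rw [show -((M:ℝ) / 10) = M * (-(1/10)) by ring, Real.exp_nat_mul]
      gcongr
      have := Real.add_one_le_exp (-(1/10:ℝ))
      linarith
    have e2 : Real.exp (-(M / 10)) ≤ Real.exp (-Real.log (160 * B)) :=
      Real.exp_le_exp.2 (by linarith)
    rw [Real.exp_neg (Real.log _), Real.exp_log (by linarith)] at e2
    calc _ ≤ 160 * B * (160 * B)⁻¹ := by gcongr; exact e1.trans e2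
      _ = 1 := mul_inv_cancel₀ (by linarith)
  -- tail and head
  have hgeo : HasSum (fun m => 8 * B * (9 / 10 : ℝ) ^ (m + M)) (80 * B * (9 / 10) ^ M) := by
    have := (hasSum_geometric_of_lt_one (r := (9/10:ℝ)) (by norm_num) (by norm_num)).mul_left
      (8 * B * (9 / 10) ^ M)
    rw [show (1 - 9 / 10 : ℝ)⁻¹ = 10 by norm_num] at this
    rw [show 80 * B * (9 / 10) ^ M = 8 * B * (9 / 10) ^ M * 10 by ring]
    have e : (fun m => 8 * B * (9 / 10 : ℝ) ^ (m + M)) =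
        fun i => 8 * B * (9 / 10) ^ M * (9 / 10) ^ i := by funext m; ring
    rw [e]; exact this
  have htail : |∑' m, t (m + M)| ≤ 80 * B * (9 / 10) ^ M := by
    rw [← Real.norm_eq_abs]
    exact tsum_of_norm_bounded hgeo fun m => by rw [Real.norm_eq_abs]; exact htb _
  have hsplit : (h β).re = ∑ m ∈ range M, t m + ∑' m, t (m + M) := by
    rw [hTr.summable.sum_add_tsum_nat_add, hTr.tsum_eq]
  have hhead : 1 - l.re * ((y ^ M - 1) / (y - 1)) ≤ ∑ m ∈ range M, t m := by
    rw [← geom_sum_eq hy1.ne', mul_sum]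
    simp_rw [ht1]
    rw [sum_sub_distrib]
    refine sub_le_sub_right ?_ _
    have : (fun m => (m ! : ℝ)⁻¹ * y ^ m * ((-1) ^ m * iteratedDeriv m (LSeries a) 2).re) 0 ≤
        ∑ m ∈ range M, (m ! : ℝ)⁻¹ * y ^ m * ((-1) ^ m * iteratedDeriv m (LSeries a) 2).re := by
      refine single_le_sum (f := fun m => (m ! : ℝ)⁻¹ * y ^ m * ((-1) ^ m *
        iteratedDeriv m (LSeries a) 2).re) (fun m _ => ?_) (mem_range.2 hMpos)
      have := hb m
      positivity
    simp only [Nat.factorial_zero, Nat.cast_one, inv_one, pow_zero, one_mul, mul_one,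
      iteratedDeriv_zero] at this
    linarith
  have hhβ : (h β).re ≤ l.re / (y - 1) := by
    have hne : (β:ℂ) ≠ 1 := by exact_mod_cast hβ1.ne
    rw [hhe _ hne, show ((β:ℂ) - 1)⁻¹ = (((β - 1)⁻¹ : ℝ) : ℂ) by push_cast; rfl,
      Complex.re_ofReal_mul, Complex.sub_re, show y - 1 = -(β - 1) by rw [hy]; ring, div_neg,
      div_eq_mul_inv]
    have : (β - 1)⁻¹ < 0 := inv_lt_zero.2 (by linarith)
    nlinarith
  have hy0 : 0 < y - 1 := by linarith
  have hkey : 1 / 2 ≤ l.re * (y ^ M / (y - 1)) := by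
    have := (abs_le.1 htail).1
    have e : l.re * (y ^ M / (y - 1)) = l.re * ((y ^ M - 1) / (y - 1)) + l.re / (y - 1) := by
      field_simp; ring
    rw [e]; linarith
  have hyM : y ^ M ≤ 3 * (160 * B) ^ (10 * (1 - β)) := by
    have e1 : y ≤ Real.exp (1 - β) := by
      have := Real.add_one_le_exp (1 - β); linarith
    calc y ^ M ≤ Real.exp (1 - β) ^ M := by gcongr
      _ = Real.exp (M * (1 - β)) := by rw [Real.exp_nat_mul]
      _ ≤ Real.exp (1 + Real.log (160 * B) * (10 * (1 - β))) := by
          apply Real.exp_le_exp.2; nlinarith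
      _ = Real.exp 1 * (160 * B) ^ (10 * (1 - β)) := by
          rw [Real.exp_add, Real.rpow_def_of_pos (by linarith)]
      _ ≤ _ := by
          gcongr
          have := Real.exp_one_lt_d9; linarith
  have hP : 0 < (160 * B) ^ (10 * (1 - β)) := Real.rpow_pos_of_pos (by linarith) _
  rw [Real.rpow_neg (by linarith)]
  have hyMp : 0 < y ^ M := by positivity
  have hlpos : 0 < l.re := by
    by_contra hneg
    have : l.re * (y ^ M / (y - 1)) ≤ 0 :=
      mul_nonpos_of_nonpos_of_nonneg (not_lt.1 hneg) (by positivity)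
    linarith
  have h6 : (y - 1) / 2 ≤ l.re * y ^ M := by
    have : l.re * (y ^ M / (y - 1)) * (y - 1) = l.re * y ^ M := by field_simp
    nlinarith
  rw [← div_eq_mul_inv, div_le_iff₀ hP]
  nlinarith

lemma arith_mul_prime_pow (f g : ArithmeticFunction ℂ) {p : ℕ} (hp : p.Prime) (k : ℕ) :
    (f * g) (p ^ k) = ∑ i ∈ range (k + 1), f (p ^ i) * g (p ^ (k - i)) := by
  rw [ArithmeticFunction.mul_apply, Nat.sum_divisorsAntidiagonal (fun i j => f i * g j),
    Nat.sum_divisors_prime_pow hp]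
  refine sum_congr rfl fun i hi => ?_
  rw [Nat.pow_div (by have := mem_range.1 hi; omega) hp.pos]

variable {N : ℕ}

/-- The arithmetic function attached to a Dirichlet character. -/
noncomputable def charArith {N : ℕ} (χ : DirichletCharacter ℂ N) : ArithmeticFunction ℂ :=
  toArithmeticFunction (χ ·)

lemma charArith_prime_pow (χ : DirichletCharacter ℂ N) {p : ℕ} (hp : p.Prime) (k : ℕ) :
    charArith χ (p ^ k) = χ p ^ k := by
  have := apply_eq_toArithmeticFunction_apply χ (pow_ne_zero k hp.ne_zero)
  rw [charArith, ← this]; simp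

lemma charArith_isMultiplicative (χ : DirichletCharacter ℂ N) : (charArith χ).IsMultiplicative :=
  isMultiplicative_toArithmeticFunction χ

lemma charArith_summable [NeZero N] (χ : DirichletCharacter ℂ N) {s : ℂ} (hs : 1 < s.re) :
    LSeriesSummable (charArith χ) s :=
  (LSeriesSummable_congr _ fun h ↦ (χ.apply_eq_toArithmeticFunction_apply h).symm).mpr <|
      ZMod.LSeriesSummable_of_one_lt_re χ hs

lemma charArith_LSeries [NeZero N] (χ : DirichletCharacter ℂ N) {s : ℂ} (hs : 1 < s.re) :
    LSeries (charArith χ) s = LFunction χ s := by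
  rw [χ.LFunction_eq_LSeries hs]
  exact LSeries_congr (fun h => (χ.apply_eq_toArithmeticFunction_apply h).symm) s

lemma multiplicative_nonneg {f : ArithmeticFunction ℂ} (hf : f.IsMultiplicative)
    (h : ∀ p k : ℕ, p.Prime → 0 ≤ f (p ^ k)) (n : ℕ) : 0 ≤ f n := by
  rcases eq_or_ne n 0 with rfl | hn
  · simp
  · rw [hf.multiplicative_factorization _ hn]
    exact Finset.prod_nonneg fun p hp => h _ _ (Nat.prime_of_mem_primeFactors hp)

lemma char_values {χ : DirichletCharacter ℂ N} (hχ : χ ^ 2 = 1) (n : ℕ) :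
    χ n = 0 ∨ χ n = 1 ∨ χ n = -1 := MulChar.isQuadratic_iff_sq_eq_one.mpr hχ n

lemma charArith_one_mul_prime_pow_of_neg {χ : DirichletCharacter ℂ N} {p : ℕ}
    (hp : p.Prime) (hu : IsUnit (p : ZMod N)) (h : χ p = -1) (k : ℕ) :
    (charArith (1 : DirichletCharacter ℂ N) * charArith χ) (p ^ k) =
      if _root_.Even (k + 1) then 0 else 1 := by
  rw [arith_mul_prime_pow _ _ hp]
  simp_rw [charArith_prime_pow _ hp, MulChar.one_apply hu, one_pow, one_mul]
  have := sum_range_reflect (fun i => (χ p) ^ i) (k + 1)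
  rw [h, neg_one_geom_sum] at this
  rw [← this, h]
  rfl

lemma charArith_one_mul_prime_pow {χ : DirichletCharacter ℂ N} (hχ : χ ^ 2 = 1) {p : ℕ}
    (hp : p.Prime) (k : ℕ) : 0 ≤ (charArith (1 : DirichletCharacter ℂ N) * charArith χ) (p ^ k) := by
  rw [arith_mul_prime_pow _ _ hp]
  simp_rw [charArith_prime_pow _ hp]
  by_cases hu : IsUnit (p : ZMod N)
  · simp_rw [MulChar.one_apply hu, one_pow, one_mul]
    rcases char_values hχ p with h | h | h
    · exact absurd (hu.map χ) (by rw [h]; simp)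
    · exact sum_nonneg fun i _ => by rw [h]; simp
    · have := charArith_one_mul_prime_pow_of_neg hp hu h k
      rw [arith_mul_prime_pow _ _ hp] at this
      simp_rw [charArith_prime_pow _ hp, MulChar.one_apply hu, one_pow, one_mul] at this
      rw [this]
      split_ifs <;> simp
  · simp_rw [MulChar.map_nonunit _ hu]
    exact sum_nonneg fun i _ => mul_nonneg (pow_nonneg le_rfl _) (pow_nonneg le_rfl _)

lemma charArith_one_mul_nonneg {χ : DirichletCharacter ℂ N} (hχ : χ ^ 2 = 1) (n : ℕ) :
    0 ≤ (charArith (1 : DirichletCharacter ℂ N) * charArith χ) n :=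
  multiplicative_nonneg ((charArith_isMultiplicative (1 : DirichletCharacter ℂ N)).mul (charArith_isMultiplicative χ))
    (fun _ k hp => charArith_one_mul_prime_pow hχ hp k) n

lemma charArith_mul_prime_pow (χ ψ : DirichletCharacter ℂ N) {p : ℕ}
    (hp : p.Prime) (hu : IsUnit (p : ZMod N)) (k : ℕ) :
    (charArith ψ * charArith (χ * ψ)) (p ^ k) =
      ψ p ^ k * (charArith (1 : DirichletCharacter ℂ N) * charArith χ) (p ^ k) := by
  rw [arith_mul_prime_pow _ _ hp, arith_mul_prime_pow _ _ hp, mul_sum]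
  refine sum_congr rfl fun i hi => ?_
  simp_rw [charArith_prime_pow _ hp, MulChar.mul_apply, MulChar.one_apply hu]
  rw [show k = i + (k - i) by have := mem_range.1 hi; omega, pow_add, mul_pow]
  simp
  ring

lemma charArith_four_nonneg_aux {χ ψ : DirichletCharacter ℂ N} (hχ : χ ^ 2 = 1) {p : ℕ}
    (hp : p.Prime) (hu : IsUnit (p : ZMod N)) (hψ : ψ p = 1) (k : ℕ) :
    0 ≤ ((charArith (1 : DirichletCharacter ℂ N) * charArith χ) * (charArith ψ * charArith (χ * ψ))) (p ^ k) := by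
  rw [arith_mul_prime_pow _ _ hp]
  refine sum_nonneg fun i _ => ?_
  rw [charArith_mul_prime_pow _ _ hp hu, hψ, one_pow, one_mul]
  exact mul_nonneg (charArith_one_mul_prime_pow hχ hp _) (charArith_one_mul_prime_pow hχ hp _)

lemma charArith_four_nonneg {χ ψ : DirichletCharacter ℂ N} (hχ : χ ^ 2 = 1) (hψ : ψ ^ 2 = 1)
    (n : ℕ) :
    0 ≤ ((charArith (1 : DirichletCharacter ℂ N) * charArith χ) * (charArith ψ * charArith (χ * ψ))) n := by
  refine multiplicative_nonneg (((charArith_isMultiplicative (1 : DirichletCharacter ℂ N)).mul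
    (charArith_isMultiplicative χ)).mul ((charArith_isMultiplicative ψ).mul
    (charArith_isMultiplicative _))) (fun p k hp => ?_) n
  by_cases hu : IsUnit (p : ZMod N)
  · rcases char_values hψ p with h | h | h
    · exact absurd (hu.map ψ) (by rw [h]; simp)
    · exact charArith_four_nonneg_aux hχ hp hu h k
    · rcases char_values hχ p with h' | h' | h'
      · exact absurd (hu.map χ) (by rw [h']; simp)
      · have := charArith_four_nonneg_aux hψ hp hu h' k
        rw [show charArith (1 : DirichletCharacter ℂ N) * charArith χ * (charArith ψ * charArith (χ * ψ)) =
          charArith (1 : DirichletCharacter ℂ N) * charArith ψ * (charArith χ * charArith (ψ * χ)) by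
            rw [mul_comm ψ χ]; ring]
        exact this
      · rw [arith_mul_prime_pow _ _ hp]
        refine sum_nonneg fun i _ => ?_
        rw [charArith_mul_prime_pow _ _ hp hu, h, charArith_one_mul_prime_pow_of_neg hp hu h',
          charArith_one_mul_prime_pow_of_neg hp hu h']
        split_ifs with h1 h2 h2
        · simp
        · simp
        · simp
        · have : _root_.Even (k - i) := by
            rw [Nat.even_add_one, not_not] at h2; exact h2
          rw [this.neg_one_pow]; simp
  · rw [arith_mul_prime_pow _ _ hp]
    refine sum_nonneg fun i _ => ?_
    rw [arith_mul_prime_pow _ _ hp, arith_mul_prime_pow _ _ hp]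
    refine mul_nonneg (sum_nonneg fun i _ => ?_) (sum_nonneg fun i _ => ?_)
    all_goals
      simp_rw [charArith_prime_pow _ hp, MulChar.map_nonunit _ hu]
      exact mul_nonneg (pow_nonneg le_rfl _) (pow_nonneg le_rfl _)

end Vaughan

namespace Vaughan
open MeasureTheory Filter Topology Asymptotics DirichletCharacter
open scoped ComplexOrder Nat ComplexConjugate

variable {N : ℕ} [NeZero N]

lemma trivChar₁_eq {s : ℂ} (hs : s ≠ 1) :
    LFunctionTrivChar₁ N s = (s - 1) * LFunction (1 : DirichletCharacter ℂ N) s := by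
  rw [LFunctionTrivChar₁, Function.update_of_ne hs]

lemma trivChar₁_eq_regL {s : ℂ} (hs : s ≠ 0) :
    LFunctionTrivChar₁ N s = s * regL (1 : DirichletCharacter ℂ N) s := by
  rw [regL_one]; field_simp

lemma norm_trivChar₁_one_le : ‖LFunctionTrivChar₁ N 1‖ ≤ 1 := by
  rw [LFunctionTrivChar₁, Function.update_self, norm_prod]
  refine prod_le_one (fun _ _ => norm_nonneg _) fun p hp => ?_
  have hp := (Nat.prime_of_mem_primeFactors hp).two_le
  have h2 : (p:ℝ)⁻¹ ≤ 1 := inv_le_one_of_one_le₀ (by exact_mod_cast (by omega : 1 ≤ p))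
  have h0 : (0:ℝ) ≤ (p:ℝ)⁻¹ := by positivity
  rw [show (1:ℂ) - (p:ℂ)⁻¹ = ((1 - (p:ℝ)⁻¹ : ℝ) : ℂ) by push_cast; rfl, Complex.norm_real,
    Real.norm_eq_abs, abs_le]
  constructor <;> linarith

/-- Crude polynomial bound in the box used for the Taylor expansion around `2`. -/
lemma exists_regL_box_bound : ∃ C : ℝ, 1 ≤ C ∧ ∀ (N : ℕ) [NeZero N] (χ : DirichletCharacter ℂ N)
    (s : ℂ), 3 / 4 ≤ s.re → s.re ≤ 4 → |s.im| ≤ 2 → ‖regL χ s‖ ^ 2 ≤ C * N := by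
  obtain ⟨C, hC, h⟩ := exists_regL_bound (ε := 1 / 4) (by norm_num) le_rfl
  refine ⟨C ^ 2 * 4, by nlinarith, fun N _ χ s h1 h2 h3 => ?_⟩
  have := h N χ s (by linarith) h2
  have hc := two_le_cond (N := N) s
  have hc' : cond N s ≤ N * 4 := by unfold cond; gcongr; linarith
  calc _ ≤ (C * cond N s ^ (2 * (1 / 4) : ℝ)) ^ 2 := by gcongr
    _ = C ^ 2 * cond N s := by
      rw [mul_pow, ← Real.rpow_natCast (cond N s ^ _), ← Real.rpow_mul (by linarith)]; norm_num
    _ ≤ C ^ 2 * (N * 4) := by gcongr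
    _ = _ := by ring

lemma norm_le_six {s : ℂ} (h1 : 3 / 4 ≤ s.re) (h2 : s.re ≤ 4) (h3 : |s.im| ≤ 2) : ‖s‖ ≤ 6 := by
  have := Complex.norm_le_abs_re_add_abs_im s
  rw [abs_of_pos (by linarith)] at this
  linarith

/-- A quadratic `L`-function without a sign change on `[β, 1)`. -/
lemma exists_lower_bound_of_nonneg : ∃ K : ℝ, 1 ≤ K ∧ ∀ (N : ℕ) [NeZero N]
    (χ : DirichletCharacter ℂ N), χ ^ 2 = 1 → χ ≠ 1 → ∀ β : ℝ, 7 / 8 ≤ β → β < 1 →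
    0 ≤ (LFunctionTrivChar₁ N β * LFunction χ β).re →
    (1 - β) / 6 * (K * N) ^ (-(10 * (1 - β))) ≤ ‖LFunction χ 1‖ := by
  obtain ⟨C, hC, hb⟩ := exists_regL_box_bound
  refine ⟨160 * (6 * C), by linarith, fun N _ χ hχ hχ1 β h1 h2 h3 => ?_⟩
  have hN1 : (1:ℝ) ≤ N := by exact_mod_cast Nat.pos_of_ne_zero (NeZero.ne N)
  have key := residue_lower_bound (g := fun s => LFunctionTrivChar₁ N s * LFunction χ s)
    (a := ⇑((charArith (1 : DirichletCharacter ℂ N) * charArith χ : ArithmeticFunction ℂ))) (B := 6 * C * N)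
    (charArith_one_mul_nonneg hχ)
    ((charArith_isMultiplicative _).mul (charArith_isMultiplicative _)).1
    (fun s hs => ArithmeticFunction.LSeriesSummable_mul (charArith_summable _ hs)
      (charArith_summable _ hs))
    ((differentiable_LFunctionTrivChar₁ N).mul (differentiable_LFunction hχ1)).differentiableOn
    (by nlinarith) ?_ ?_ h1 h2 h3
  · refine le_trans (le_trans (le_of_eq (by ring_nf)) key) ?_
    refine (Complex.re_le_norm _).trans ?_
    rw [norm_mul]
    have := norm_trivChar₁_one_le (N := N)
    nlinarith [norm_nonneg (LFunction χ 1)]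
  · intro s h1 h2 h3
    have hs0 : s ≠ 0 := by rintro rfl; norm_num at h1
    have b1 := hb N 1 s h1 h2 h3
    have b2 := hb N χ s h1 h2 h3
    rw [regL_of_ne hχ1] at b2
    rw [trivChar₁_eq_regL hs0, norm_mul, norm_mul, mul_assoc, mul_assoc]
    refine mul_le_mul (norm_le_six h1 h2 h3) ?_ (by positivity) (by norm_num)
    nlinarith [sq_nonneg (‖regL (1 : DirichletCharacter ℂ N) s‖ - ‖LFunction χ s‖)]
  · intro s hs
    have hs1 : s ≠ 1 := by rintro rfl; simp at hs
    rw [trivChar₁_eq hs1, ArithmeticFunction.LSeries_mul' (charArith_summable _ hs)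
      (charArith_summable _ hs), charArith_LSeries _ hs, charArith_LSeries _ hs]
    ring

lemma exists_lower_bound_of_zero : ∃ K : ℝ, 1 ≤ K ∧ ∀ (N : ℕ) [NeZero N]
    (χ ψ : DirichletCharacter ℂ N), χ ^ 2 = 1 → χ ≠ 1 → ψ ^ 2 = 1 → ψ ≠ 1 → χ * ψ ≠ 1 →
    ∀ β : ℝ, 7 / 8 ≤ β → β < 1 → LFunction ψ β = 0 →
    (1 - β) / 6 * (K * N ^ 2) ^ (-(10 * (1 - β))) ≤
      ‖LFunction χ 1‖ * (‖LFunction ψ 1‖ * ‖LFunction (χ * ψ) 1‖) := by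
  obtain ⟨C, hC, hb⟩ := exists_regL_box_bound
  refine ⟨160 * (6 * C ^ 2), by nlinarith, fun N _ χ ψ hχ hχ1 hψ hψ1 hχψ β h1 h2 h3 => ?_⟩
  have hN1 : (1:ℝ) ≤ N := by exact_mod_cast Nat.pos_of_ne_zero (NeZero.ne N)
  have hsm : ∀ (χ ψ : DirichletCharacter ℂ N) {s : ℂ}, 1 < s.re →
      LSeriesSummable ⇑(charArith χ * charArith ψ : ArithmeticFunction ℂ) s := fun χ ψ s hs =>
    ArithmeticFunction.LSeriesSummable_mul (charArith_summable _ hs) (charArith_summable _ hs)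
  have key := residue_lower_bound (g := fun s => (LFunctionTrivChar₁ N s * LFunction χ s) *
      (LFunction ψ s * LFunction (χ * ψ) s))
    (a := ⇑(((charArith (1 : DirichletCharacter ℂ N) * charArith χ) *
      (charArith ψ * charArith (χ * ψ)) : ArithmeticFunction ℂ))) (B := 6 * C ^ 2 * N ^ 2)
    (charArith_four_nonneg hχ hψ)
    (((charArith_isMultiplicative _).mul (charArith_isMultiplicative _)).mul
      ((charArith_isMultiplicative _).mul (charArith_isMultiplicative _))).1
    (fun s hs => ArithmeticFunction.LSeriesSummable_mul (hsm _ _ hs) (hsm _ _ hs))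
    (((differentiable_LFunctionTrivChar₁ N).mul (differentiable_LFunction hχ1)).mul
      ((differentiable_LFunction hψ1).mul (differentiable_LFunction hχψ))).differentiableOn
    (by have : 1 ≤ C ^ 2 := by nlinarith
        have : (1:ℝ) ≤ (N:ℝ) ^ 2 := by nlinarith
        nlinarith) ?_ ?_ h1 h2 (by simp [h3])
  · refine le_trans (le_trans (le_of_eq (by ring_nf)) key) ?_
    refine (Complex.re_le_norm _).trans ?_
    rw [norm_mul, norm_mul, norm_mul, mul_assoc]
    have := norm_trivChar₁_one_le (N := N)
    refine mul_le_of_le_one_left (by positivity) this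
  · intro s h1 h2 h3
    have hs0 : s ≠ 0 := by rintro rfl; norm_num at h1
    have b1 := hb N 1 s h1 h2 h3
    have b2 := hb N χ s h1 h2 h3
    have b3 := hb N ψ s h1 h2 h3
    have b4 := hb N (χ * ψ) s h1 h2 h3
    rw [regL_of_ne hχ1] at b2
    rw [regL_of_ne hψ1] at b3
    rw [regL_of_ne hχψ] at b4
    rw [trivChar₁_eq_regL hs0, norm_mul, norm_mul, norm_mul, norm_mul]
    calc _ = ‖s‖ * ((‖regL (1 : DirichletCharacter ℂ N) s‖ * ‖LFunction χ s‖) *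
        (‖LFunction ψ s‖ * ‖LFunction (χ * ψ) s‖)) := by ring
      _ ≤ 6 * ((C * N) * (C * N)) := by
        refine mul_le_mul (norm_le_six h1 h2 h3) (mul_le_mul ?_ ?_ (by positivity) (by positivity))
          (by positivity) (by norm_num)
        · nlinarith [sq_nonneg (‖regL (1 : DirichletCharacter ℂ N) s‖ - ‖LFunction χ s‖)]
        · nlinarith [sq_nonneg (‖LFunction ψ s‖ - ‖LFunction (χ * ψ) s‖)]
      _ = _ := by ring
  · intro s hs
    have hs1 : s ≠ 1 := by rintro rfl; simp at hs
    rw [trivChar₁_eq hs1, ArithmeticFunction.LSeries_mul' (hsm _ _ hs) (hsm _ _ hs),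
      ArithmeticFunction.LSeries_mul' (charArith_summable _ hs)
      (charArith_summable _ hs), ArithmeticFunction.LSeries_mul' (charArith_summable _ hs)
      (charArith_summable _ hs), charArith_LSeries _ hs, charArith_LSeries _ hs,
      charArith_LSeries _ hs, charArith_LSeries _ hs]
    ring

/-- Quadratic `L`-functions are real on the real axis. -/
lemma LFunction_im_eq_zero {χ : DirichletCharacter ℂ N} (hχ : χ ^ 2 = 1) (hχ1 : χ ≠ 1) (x : ℝ) :
    (LFunction χ x).im = 0 := by
  have hd := differentiable_LFunction hχ1
  have hd2 : Differentiable ℂ (conj ∘ LFunction χ ∘ conj) := fun s =>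
    differentiableAt_conj_conj_iff.2 (hd _)
  have heq : conj ∘ LFunction χ ∘ conj = LFunction χ := by
    refine AnalyticOnNhd.eq_of_eventuallyEq (z₀ := 2) (fun s _ => hd2.analyticAt s)
      (fun s _ => hd.analyticAt s) ?_
    have : {s : ℂ | 1 < s.re} ∈ 𝓝 (2:ℂ) :=
      (isOpen_lt continuous_const Complex.continuous_re).mem_nhds (by simp)
    filter_upwards [this] with s hs
    have hs' : (1:ℝ) < s.re := hs
    have hs'' : 1 < (conj s).re := by simpa using hs'
    simp only [Function.comp_apply]
    rw [χ.LFunction_eq_LSeries hs', χ.LFunction_eq_LSeries hs'', LSeries, LSeries, 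
      Complex.conj_tsum]
    refine tsum_congr fun n => ?_
    rcases eq_or_ne n 0 with rfl | hn
    · simp
    · rw [LSeries.term_of_ne_zero hn, LSeries.term_of_ne_zero hn, map_div₀]
      congr 1
      · rcases char_values hχ n with h | h | h <;> rw [h] <;> simp
      · have ha : ((n:ℂ)).arg ≠ Real.pi := by
          rw [Complex.natCast_arg]; exact Real.pi_ne_zero.symm
        rw [Complex.cpow_conj _ _ ha]; simp
  have := congrFun heq x
  simp only [Function.comp_apply, Complex.conj_ofReal] at this
  exact Complex.conj_eq_iff_im.1 this

end Vaughan

namespace Vaughan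
open MeasureTheory Filter Topology Asymptotics DirichletCharacter
open scoped ComplexOrder Nat ComplexConjugate

variable {N : ℕ} [NeZero N]

lemma trivChar₁_im_eq_zero (x : ℝ) : (LFunctionTrivChar₁ N x).im = 0 := by
  have hd := differentiable_LFunctionTrivChar₁ N
  have hd2 : Differentiable ℂ (conj ∘ LFunctionTrivChar₁ N ∘ conj) := fun s =>
    differentiableAt_conj_conj_iff.2 (hd _)
  have heq : conj ∘ LFunctionTrivChar₁ N ∘ conj = LFunctionTrivChar₁ N := by
    refine AnalyticOnNhd.eq_of_eventuallyEq (z₀ := 2) (fun s _ => hd2.analyticAt s)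
      (fun s _ => hd.analyticAt s) ?_
    have : {s : ℂ | 1 < s.re} ∈ 𝓝 (2:ℂ) :=
      (isOpen_lt continuous_const Complex.continuous_re).mem_nhds (by simp)
    filter_upwards [this] with s hs
    have hs' : (1:ℝ) < s.re := hs
    have hs'' : 1 < (conj s).re := by simpa using hs'
    have hs1 : s ≠ 1 := by rintro rfl; simp at hs'
    have hs2 : conj s ≠ 1 := by intro h; rw [h] at hs''; simp at hs''
    simp only [Function.comp_apply]
    rw [trivChar₁_eq hs1, trivChar₁_eq hs2, LFunction_eq_LSeries _ hs',
      LFunction_eq_LSeries _ hs'', LSeries, LSeries, map_mul, Complex.conj_tsum]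
    congr 1
    · simp
    refine tsum_congr fun n => ?_
    rcases eq_or_ne n 0 with rfl | hn
    · simp
    · rw [LSeries.term_of_ne_zero hn, LSeries.term_of_ne_zero hn, map_div₀]
      congr 1
      · rcases char_values (one_pow 2 : (1 : DirichletCharacter ℂ N) ^ 2 = 1) n with h | h | h <;>
          rw [h] <;> simp
      · have ha : ((n:ℂ)).arg ≠ Real.pi := by
          rw [Complex.natCast_arg]; exact Real.pi_ne_zero.symm
        rw [Complex.cpow_conj _ _ ha]; simp
  have := congrFun heq x
  simp only [Function.comp_apply, Complex.conj_ofReal] at this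
  exact Complex.conj_eq_iff_im.1 this

lemma trivChar₁_mul_LFunction_one_re_nonneg {χ : DirichletCharacter ℂ N} (hχ : χ ^ 2 = 1)
    (hχ1 : χ ≠ 1) : 0 ≤ (LFunctionTrivChar₁ N 1 * LFunction χ 1).re := by
  have hc : Continuous fun x : ℝ => (LFunctionTrivChar₁ N x * LFunction χ x).re := by
    have h1 := (differentiable_LFunctionTrivChar₁ N).continuous
    have h2 := (differentiable_LFunction hχ1).continuous
    exact Complex.continuous_re.comp ((h1.comp Complex.continuous_ofReal).mul
      (h2.comp Complex.continuous_ofReal))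
  have ht := (hc.tendsto 1).mono_left (nhdsWithin_le_nhds (s := Set.Ioi 1))
  simp only [Complex.ofReal_one] at ht
  refine ge_of_tendsto ht ?_
  filter_upwards [self_mem_nhdsWithin] with x hx
  have hx : 1 < x := hx
  have hx' : 1 < (x:ℂ).re := by simpa using hx
  have hx1 : (x:ℂ) ≠ 1 := by norm_cast; exact hx.ne'
  rw [trivChar₁_eq hx1, mul_assoc, ← charArith_LSeries _ hx', ← charArith_LSeries _ hx',
    ← ArithmeticFunction.LSeries_mul' (charArith_summable _ hx') (charArith_summable _ hx')]
  have h0 : 0 ≤ LSeries ⇑(charArith (1 : DirichletCharacter ℂ N) * charArith χ :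
      ArithmeticFunction ℂ) x := by
    refine tsum_nonneg fun n => ?_
    exact LSeries.term_nonneg (charArith_one_mul_nonneg hχ n) x
  rw [show (x:ℂ) - 1 = ((x - 1 : ℝ) : ℂ) by push_cast; ring, Complex.re_ofReal_mul]
  exact mul_nonneg (by linarith) (Complex.nonneg_iff.1 h0).1

lemma exists_real_zero {χ : DirichletCharacter ℂ N} (hχ : χ ^ 2 = 1) (hχ1 : χ ≠ 1) {β : ℝ}
    (hβ : β < 1) (hneg : (LFunctionTrivChar₁ N β * LFunction χ β).re < 0) :
    ∃ x : ℝ, β ≤ x ∧ x < 1 ∧ LFunctionTrivChar₁ N x * LFunction χ x = 0 := by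
  have hc : Continuous fun x : ℝ => (LFunctionTrivChar₁ N x * LFunction χ x).re := by
    have h1 := (differentiable_LFunctionTrivChar₁ N).continuous
    have h2 := (differentiable_LFunction hχ1).continuous
    exact Complex.continuous_re.comp ((h1.comp Complex.continuous_ofReal).mul
      (h2.comp Complex.continuous_ofReal))
  have h1 := trivChar₁_mul_LFunction_one_re_nonneg hχ hχ1
  obtain ⟨x, hx, hx0⟩ := intermediate_value_Icc hβ.le hc.continuousOn
    (show (0:ℝ) ∈ _ from ⟨hneg.le, by simpa using h1⟩)
  have hz : LFunctionTrivChar₁ N x * LFunction χ x = 0 := by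
    refine Complex.ext hx0 ?_
    rw [Complex.mul_im, trivChar₁_im_eq_zero, LFunction_im_eq_zero hχ hχ1]
    simp
  refine ⟨x, hx.1, lt_of_le_of_ne hx.2 ?_, hz⟩
  rintro rfl
  rw [Complex.ofReal_one] at hz
  rcases mul_eq_zero.1 hz with h | h
  · exact LFunctionTrivChar₁_apply_one_ne_zero _ h
  · exact LFunction_apply_one_ne_zero hχ1 h

/-- Comparing `L(χ, 1)` with the value for the induced character. -/
lemma norm_LFunction_changeLevel_le (N₁ : ℕ) [NeZero N₁] {χ : DirichletCharacter ℂ N}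
    (hχ1 : χ ≠ 1) :
    ‖LFunction (changeLevel (dvd_mul_right N N₁) χ) 1‖ ≤ ‖LFunction χ 1‖ * 2 ^ N₁ := by
  rw [LFunction_changeLevel _ _ (.inl hχ1), norm_mul, norm_prod]
  refine mul_le_mul_of_nonneg_left ?_ (norm_nonneg _)
  have h1 : ∀ p ∈ (N * N₁).primeFactors, ‖1 - χ p * (p:ℂ) ^ (-1:ℂ)‖ ≤ if p ∣ N then 1 else 2 := by
    intro p hp
    have hpp := Nat.prime_of_mem_primeFactors hp
    split_ifs with h
    · have : χ p = 0 := by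
        refine χ.map_nonunit ?_
        rw [ZMod.isUnit_iff_coprime, Nat.Prime.coprime_iff_not_dvd hpp]
        simpa using h
      simp [this]
    · calc _ ≤ ‖(1:ℂ)‖ + ‖χ p * (p:ℂ) ^ (-1:ℂ)‖ := norm_sub_le _ _
        _ ≤ 1 + 1 * 1 := by
          rw [norm_one, norm_mul]
          gcongr
          · exact χ.norm_le_one _
          · rw [Complex.cpow_neg_one, norm_inv, Complex.norm_natCast]
            exact inv_le_one_of_one_le₀ (by exact_mod_cast hpp.one_le)
        _ = 2 := by norm_num
  refine (prod_le_prod (fun _ _ => norm_nonneg _) h1).trans ?_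
  rw [prod_ite, prod_const_one, one_mul, prod_const]
  refine pow_le_pow_right₀ (by norm_num) ?_
  calc _ ≤ N₁.primeFactors.card := by
        refine card_le_card fun p hp => ?_
        rw [mem_filter, Nat.mem_primeFactors] at hp
        rw [Nat.mem_primeFactors]
        exact ⟨hp.1.1, ((hp.1.1.dvd_mul).1 hp.1.2.1).resolve_left hp.2, NeZero.ne _⟩
    _ ≤ (Finset.Icc 1 N₁).card := by
        refine card_le_card fun p hp => ?_
        rw [Nat.mem_primeFactors] at hp
        exact mem_Icc.2 ⟨hp.1.one_le, Nat.le_of_dvd (Nat.pos_of_ne_zero hp.2.2) hp.2.1⟩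
    _ = N₁ := by simp

lemma trivChar₁_eq_zero_of_riemannZeta {s : ℂ} (hs : s ≠ 1) (h : riemannZeta s = 0) :
    LFunctionTrivChar₁ N s = 0 := by
  rw [trivChar₁_eq hs]
  have := LFunctionTrivChar_eq_mul_riemannZeta (N := N) hs
  rw [LFunctionTrivChar] at this
  rw [this, h]; simp

lemma riemannZeta_eq_zero_of_trivChar₁ {x : ℝ} (hx0 : 0 < x) (hx : x ≠ 1)
    (h : LFunctionTrivChar₁ N x = 0) : riemannZeta x = 0 := by
  have hs : (x:ℂ) ≠ 1 := by norm_cast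
  rw [trivChar₁_eq hs, mul_eq_zero, or_iff_right (sub_ne_zero.2 hs)] at h
  have := LFunctionTrivChar_eq_mul_riemannZeta (N := N) hs
  rw [LFunctionTrivChar] at this
  rw [this, mul_eq_zero] at h
  refine h.resolve_left (Finset.prod_ne_zero_iff.2 fun p hp => ?_)
  have hp := Nat.prime_of_mem_primeFactors hp
  rw [sub_ne_zero]
  intro h
  have h2 : ‖(p:ℂ) ^ (-(x:ℂ))‖ < 1 := by
    rw [Complex.norm_natCast_cpow_of_pos hp.pos]
    exact Real.rpow_lt_one_of_one_lt_of_neg (by exact_mod_cast hp.one_lt) (by simpa using hx0)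
  rw [← h] at h2
  simp at h2

end Vaughan

namespace Vaughan
open MeasureTheory Filter Topology Asymptotics DirichletCharacter
open scoped ComplexOrder Nat ComplexConjugate

lemma exists_LFunction_one_bound {ε : ℝ} (hε : 0 < ε) : ∃ C : ℝ, 1 ≤ C ∧ ∀ (N : ℕ) [NeZero N]
    (χ : DirichletCharacter ℂ N), χ ≠ 1 → ‖LFunction χ 1‖ ≤ C * (N : ℝ) ^ ε := by
  obtain ⟨C, hC, h⟩ := exists_regL_bound (ε := min (ε / 2) (1 / 4)) (by positivity)
    (min_le_right _ _)
  refine ⟨C * 2 ^ ε, ?_, fun N _ χ hχ => ?_⟩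
  · have := Real.one_le_rpow (x := 2) (by norm_num) hε.le
    nlinarith
  have h0 : (0:ℝ) < min (ε / 2) (1 / 4) := by positivity
  have h1 := h N χ 1 (by simp; linarith) (by simp)
  rw [regL_of_ne hχ] at h1
  refine h1.trans ?_
  rw [mul_assoc]
  gcongr
  have hN : (1:ℝ) ≤ N := by exact_mod_cast Nat.pos_of_ne_zero (NeZero.ne N)
  rw [← Real.mul_rpow (by norm_num) (by linarith)]
  have hc : cond N 1 = 2 * N := by simp [cond]; ring
  rw [hc]
  exact Real.rpow_le_rpow_of_exponent_le (by linarith) (by linarith [min_le_left (ε / 2) (1 / 4)])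

lemma rpow_neg_mul_le {K b e : ℝ} {j : ℕ} (hK : 1 ≤ K) {N N₁ : ℝ} (hN : 1 ≤ N)
    (hN₁ : 1 ≤ N₁) (hb : b ≤ e) :
    (K * N₁ ^ j) ^ (-e) * N ^ (-(j * e)) ≤ (K * (N * N₁) ^ j) ^ (-b) := by
  have h1 : 1 ≤ (N * N₁) ^ j := one_le_pow₀ (by nlinarith)
  calc _ = (K * (N * N₁) ^ j) ^ (-e) := by
        rw [mul_pow, show K * (N ^ j * N₁ ^ j) = (K * N₁ ^ j) * N ^ j by ring,
          Real.mul_rpow (x := K * N₁ ^ j) (by positivity) (by positivity), ← Real.rpow_natCast N,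
          ← Real.rpow_mul (by linarith), mul_neg]
    _ ≤ _ := Real.rpow_le_rpow_of_exponent_le (by nlinarith) (by linarith)

/-- Siegel's lower bound for quadratic characters. -/
theorem exists_siegel_bound {ε : ℝ} (hε : 0 < ε) : ∃ c : ℝ, 0 < c ∧ ∀ (N : ℕ) [NeZero N]
    (χ : DirichletCharacter ℂ N), χ ^ 2 = 1 → χ ≠ 1 → c * (N : ℝ) ^ (-ε) ≤ ‖LFunction χ 1‖ := by
  obtain ⟨K, hK, hA⟩ := exists_lower_bound_of_nonneg
  set η := min (1 / 8) (ε / 60) with hη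
  have hη0 : 0 < η := by positivity
  have hη8 : η ≤ 1 / 8 := min_le_left _ _
  have hηε : η ≤ ε / 60 := min_le_right _ _
  have hbase : ∀ (N : ℕ) [NeZero N] (χ : DirichletCharacter ℂ N), χ ^ 2 = 1 → χ ≠ 1 →
      ∀ β : ℝ, 1 - η ≤ β → β < 1 → 0 ≤ (LFunctionTrivChar₁ N β * LFunction χ β).re →
      ((1 - β) / 6 * K ^ (-(10 * η))) * (N : ℝ) ^ (-ε) ≤ ‖LFunction χ 1‖ := by
    intro N _ χ hχ hχ1 β h1 h2 h3
    have hN : (1:ℝ) ≤ N := by exact_mod_cast Nat.pos_of_ne_zero (NeZero.ne N)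
    refine le_trans ?_ (hA N χ hχ hχ1 β (by linarith) h2 h3)
    rw [mul_assoc]
    gcongr
    have := rpow_neg_mul_le (j := 1) hK (e := 10 * η) (b := 10 * (1 - β)) hN le_rfl
      (by linarith)
    simp only [pow_one, mul_one, Nat.cast_one, one_mul] at this
    refine le_trans ?_ this
    gcongr
    · linarith
  by_cases hz : ∃ β : ℝ, 1 - η ≤ β ∧ β < 1 ∧ riemannZeta β = 0
  · obtain ⟨β, h1, h2, h3⟩ := hz
    refine ⟨(1 - β) / 6 * K ^ (-(10 * η)), by have : 0 < 1 - β := by linarith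
                                              positivity, fun N _ χ hχ hχ1 => ?_⟩
    refine hbase N χ hχ hχ1 β h1 h2 ?_
    rw [trivChar₁_eq_zero_of_riemannZeta (by norm_cast; exact h2.ne) h3]; simp
  by_cases hL : ∃ (N₁ : ℕ) (_ : NeZero N₁) (ψ : DirichletCharacter ℂ N₁) (β : ℝ), ψ ^ 2 = 1 ∧ ψ ≠ 1 ∧
      1 - η ≤ β ∧ β < 1 ∧ LFunction ψ β = 0
  · obtain ⟨N₁, _, ψ, β, hψ, hψ1, h1, h2, h3⟩ := hL
    obtain ⟨K', hK', hB⟩ := exists_lower_bound_of_zero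
    obtain ⟨D, hD, hDb⟩ := exists_LFunction_one_bound (ε := ε / 6) (by linarith)
    have hN₁ : (1:ℝ) ≤ N₁ := by exact_mod_cast Nat.pos_of_ne_zero (NeZero.ne N₁)
    have hβ : 0 < 1 - β := by linarith
    set c₁ := (1 - β) / 6 * K ^ (-(10 * η)) * (N₁ : ℝ) ^ (-ε) / 2 ^ N₁ with hc₁
    set c₂ := (1 - β) / 6 * (K' * N₁ ^ 2) ^ (-(10 * η)) / (2 ^ N₁ * (D ^ 2 * N₁ ^ (ε / 3)))
      with hc₂
    have hc₁0 : 0 < c₁ := by positivity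
    have hc₂0 : 0 < c₂ := by positivity
    refine ⟨min c₁ c₂, lt_min hc₁0 hc₂0, fun N _ χ hχ hχ1 => ?_⟩
    have hN : (1:ℝ) ≤ N := by exact_mod_cast Nat.pos_of_ne_zero (NeZero.ne N)
    have hcl := norm_LFunction_changeLevel_le N₁ hχ1
    set χ' := changeLevel (dvd_mul_right N N₁) χ with hχ'
    set ψ₁ := changeLevel (dvd_mul_left N₁ N) ψ with hψ₁
    have a1 : χ' ^ 2 = 1 := by rw [hχ', ← map_pow, hχ, map_one]
    have a2 : ψ₁ ^ 2 = 1 := by rw [hψ₁, ← map_pow, hψ, map_one]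
    have a3 : χ' ≠ 1 := fun h => hχ1 ((changeLevel_eq_one_iff _).1 h)
    have a4 : ψ₁ ≠ 1 := fun h => hψ1 ((changeLevel_eq_one_iff _).1 h)
    have a5 : LFunction ψ₁ β = 0 := by
      rw [hψ₁, LFunction_changeLevel _ _ (.inl hψ1), h3, zero_mul]
    by_cases hχψ : χ' * ψ₁ = 1
    · have : χ' = ψ₁ := by
        have h := congrArg (· * ψ₁) hχψ
        simp only [mul_assoc, ← pow_two, a2] at h
        simpa using h
      have hb := hbase _ χ' a1 a3 β h1 h2 (by rw [this, a5]; simp)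
      calc _ ≤ c₁ * (N:ℝ) ^ (-ε) := by gcongr; exact min_le_left _ _
        _ = ((1 - β) / 6 * K ^ (-(10 * η)) * ((N * N₁ : ℕ) : ℝ) ^ (-ε)) / 2 ^ N₁ := by
          rw [Nat.cast_mul, Real.mul_rpow (by linarith) (by linarith), hc₁]; ring
        _ ≤ (‖LFunction χ 1‖ * 2 ^ N₁) / 2 ^ N₁ := div_le_div_of_nonneg_right (hb.trans hcl) (by positivity)
        _ = _ := by field_simp
    · have hb := hB _ χ' ψ₁ a1 a3 a2 a4 hχψ β (by linarith) h2 a5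
      have d1 := hDb _ ψ₁ a4
      have d2 := hDb _ (χ' * ψ₁) hχψ
      have hM : ((N * N₁ : ℕ) : ℝ) ^ (ε / 6) * ((N * N₁ : ℕ) : ℝ) ^ (ε / 6) =
          (N:ℝ) ^ (ε / 3) * (N₁:ℝ) ^ (ε / 3) := by
        rw [← Real.rpow_add (by push_cast; positivity), Nat.cast_mul,
          Real.mul_rpow (by linarith) (by linarith)]
        ring_nf
      have hr := rpow_neg_mul_le (j := 2) hK' (e := 10 * η) (b := 10 * (1 - β)) hN
        hN₁ (by linarith)
      have hchain : (1 - β) / 6 * ((K' * N₁ ^ 2) ^ (-(10 * η)) * (N:ℝ) ^ (-((2:ℕ) * (10 * η)))) ≤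
          (‖LFunction χ 1‖ * 2 ^ N₁) * (D ^ 2 * ((N:ℝ) ^ (ε / 3) * (N₁:ℝ) ^ (ε / 3))) := by
        calc _ ≤ (1 - β) / 6 * (K' * ((N * N₁ : ℕ) : ℝ) ^ 2) ^ (-(10 * (1 - β))) := by
              rw [Nat.cast_mul]
              exact mul_le_mul_of_nonneg_left hr (by positivity)
          _ ≤ _ := hb
          _ ≤ (‖LFunction χ 1‖ * 2 ^ N₁) * ((D * ((N * N₁ : ℕ) : ℝ) ^ (ε / 6)) *
              (D * ((N * N₁ : ℕ) : ℝ) ^ (ε / 6))) := by gcongr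
          _ = _ := by rw [← hM]; ring
      have hexp : (N:ℝ) ^ (-ε) ≤ (N:ℝ) ^ (-((2:ℕ) * (10 * η))) / (N:ℝ) ^ (ε / 3) := by
        rw [← Real.rpow_sub (by linarith)]
        refine Real.rpow_le_rpow_of_exponent_le hN ?_
        push_cast
        linarith
      calc _ ≤ c₂ * ((N:ℝ) ^ (-((2:ℕ) * (10 * η))) / (N:ℝ) ^ (ε / 3)) := by
            gcongr; exact min_le_right _ _
        _ = ((1 - β) / 6 * ((K' * N₁ ^ 2) ^ (-(10 * η)) * (N:ℝ) ^ (-((2:ℕ) * (10 * η))))) /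
            (2 ^ N₁ * (D ^ 2 * ((N:ℝ) ^ (ε / 3) * (N₁:ℝ) ^ (ε / 3)))) := by
          rw [hc₂]; field_simp
        _ ≤ ((‖LFunction χ 1‖ * 2 ^ N₁) * (D ^ 2 * ((N:ℝ) ^ (ε / 3) * (N₁:ℝ) ^ (ε / 3)))) / 
            (2 ^ N₁ * (D ^ 2 * ((N:ℝ) ^ (ε / 3) * (N₁:ℝ) ^ (ε / 3)))) := by gcongr
        _ = _ := by field_simp
  · refine ⟨η / 6 * K ^ (-(10 * η)), by positivity, fun N _ χ hχ hχ1 => ?_⟩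
    have := hbase N χ hχ hχ1 (1 - η) le_rfl (by linarith) ?_
    · simpa using this
    by_contra hneg
    obtain ⟨x, hx1, hx2, hx⟩ := exists_real_zero hχ hχ1 (by linarith) (not_le.1 hneg)
    rcases mul_eq_zero.1 hx with h | h
    · exact hz ⟨x, hx1, hx2, riemannZeta_eq_zero_of_trivChar₁ (by linarith) hx2.ne h⟩
    · exact hL ⟨N, inferInstance, χ, x, hχ, hχ1, hx1, hx2, h⟩

lemma exists_trivChar₁_one_bound {ε : ℝ} (hε : 0 < ε) : ∃ c : ℝ, 0 < c ∧ ∀ (N : ℕ) [NeZero N],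
    c * (N : ℝ) ^ (-ε) ≤ ‖LFunctionTrivChar₁ N 1‖ := by
  obtain ⟨P, hP⟩ := ((tendsto_rpow_neg_atTop hε).comp tendsto_natCast_atTop_atTop
    |>.eventually_le_const (show (0:ℝ) < 1 / 2 by norm_num)).exists_forall_of_atTop
  refine ⟨(1 / 2) ^ P, by positivity, fun N _ => ?_⟩
  have hN : (1:ℝ) ≤ N := by exact_mod_cast Nat.pos_of_ne_zero (NeZero.ne N)
  rw [LFunctionTrivChar₁, Function.update_self, norm_prod]
  have h1 : ∀ p ∈ N.primeFactors, (if p < P then (1 / 2 : ℝ) else 1) * (p:ℝ) ^ (-ε) ≤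
      ‖1 - (p:ℂ)⁻¹‖ := by
    intro p hp
    have hp := Nat.prime_of_mem_primeFactors hp
    have hp2 : (2:ℝ) ≤ p := by exact_mod_cast hp.two_le
    have h2 : (p:ℝ)⁻¹ ≤ 1 / 2 := by rw [one_div]; gcongr
    rw [show (1:ℂ) - (p:ℂ)⁻¹ = ((1 - (p:ℝ)⁻¹ : ℝ) : ℂ) by push_cast; rfl, Complex.norm_real,
      Real.norm_of_nonneg (by linarith)]
    have h3 : (p:ℝ) ^ (-ε) ≤ 1 := Real.rpow_le_one_of_one_le_of_nonpos (by linarith) (by linarith)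
    split_ifs with h
    · linarith
    · have := hP p (not_lt.1 h)
      simp only [Function.comp_apply] at this
      linarith
  refine le_trans ?_ (prod_le_prod (fun _ _ => by positivity) h1)
  rw [prod_mul_distrib, prod_ite, prod_const_one, mul_one, prod_const,
    Real.finsetProd_rpow _ _ (fun _ _ => by positivity)]
  refine mul_le_mul ?_ ?_ (by positivity) (by positivity)
  · refine pow_le_pow_of_le_one (by norm_num) (by norm_num) ?_
    calc _ ≤ (range P).card := card_le_card fun p hp => by
          rw [mem_filter] at hp; exact mem_range.2 hp.2
      _ = P := card_range P
  · rw [← Nat.cast_prod]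
    refine Real.rpow_le_rpow_of_nonpos ?_ ?_ (by linarith)
    · exact_mod_cast prod_pos fun p hp => (Nat.prime_of_mem_primeFactors hp).pos
    · exact_mod_cast Nat.le_of_dvd (Nat.pos_of_ne_zero (NeZero.ne N)) (Nat.prod_primeFactors_dvd N)

/-- Lower bound at `1` for the regularised quadratic `L`-functions, principal case included. -/
lemma exists_regL_one_bound {ε : ℝ} (hε : 0 < ε) : ∃ c : ℝ, 0 < c ∧ ∀ (N : ℕ) [NeZero N]
    (χ : DirichletCharacter ℂ N), χ ^ 2 = 1 → c * (N : ℝ) ^ (-ε) ≤ ‖regL χ 1‖ := by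
  obtain ⟨c₁, h1, hb1⟩ := exists_siegel_bound hε
  obtain ⟨c₂, h2, hb2⟩ := exists_trivChar₁_one_bound hε
  refine ⟨min c₁ c₂, lt_min h1 h2, fun N _ χ hχ => ?_⟩
  rcases eq_or_ne χ 1 with rfl | hχ1
  · simp only [regL_one, div_one]
    refine le_trans ?_ (hb2 N)
    gcongr; exact min_le_right _ _
  · rw [regL_of_ne hχ1]
    refine le_trans ?_ (hb1 N χ hχ hχ1)
    gcongr; exact min_le_left _ _

end Vaughan

namespace Vaughan
open MeasureTheory Filter Topology Asymptotics DirichletCharacter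

lemma cond_mono {N : ℕ} {s w : ℂ} (h : |s.im| ≤ |w.im|) : cond N s ≤ cond N w := by
  unfold cond; gcongr

variable {N : ℕ} [NeZero N]

lemma exists_regL_deriv_bound {ε : ℝ} (hε : 0 < ε) : ∃ C η : ℝ, 1 ≤ C ∧ 0 < η ∧ η ≤ 1 / 8 ∧
    ∀ (N : ℕ) [NeZero N] (χ : DirichletCharacter ℂ N) (s : ℂ), 1 - η ≤ s.re → s.re ≤ 3 →
      ‖regL χ s‖ ≤ C * cond N s ^ ε ∧ ‖deriv (regL χ) s‖ ≤ C * cond N s ^ ε := by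
  set e := min (ε / 2) (1 / 4) with he
  have he0 : 0 < e := by positivity
  have he4 : e ≤ 1 / 4 := min_le_right _ _
  have hee : 2 * e ≤ ε := by linarith [min_le_left (ε / 2) (1 / 4)]
  obtain ⟨C, hC, h⟩ := exists_regL_bound he0 he4
  have hb : ∀ (N : ℕ) [NeZero N] (χ : DirichletCharacter ℂ N) (s : ℂ), 1 - e ≤ s.re → s.re ≤ 4 →
      ‖regL χ s‖ ≤ C * cond N s ^ ε := fun N _ χ s h1 h2 => (h N χ s h1 h2).trans <| by
    have := two_le_cond (N := N) s
    gcongr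
    linarith
  have h2ε : (1:ℝ) ≤ 2 ^ ε := Real.one_le_rpow (by norm_num) hε.le
  refine ⟨C * 2 ^ ε / (e / 2), e / 2, ?_, by positivity, by linarith, fun N _ χ s h1 h2 => ?_⟩
  · rw [le_div_iff₀ (by positivity)]; nlinarith
  have hX := two_le_cond (N := N) s
  have hpos : 0 < cond N s ^ ε := by positivity
  constructor
  · refine (hb N χ s (by linarith) (by linarith)).trans ?_
    gcongr
    rw [le_div_iff₀ (by positivity)]
    nlinarith
  · have := Complex.norm_deriv_le_of_forall_mem_sphere_norm_le (c := s) (R := e / 2)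
      (C := C * (2 ^ ε * cond N s ^ ε)) (f := regL χ) (by positivity) ?_ ?_
    · refine this.trans (le_of_eq (by ring))
    · refine DifferentiableOn.diffContOnCl fun w hw => ?_
      rw [closure_ball _ (by positivity), Metric.mem_closedBall, dist_eq_norm] at hw
      refine (differentiableAt_regL χ ?_).differentiableWithinAt
      rintro rfl
      have := (Complex.abs_re_le_norm _).trans hw
      rw [abs_le] at this
      simp at this
      linarith
    · intro w hw
      rw [mem_sphere_iff_norm] at hw
      have h3 := (Complex.abs_re_le_norm _).trans hw.le
      have h4 := (Complex.abs_im_le_norm _).trans hw.le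
      rw [abs_le, Complex.sub_re] at h3
      rw [Complex.sub_im] at h4
      refine (hb N χ w (by linarith) (by linarith)).trans ?_
      rw [← Real.mul_rpow (by norm_num) (by linarith)]
      have := two_le_cond (N := N) w
      gcongr
      unfold cond
      have h5 : |w.im| ≤ |s.im| + e / 2 := by
        have := abs_sub_abs_le_abs_sub w.im s.im
        linarith
      have hN : (0:ℝ) ≤ N := by positivity
      nlinarith [abs_nonneg s.im]

lemma norm_regL_sub_le {C η ε : ℝ} (hC : 0 ≤ C) (hε : 0 ≤ ε) {χ : DirichletCharacter ℂ N}
    (h : ∀ s : ℂ, 1 - η ≤ s.re → s.re ≤ 3 → ‖deriv (regL χ) s‖ ≤ C * cond N s ^ ε)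
    (hη : η ≤ 1 / 8) {s w : ℂ} (hs : 1 - η ≤ s.re) (hs' : s.re ≤ 3) (hw : 1 - η ≤ w.re)
    (hw' : w.re ≤ 3) (him : |w.im| ≤ |s.im|) :
    ‖regL χ s - regL χ w‖ ≤ C * cond N s ^ ε * ‖s - w‖ := by
  have hconv : Convex ℝ (Set.Icc (1 - η) 3 ×ℂ Set.Icc (-|s.im|) |s.im|) :=
    
    (Convex.linear_preimage (convex_Icc (1 - η) 3) Complex.reLm).inter
      (Convex.linear_preimage (convex_Icc (-|s.im|) |s.im|) Complex.imLm)
  refine hconv.norm_image_sub_le_of_norm_deriv_le (𝕜 := ℂ) (fun z hz => ?_) (fun z hz => ?_) ?_ ?_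
  · refine differentiableAt_regL χ ?_
    rintro rfl
    rw [Complex.mem_reProdIm] at hz
    have := hz.1.1
    simp at this
    linarith
  · rw [Complex.mem_reProdIm] at hz
    refine (h z hz.1.1 hz.1.2).trans ?_
    have := two_le_cond (N := N) z
    have := cond_mono (N := N) (abs_le.2 hz.2)
    gcongr
  · exact ⟨⟨hw, hw'⟩, abs_le.1 him⟩
  · exact ⟨⟨hs, hs'⟩, abs_le.1 le_rfl⟩

end Vaughan

namespace Vaughan
open MeasureTheory Filter Topology Asymptotics DirichletCharacter

variable {N : ℕ} [NeZero N]

lemma norm_div_sub_one_le {w : ℂ} {d : ℝ} (hd : 0 < d) (hd1 : d ≤ 1) (h : d ≤ ‖w - 1‖) :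
    ‖w / (w - 1)‖ ≤ 2 / d := by
  have h0 : w - 1 ≠ 0 := by
    intro h0; rw [h0, norm_zero] at h; linarith
  rw [show w / (w - 1) = 1 + (w - 1)⁻¹ by field_simp; ring]
  calc _ ≤ ‖(1:ℂ)‖ + ‖(w - 1)⁻¹‖ := norm_add_le _ _
    _ ≤ 1 / d + 1 / d := by
      rw [norm_one, norm_inv, ← one_div ‖w - 1‖]
      gcongr
      rw [le_div_iff₀ hd]; linarith
    _ = 2 / d := by ring

lemma LFunction_one_eq_regL {w : ℂ} (h0 : w ≠ 0) (h1 : w ≠ 1) :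
    LFunction (1 : DirichletCharacter ℂ N) w =
      w / (w - 1) * regL (1 : DirichletCharacter ℂ N) w := by
  have := sub_ne_zero.2 h1
  have h2 := trivChar₁_eq_regL (N := N) h0
  rw [trivChar₁_eq h1] at h2
  field_simp
  rw [mul_comm, ← h2]

lemma norm_LFunction_le_regL {χ : DirichletCharacter ℂ N} {w : ℂ} {d : ℝ} (hd : 0 < d)
    (hd1 : d ≤ 1) (hw : 1 < w.re) (h : χ ≠ 1 ∨ d ≤ ‖w - 1‖) :
    ‖LFunction χ w‖ ≤ 2 / d * ‖regL χ w‖ := by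
  rcases eq_or_ne χ 1 with rfl | hχ
  · have h := h.resolve_left (by simp)
    rw [LFunction_one_eq_regL (by rintro rfl; simp at hw; linarith) (by rintro rfl; simp at hw),
      norm_mul]
    gcongr
    exact norm_div_sub_one_le hd hd1 h
  · rw [regL_of_ne hχ]
    refine le_mul_of_one_le_left (norm_nonneg _) ?_
    rw [le_div_iff₀ hd]; linarith

/-- The `3-4-1` inequality as a lower bound, away from the possible pole. -/
lemma regL_three_four_one {C η ε δ : ℝ} (hC : 1 ≤ C) (hε : 0 ≤ ε) (hε1 : ε ≤ 1) (hδ : 0 < δ)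
    (hδ1 : δ ≤ 1) {χ : DirichletCharacter ℂ N} (hη : 0 < η)
    (h : ∀ (ψ : DirichletCharacter ℂ N) (s : ℂ), 1 - η ≤ s.re → s.re ≤ 3 →
      ‖regL ψ s‖ ≤ C * cond N s ^ ε) {x y : ℝ} (hx : 0 < x) (hx1 : x ≤ 1)
    (hns : χ ^ 2 ≠ 1 ∨ δ ≤ |y| ∨ δ ≤ x) {u : ℝ} (hu : (N * (|y| + 2) : ℝ) ^ ε = u) :
    x ^ 3 ≤ (2 * C * u) ^ 3 * (2 / δ * ‖regL χ (1 + x + Complex.I * y)‖) ^ 4 *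
      (2 / δ * (2 * C * u)) := by
  have hN : (1:ℝ) ≤ N := by exact_mod_cast Nat.pos_of_ne_zero (NeZero.ne N)
  have hX : (2:ℝ) ≤ N * (|y| + 2) := by nlinarith [abs_nonneg y]
  have hu0 : 0 < u := by rw [← hu]; positivity
  have key := norm_LFunction_product_ge_one (N := N) χ hx y
  rw [norm_mul, norm_mul, norm_pow, norm_pow] at key
  have b1 : x * ‖LFunctionTrivChar N (1 + x)‖ ≤ 2 * C * u := by
    have e1 : (1 + (x:ℂ)) ≠ 0 := by norm_cast; linarith
    have e2 : (1 + (x:ℂ)) ≠ 1 := by simpa using hx.ne'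
    rw [LFunctionTrivChar, LFunction_one_eq_regL e1 e2, norm_mul, norm_div]
    have e3 : ‖1 + (x:ℂ) - 1‖ = x := by simp [abs_of_pos hx]
    have e4 : ‖1 + (x:ℂ)‖ ≤ 2 := by
      refine (norm_add_le _ _).trans ?_
      simp [abs_of_pos hx]; linarith
    have e5 : ‖regL (1 : DirichletCharacter ℂ N) (1 + x)‖ ≤ C * u := by
      refine (h 1 (1 + x) (by simp; linarith) (by simp; linarith)).trans ?_
      rw [← hu]
      have := two_le_cond (N := N) (1 + x)
      gcongr
      unfold cond
      gcongr ?_ * (?_ + _)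
      simp
    rw [e3]
    calc _ = ‖1 + (x:ℂ)‖ * ‖regL (1 : DirichletCharacter ℂ N) (1 + x)‖ := by field_simp
      _ ≤ 2 * (C * u) := by gcongr
      _ = _ := by ring
  have b2 : ‖LFunction χ (1 + x + Complex.I * y)‖ ≤
      2 / δ * ‖regL χ (1 + x + Complex.I * y)‖ := by
    refine norm_LFunction_le_regL hδ hδ1 (by simp [hx]) ?_
    rcases hns with h | h | h
    · left; rintro rfl; exact h (one_pow 2)
    · right; refine h.trans ?_
      refine le_trans (le_of_eq ?_) (Complex.abs_im_le_norm _); simp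
    · right; refine h.trans ?_
      refine le_trans (le_of_eq ?_) (Complex.abs_re_le_norm _); simp [abs_of_pos hx]
  have b3 : ‖LFunction (χ ^ 2) (1 + x + 2 * Complex.I * y)‖ ≤ 2 / δ * (2 * C * u) := by
    refine (norm_LFunction_le_regL hδ hδ1 (by simp [hx]) ?_).trans ?_
    · rcases hns with h | h | h
      · exact .inl h
      · right; refine h.trans ?_
        refine le_trans ?_ (Complex.abs_im_le_norm _)
        simp [abs_mul]
        linarith [abs_nonneg y]
      · right; refine h.trans ?_
        refine le_trans (le_of_eq ?_) (Complex.abs_re_le_norm _); simp [abs_of_pos hx]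
    · have h2 := h (χ ^ 2) (1 + x + 2 * Complex.I * y) (by simp; linarith) (by simp; linarith)
      have h3 : cond N (1 + x + 2 * Complex.I * y) ^ ε ≤ 2 * u := by
        have hc : cond N (1 + x + 2 * Complex.I * y) ≤ 2 * (N * (|y| + 2)) := by
          simp only [cond]
          simp [abs_mul]
          linarith
        have := two_le_cond (N := N) (1 + x + 2 * Complex.I * y)
        calc _ ≤ (2 * (N * (|y| + 2)) : ℝ) ^ ε := by gcongr
          _ = 2 ^ ε * u := by rw [Real.mul_rpow (by norm_num) (by linarith), hu]
          _ ≤ 2 ^ (1:ℝ) * u := by gcongr; norm_num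
          _ = 2 * u := by norm_num
      have h4 : ‖regL (χ ^ 2) (1 + x + 2 * Complex.I * y)‖ ≤ 2 * C * u := by nlinarith
      gcongr
  calc x ^ 3 ≤ x ^ 3 * (‖LFunctionTrivChar N (1 + x)‖ ^ 3 *
      ‖LFunction χ (1 + x + Complex.I * y)‖ ^ 4 *
      ‖LFunction (χ ^ 2) (1 + x + 2 * Complex.I * y)‖) := le_mul_of_one_le_right (by positivity) key
    _ = (x * ‖LFunctionTrivChar N (1 + x)‖) ^ 3 * ‖LFunction χ (1 + x + Complex.I * y)‖ ^ 4 *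
      ‖LFunction (χ ^ 2) (1 + x + 2 * Complex.I * y)‖ := by ring
    _ ≤ _ := by gcongr

lemma four_root_bound {C u a δ K κ x₀ x p : ℝ} (hC : 1 ≤ C) (hu1 : 1 ≤ u) (ha0 : 0 < a)
    (ha1 : a ≤ 1) (hδ : δ = a / (4 * C * u ^ 2)) (hK : K = 16 * C ^ 2 / a) (hκ0 : 0 < κ)
    (hκK : κ * (256 * K ^ 8 * C ^ 4) ≤ 1) (hx₀ : x₀ = κ * (u ^ 18)⁻¹) (hxx₀ : x₀ ≤ x)
    (hp0 : 0 ≤ p)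
    (key : x ^ 3 ≤ (2 * C * u) ^ 3 * (2 / δ * p) ^ 4 * (2 / δ * (2 * C * u))) :
    4 * C * u * x₀ ≤ p := by
  by_contra! hlt
  have hx₀0 : 0 < x₀ := by rw [hx₀]; positivity
  have hK0 : 0 < K := by rw [hK]; positivity
  have e1 : 2 / δ = 8 * C / a * u ^ 2 := by rw [hδ]; field_simp; norm_num
  have e2 : 8 * C / a ≤ K := by rw [hK]; gcongr ?_ / a; nlinarith
  have e3 : 2 * C ≤ K := by
    refine le_trans ?_ e2
    rw [le_div_iff₀ ha0]; nlinarith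
  have f1 : 2 / δ * p ≤ K * u ^ 2 * p := by rw [e1]; gcongr
  have f2 : 2 / δ * (2 * C * u) = K * u ^ 3 := by rw [e1, hK]; ring
  have f3 : 0 ≤ 2 / δ * p := by rw [e1]; positivity
  have : x₀ ^ 3 < x₀ ^ 3 := by
    calc x₀ ^ 3 ≤ x ^ 3 := by gcongr
      _ ≤ _ := key
      _ ≤ (K * u) ^ 3 * (K * u ^ 2 * p) ^ 4 * (K * u ^ 3) := by
        rw [f2]
        refine mul_le_mul_of_nonneg_right (mul_le_mul ?_ (pow_le_pow_left₀ f3 f1 4) (by positivity)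
          (by positivity)) (by positivity)
        exact pow_le_pow_left₀ (by positivity) (mul_le_mul_of_nonneg_right e3 (by linarith)) 3
      _ < (K * u) ^ 3 * (K * u ^ 2 * (4 * C * u * x₀)) ^ 4 * (K * u ^ 3) := by
        refine mul_lt_mul_of_pos_right (mul_lt_mul_of_pos_left ?_ (by positivity)) (by positivity)
        refine pow_lt_pow_left₀ (mul_lt_mul_of_pos_left hlt (by positivity)) (by positivity)
          (by norm_num)
      _ = (κ * (256 * K ^ 8 * C ^ 4)) * (u ^ 18 * (u ^ 18)⁻¹) * x₀ ^ 3 := by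
        rw [hx₀]; ring
      _ ≤ 1 * 1 * x₀ ^ 3 := by
        rw [mul_inv_cancel₀ (by positivity)]
        gcongr
      _ = x₀ ^ 3 := by ring
  exact lt_irrefl _ this

set_option maxHeartbeats 800000 in
/-- Lower bound for the regularised `L`-functions in a zero-free region. -/
theorem exists_regL_lower_bound {ε : ℝ} (hε : 0 < ε) (hε1 : ε ≤ 1) : ∃ c : ℝ, 0 < c ∧ c ≤ 1 / 8 ∧
    ∀ (N : ℕ) [NeZero N] (χ : DirichletCharacter ℂ N) (s : ℂ), 1 - c * cond N s ^ (-ε) ≤ s.re →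
      s.re ≤ 2 → c * cond N s ^ (-ε) ≤ ‖regL χ s‖ := by
  set e := ε / 18 with he
  have he0 : 0 < e := by positivity
  obtain ⟨C, η, hC, hη, hη8, hb⟩ := exists_regL_deriv_bound he0
  obtain ⟨a', ha', ha⟩ := exists_regL_one_bound he0
  set a := min a' 1 with haa
  have ha0 : 0 < a := lt_min ha' one_pos
  have ha1 : a ≤ 1 := min_le_right _ _
  set K := 16 * C ^ 2 / a with hK
  have hK16 : 16 / a ≤ K := by rw [hK]; gcongr; nlinarith
  have h16 : 16 ≤ 16 / a := by rw [le_div_iff₀ ha0]; nlinarith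
  have hK1 : 1 ≤ K := by linarith
  have hKK : K ≤ K ^ 8 := le_self_pow₀ hK1 (by norm_num)
  set κ := min η (1 / (256 * K ^ 8 * C ^ 4)) with hκ
  have hκ0 : 0 < κ := by positivity
  have hκη : κ ≤ η := min_le_left _ _
  have hκK : κ * (256 * K ^ 8 * C ^ 4) ≤ 1 := by
    rw [← le_div_iff₀ (by positivity)]; exact min_le_right _ _
  have hκa : κ ≤ a / 4096 := by
    have h1 : 1 ≤ C ^ 4 := one_le_pow₀ hC
    have h2 : κ * (256 * (16 / a)) ≤ 1 := by
      refine le_trans ?_ hκK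
      have h2 : 16 / a ≤ K ^ 8 := by linarith
      have h3 : 256 * (16 / a) * 1 ≤ 256 * K ^ 8 * C ^ 4 := by gcongr
      rw [mul_one] at h3
      gcongr
    rw [show κ * (256 * (16 / a)) = κ / (a / 4096) by field_simp; norm_num,
      div_le_one (by positivity)] at h2
    exact h2
  refine ⟨κ, hκ0, hκη.trans hη8, fun N _ χ s hs hs2 => ?_⟩
  set X := cond N s with hX
  have hX2 : 2 ≤ X := two_le_cond s
  set u := X ^ e with hu
  have hu1 : 1 ≤ u := Real.one_le_rpow (by linarith) he0.le
  have hu18 : X ^ (-ε) = (u ^ 18)⁻¹ := by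
    rw [Real.rpow_neg (by linarith), hu, ← Real.rpow_natCast, ← Real.rpow_mul (by linarith), he]
    congr 2; push_cast; ring
  rw [hu18] at hs ⊢
  have hu18' : 1 ≤ u ^ 18 := one_le_pow₀ hu1
  set x₀ := κ * (u ^ 18)⁻¹ with hx₀
  have hx₀0 : 0 < x₀ := by positivity
  have hx₀κ : x₀ ≤ κ := mul_le_of_le_one_right hκ0.le (inv_le_one_of_one_le₀ hu18')
  set δ := a / (4 * C * u ^ 2) with hδ
  have hδ0 : 0 < δ := by positivity
  have hu2 : 1 ≤ u ^ 2 := one_le_pow₀ hu1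
  have hCu2 : 1 ≤ C * u ^ 2 := one_le_mul_of_one_le_of_one_le hC hu2
  have hδ1 : δ ≤ 1 := by
    rw [hδ, div_le_one (by positivity)]; nlinarith
  set x := max (s.re - 1) x₀ with hx
  have hx0 : 0 < x := lt_of_lt_of_le hx₀0 (le_max_right _ _)
  have hxx₀ : x₀ ≤ x := le_max_right _ _
  have hx1 : x ≤ 1 := max_le (by linarith) (by linarith)
  have hd := fun w h1 h2 => (hb N χ w h1 h2).2
  by_cases hns : χ ^ 2 ≠ 1 ∨ δ ≤ |s.im| ∨ δ ≤ x
  · have key := regL_three_four_one (χ := χ) hC he0.le (by linarith) hδ0 hδ1 hη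
      (fun ψ w h1 h2 => (hb N ψ w h1 h2).1) hx0 hx1 hns (u := u) rfl
    set p := ‖regL χ (1 + x + Complex.I * s.im)‖ with hp
    have hlow : 4 * C * u * x₀ ≤ p := by
      exact four_root_bound hC hu1 ha0 ha1 hδ hK hκ0 hκK hx₀ hxx₀ (norm_nonneg _) key
    have hpert := norm_regL_sub_le (by linarith) he0.le hd hη8 (s := s)
      (w := 1 + x + Complex.I * s.im) (by linarith) (by linarith) (by simp; linarith)
      (by simp; linarith) (by simp)
    have hdist : ‖s - (1 + x + Complex.I * s.im)‖ ≤ 2 * x₀ := by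
      have : s - (1 + x + Complex.I * s.im) = ((s.re - 1 - x : ℝ) : ℂ) := by
        apply Complex.ext <;> simp; ring
      rw [this, Complex.norm_real, Real.norm_eq_abs, abs_le]
      constructor
      · rcases max_choice (s.re - 1) x₀ with h | h <;> rw [← hx] at h <;> linarith
      · linarith [le_max_left (s.re - 1) x₀]
    have h3 : C * u * ‖s - (1 + x + Complex.I * s.im)‖ ≤ C * u * (2 * x₀) := by gcongr
    have h4 := norm_sub_norm_le (regL χ (1 + x + Complex.I * s.im)) (regL χ s)
    rw [norm_sub_rev] at h4
    have h5 : 1 ≤ C * u := one_le_mul_of_one_le_of_one_le hC hu1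
    have h6 : x₀ ≤ C * u * (2 * x₀) := by nlinarith
    linarith
  · push Not at hns
    obtain ⟨h1, h2, h3⟩ := hns
    have hpert := norm_regL_sub_le (by linarith) he0.le hd hη8 (s := s) (w := 1)
      (by linarith) (by linarith) (by simp; linarith) (by simp) (by simp)
    have hdist : ‖s - 1‖ ≤ 2 * δ := by
      refine (Complex.norm_le_abs_re_add_abs_im _).trans ?_
      have : |(s - 1).re| ≤ δ := by
        rw [abs_le]; simp
        have := le_max_left (s.re - 1) x₀
        constructor <;> linarith
      have h4 : |(s - 1).im| ≤ δ := by simpa using h2.le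
      linarith
    have h4 := ha N χ h1
    have h5 : a / u ≤ ‖regL χ 1‖ := by
      refine le_trans ?_ h4
      rw [Real.rpow_neg (by positivity), div_eq_mul_inv]
      have hN : (1:ℝ) ≤ N := by exact_mod_cast Nat.pos_of_ne_zero (NeZero.ne N)
      have : (N:ℝ) ≤ X := by rw [hX, cond]; nlinarith [abs_nonneg s.im]
      have hNu : (N:ℝ) ^ e ≤ u := Real.rpow_le_rpow (by linarith) this he0.le
      have haa' : a ≤ a' := min_le_left _ _
      exact mul_le_mul haa' (inv_anti₀ (Real.rpow_pos_of_pos (by linarith) _) hNu)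
        (inv_nonneg.2 (by linarith)) ha'.le
    have hCu : 0 ≤ C * u := mul_nonneg (by linarith) (by linarith)
    have h6 : C * u * ‖s - 1‖ ≤ C * u * (2 * δ) := mul_le_mul_of_nonneg_left hdist hCu
    have h7 : C * u * (2 * δ) = a / u / 2 := by rw [hδ]; field_simp; norm_num
    have h8 := norm_sub_norm_le (regL χ 1) (regL χ s)
    rw [norm_sub_rev] at h8
    have h9 : x₀ ≤ a / u / 2 := by
      rw [hx₀, ← div_eq_mul_inv, div_right_comm]
      have : u ≤ u ^ 18 := le_self_pow₀ hu1 (by norm_num)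
      have h10 : κ ≤ a / 2 := by linarith
      gcongr
    linarith

end Vaughan

namespace Vaughan
open MeasureTheory Filter Topology Asymptotics DirichletCharacter
open ArithmeticFunction.vonMangoldt LSeries

/-- The regular part of `ζ` at its pole. -/
noncomputable def zetaRegular : ℂ → ℂ := dslope (LFunctionTrivChar₁ 1) 1

lemma trivChar₁_level_one : LFunctionTrivChar₁ 1 1 = 1 := by
  rw [LFunctionTrivChar₁, Function.update_self]; simp

lemma differentiable_zetaRegular : Differentiable ℂ zetaRegular := by
  rw [← differentiableOn_univ]
  exact (Complex.differentiableOn_dslope univ_mem).2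
    (differentiable_LFunctionTrivChar₁ 1).differentiableOn

lemma zetaRegular_eq {s : ℂ} (hs : s ≠ 1) : zetaRegular s = riemannZeta s - (s - 1)⁻¹ := by
  have := sub_ne_zero.2 hs
  rw [zetaRegular, dslope_of_ne _ hs, slope_def_field, trivChar₁_level_one, trivChar₁_eq hs,
    LFunction_modOne_eq]
  field_simp

lemma norm_zetaRegular_le {C η ε : ℝ} (hC : 0 ≤ C) (hε : 0 ≤ ε) (hη : 0 < η) (hη8 : η ≤ 1 / 8)
    (h : ∀ s : ℂ, 1 - η ≤ s.re → s.re ≤ 3 →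
      ‖regL (1 : DirichletCharacter ℂ 1) s‖ ≤ C * cond 1 s ^ ε ∧
      ‖deriv (regL (1 : DirichletCharacter ℂ 1)) s‖ ≤ C * cond 1 s ^ ε) {s : ℂ}
    (hs : 1 - η ≤ s.re) (hs3 : s.re ≤ 3) : ‖zetaRegular s‖ ≤ 2 * C * cond 1 s ^ ε := by
  have hs0 : s ≠ 0 := by rintro rfl; simp at hs; linarith
  have h1 : LFunctionTrivChar₁ 1 = fun z => if z = 0 then LFunctionTrivChar₁ 1 0 else
      z * regL (1 : DirichletCharacter ℂ 1) z := by
    ext z; split_ifs with hz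
    · rw [hz]
    · exact trivChar₁_eq_regL hz
  rcases eq_or_ne s 1 with rfl | hs1
  · rw [zetaRegular, dslope_same]
    have hd := (differentiableAt_regL (1 : DirichletCharacter ℂ 1) (one_ne_zero)).hasDerivAt
    have h2 : HasDerivAt (fun z => z * regL (1 : DirichletCharacter ℂ 1) z)
        (1 * regL (1 : DirichletCharacter ℂ 1) 1 + 1 * deriv (regL (1 : DirichletCharacter ℂ 1)) 1)
        1 := (hasDerivAt_id (1:ℂ)).mul hd
    have h3 : LFunctionTrivChar₁ 1 =ᶠ[𝓝 1] fun z => z * regL (1 : DirichletCharacter ℂ 1) z := by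
      filter_upwards [isOpen_ne.mem_nhds (one_ne_zero : (1:ℂ) ≠ 0)] with z hz
      exact trivChar₁_eq_regL hz
    rw [h3.deriv_eq, h2.deriv, one_mul, one_mul]
    refine (norm_add_le _ _).trans ?_
    linarith [(h 1 hs hs3).1, (h 1 hs hs3).2]
  · have hn : s - 1 ≠ 0 := sub_ne_zero.2 hs1
    rw [zetaRegular, dslope_of_ne _ hs1, slope_def_field, norm_div,
      div_le_iff₀ (norm_pos_iff.2 hn), trivChar₁_eq_regL hs0, trivChar₁_eq_regL one_ne_zero]
    have h4 := norm_regL_sub_le hC hε (fun z hz hz' => (h z hz hz').2) hη8 hs hs3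
      (w := 1) (by simp [hη.le]) (by simp) (by simp)
    rw [show s * regL (1 : DirichletCharacter ℂ 1) s - 1 * regL 1 1 =
      (s - 1) * regL (1 : DirichletCharacter ℂ 1) s + (regL (1 : DirichletCharacter ℂ 1) s -
        regL 1 1) by ring]
    refine (norm_add_le _ _).trans ?_
    rw [norm_mul]
    nlinarith [(h s hs hs3).1, norm_nonneg (s - 1)]

variable {q : ℕ}

/-- The primes in a residue class, measured against their expected density. -/
noncomputable def resDiff (a : ZMod q) (n : ℕ) : ℂ := (residueClass a n : ℂ) - (q.totient : ℂ)⁻¹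

lemma resDiff_summable (a : ZMod q) {s : ℂ} (hs : 1 < s.re) : LSeriesSummable (resDiff a) s := by
  refine LSeriesSummable.sub ?_ ?_
  · exact LSeriesSummable_of_abscissaOfAbsConv_lt_re
      ((abscissaOfAbsConv_residueClass_le_one a).trans_lt (by exact_mod_cast hs))
  · have := (LSeriesSummable_one_iff.2 hs).smul (q.totient : ℂ)⁻¹
    convert this using 1
    ext; simp

lemma resDiff_abscissa (a : ZMod q) : abscissaOfAbsConv (resDiff a) ≤ 1 :=
  abscissaOfAbsConv_le_of_forall_lt_LSeriesSummable fun y hy => resDiff_summable a (by simpa using hy)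

variable [NeZero q]

/-- The analytic continuation of the Dirichlet series of `resDiff`. -/
noncomputable def resDiffL (a : ZMod q) (s : ℂ) : ℂ :=
  (q.totient : ℂ)⁻¹ * (∑ χ : DirichletCharacter ℂ q, χ a⁻¹ * (-(deriv (regL χ) s / regL χ s))
    - s⁻¹ - zetaRegular s)

lemma LFunction_logDeriv_eq (χ : DirichletCharacter ℂ q) {s : ℂ} (hs : 1 < s.re) :
    deriv (LFunction χ) s / LFunction χ s = deriv (regL χ) s / regL χ s +
      if χ = 1 then s⁻¹ - (s - 1)⁻¹ else 0 := by
  split_ifs with hχ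
  · subst hχ
    have hs1 : s ≠ 1 := by rintro rfl; simp at hs
    have hs0 : s ≠ 0 := by rintro rfl; simp at hs; linarith
    have h1 : s - 1 ≠ 0 := sub_ne_zero.2 hs1
    have hP : regL (1 : DirichletCharacter ℂ q) s ≠ 0 := by
      have h2 := LFunction_ne_zero_of_one_le_re (1 : DirichletCharacter ℂ q) (.inr hs1) hs.le
      rw [LFunction_one_eq_regL hs0 hs1] at h2
      exact right_ne_zero_of_mul h2
    have heq : LFunction (1 : DirichletCharacter ℂ q) =ᶠ[𝓝 s] fun w => w / (w - 1) *
        regL (1 : DirichletCharacter ℂ q) w := by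
      filter_upwards [isOpen_ne.mem_nhds hs0, isOpen_ne.mem_nhds hs1] with w h0 h1
      exact LFunction_one_eq_regL h0 h1
    have hd := (differentiableAt_regL (1 : DirichletCharacter ℂ q) hs0).hasDerivAt
    have hd2 := ((hasDerivAt_id s).div ((hasDerivAt_id s).sub_const 1) h1).mul hd
    rw [heq.deriv_eq, LFunction_one_eq_regL hs0 hs1]
    have := hd2.deriv
    simp only [id, Pi.div_apply] at this
    have e : deriv (fun w => w / (w - 1) * regL (1 : DirichletCharacter ℂ q) w) s = _ := this
    rw [e]
    field_simp
    ring
  · rw [regL_of_ne hχ, add_zero]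

lemma LSeries_resDiff {a : ZMod q} (ha : IsUnit a) {s : ℂ} (hs : 1 < s.re) :
    LSeries (resDiff a) s = resDiffL a s := by
  have hs1 : s ≠ 1 := by rintro rfl; simp at hs
  have h1 : LSeries (resDiff a) s = LSeries (fun n => (residueClass a n : ℂ)) s -
      (q.totient : ℂ)⁻¹ * riemannZeta s := by
    rw [← LSeries_one_eq_riemannZeta hs, ← LSeries_smul, ← LSeries_sub]
    · refine LSeries_congr (fun {n} _ => ?_) s
      simp [resDiff]
    · exact LSeriesSummable_of_abscissaOfAbsConv_lt_re
        ((abscissaOfAbsConv_residueClass_le_one a).trans_lt (by exact_mod_cast hs))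
    · exact (LSeriesSummable_one_iff.2 hs).smul _
  have h2 := zetaRegular_eq hs1
  rw [h1, LSeries_residueClass_eq ha hs, resDiffL, h2]
  simp_rw [LFunction_logDeriv_eq _ hs, mul_add, sum_add_distrib, mul_ite, mul_zero,
    sum_ite_eq' univ (1 : DirichletCharacter ℂ q), mem_univ, if_true]
  have hu : (1 : DirichletCharacter ℂ q) a⁻¹ = 1 := by
    refine MulChar.one_apply ?_
    obtain ⟨u, rfl⟩ := ha
    rw [ZMod.inv_coe_unit]
    exact Units.isUnit _
  rw [hu]
  simp_rw [mul_neg, sum_neg_distrib]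
  ring

end Vaughan

namespace Vaughan
open MeasureTheory Filter Topology Asymptotics DirichletCharacter
open ArithmeticFunction.vonMangoldt LSeries

variable {q : ℕ} [NeZero q]

lemma cond_one_le (s : ℂ) : cond 1 s ≤ cond q s := by
  have : (1:ℝ) ≤ q := by exact_mod_cast NeZero.one_le
  simp only [cond, Nat.cast_one]
  have := abs_nonneg s.im
  nlinarith

lemma norm_resDiffL_le {c C η e : ℝ} (hc : 0 < c) (hC : 1 ≤ C) (he : 0 < e) (hη : 0 < η)
    (hη8 : η ≤ 1 / 8)
    (hu : ∀ (N : ℕ) [NeZero N] (χ : DirichletCharacter ℂ N) (s : ℂ), 1 - η ≤ s.re → s.re ≤ 3 →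
      ‖regL χ s‖ ≤ C * cond N s ^ e ∧ ‖deriv (regL χ) s‖ ≤ C * cond N s ^ e)
    (hl : ∀ (N : ℕ) [NeZero N] (χ : DirichletCharacter ℂ N) (s : ℂ),
      1 - c * cond N s ^ (-e) ≤ s.re → s.re ≤ 2 → c * cond N s ^ (-e) ≤ ‖regL χ s‖)
    (a : ZMod q) {s : ℂ} (h1 : 1 - η ≤ s.re) (h2 : 1 - c * cond q s ^ (-e) ≤ s.re)
    (h3 : s.re ≤ 2) : ‖resDiffL a s‖ ≤ (C / c + 2 + 2 * C) * cond q s ^ (2 * e) := by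
  have hX := two_le_cond (N := q) s
  set X := cond q s with hXd
  have hX0 : 0 < X := by linarith
  have hXe : 1 ≤ X ^ e := Real.one_le_rpow (by linarith) he.le
  have hX2 : X ^ (2 * e) = X ^ e * X ^ e := by rw [two_mul, Real.rpow_add hX0]
  have hterm (χ : DirichletCharacter ℂ q) :
      ‖χ a⁻¹ * (-(deriv (regL χ) s / regL χ s))‖ ≤ C / c * X ^ (2 * e) := by
    rw [norm_mul, norm_neg, norm_div]
    have hlow := hl q χ s h2 h3
    have hpos : 0 < c * X ^ (-e) := by positivity
    have hup := (hu q χ s h1 (by linarith)).2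
    calc _ ≤ 1 * (C * X ^ e / (c * X ^ (-e))) := by
          gcongr
          exact norm_le_one χ _
      _ = _ := by
        rw [Real.rpow_neg hX0.le, hX2]; field_simp
  have hsum : ‖∑ χ : DirichletCharacter ℂ q, χ a⁻¹ * (-(deriv (regL χ) s / regL χ s))‖ ≤
      q.totient * (C / c * X ^ (2 * e)) := by
    refine (norm_sum_le_of_le _ fun χ _ => hterm χ).trans ?_
    rw [sum_const, nsmul_eq_mul, card_univ, ← Nat.card_eq_fintype_card,
      DirichletCharacter.card_eq_totient_of_hasEnoughRootsOfUnity ℂ q]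
  have hφ : (1:ℝ) ≤ q.totient := by exact_mod_cast Nat.totient_pos.2 (NeZero.pos q)
  have hinv : ‖s⁻¹‖ ≤ 2 := by
    rw [norm_inv]
    refine inv_le_of_inv_le₀ (by norm_num) ?_
    exact le_trans (by linarith) ((le_abs_self _).trans (Complex.abs_re_le_norm s))
  have hz : ‖zetaRegular s‖ ≤ 2 * C * X ^ e := by
    refine (norm_zetaRegular_le (by linarith) he.le hη hη8 (hu 1 1) h1 (by linarith)).trans ?_
    have := two_le_cond (N := 1) s
    gcongr
    exact cond_one_le s
  rw [resDiffL, norm_mul, norm_inv, Complex.norm_natCast, inv_mul_le_iff₀ (by linarith)]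
  calc _ ≤ q.totient * (C / c * X ^ (2 * e)) + 2 + 2 * C * X ^ e := by
        refine (norm_sub_le _ _).trans (add_le_add ((norm_sub_le _ _).trans
          (add_le_add hsum hinv)) hz)
    _ ≤ q.totient * (C / c * X ^ (2 * e)) + q.totient * (2 * X ^ (2 * e)) +
        q.totient * (2 * C * X ^ (2 * e)) := by
      have h5 : X ^ e ≤ X ^ (2 * e) := by rw [hX2]; nlinarith
      have h6 : 2 * X ^ (2 * e) ≤ q.totient * (2 * X ^ (2 * e)) :=
        le_mul_of_one_le_left (by positivity) hφ
      have h7 : 2 * C * X ^ (2 * e) ≤ q.totient * (2 * C * X ^ (2 * e)) :=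
        le_mul_of_one_le_left (by positivity) hφ
      have h8 : 2 * C * X ^ e ≤ 2 * C * X ^ (2 * e) := by gcongr
      linarith
    _ = _ := by ring

lemma differentiableAt_resDiffL (a : ZMod q) {s : ℂ} (hs : s ≠ 0)
    (h : ∀ χ : DirichletCharacter ℂ q, regL χ s ≠ 0) : DifferentiableAt ℂ (resDiffL a) s := by
  have hd (χ : DirichletCharacter ℂ q) : DifferentiableAt ℂ (deriv (regL χ)) s := by
    have : DifferentiableOn ℂ (regL χ) {0}ᶜ :=
      fun z hz => (differentiableAt_regL χ hz).differentiableWithinAt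
    exact (this.deriv isOpen_compl_singleton).differentiableAt
      (isOpen_compl_singleton.mem_nhds hs)
  unfold resDiffL
  refine DifferentiableAt.const_mul (DifferentiableAt.sub (DifferentiableAt.sub ?_ ?_) ?_) _
  · refine DifferentiableAt.fun_sum fun χ _ => ?_
    exact (((hd χ).div (differentiableAt_regL χ hs) (h χ)).neg).const_mul _
  · exact differentiableAt_inv hs
  · exact differentiable_zetaRegular s

theorem exists_logMul_LSeries_bound (k : ℕ) {ε : ℝ} (hε : 0 < ε) (hε1 : ε ≤ 1) :
    ∃ C : ℝ, 0 < C ∧ ∀ (q : ℕ) [NeZero q] (a : ZMod q), IsUnit a → ∀ s : ℂ, 1 < s.re →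
      s.re ≤ 3 / 2 → ‖LSeries (logMul^[k] (resDiff a)) s‖ ≤ C * cond q s ^ ε := by
  have hk : (0:ℝ) < k + 2 := by positivity
  set e : ℝ := ε / (k + 2) with he
  have he0 : 0 < e := by positivity
  have he1 : e ≤ 1 / 2 := by
    rw [he, div_le_iff₀ hk]; nlinarith [(Nat.cast_nonneg k : (0:ℝ) ≤ k)]
  obtain ⟨c, hc, hc8, hl⟩ := exists_regL_lower_bound he0 (by linarith)
  obtain ⟨C, η, hC, hη, hη8, hu⟩ := exists_regL_deriv_bound he0
  set c' := min c η / 2 with hc'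
  have hc'0 : 0 < c' := by positivity
  have hc'c : c' ≤ c / 2 := by rw [hc']; gcongr; exact min_le_left _ _
  have hc'η : c' ≤ η / 2 := by rw [hc']; gcongr; exact min_le_right _ _
  have hK : 0 < C / c + 2 + 2 * C := by positivity
  refine ⟨k.factorial * (2 * (C / c + 2 + 2 * C)) / c' ^ k, by positivity, ?_⟩
  intro q _ a ha s hs1 hs2
  have hX := two_le_cond (N := q) s
  set X := cond q s with hXd
  have hX0 : 0 < X := by linarith
  set r := c' * X ^ (-e) with hr
  have hXe1 : X ^ (-e) ≤ 1 := Real.rpow_le_one_of_one_le_of_nonpos (by linarith) (by linarith)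
  have hr0 : 0 < r := by positivity
  have hrc : r ≤ c' := by rw [hr]; exact mul_le_of_le_one_right hc'0.le hXe1
  have hw (w : ℂ) (hw : w ∈ Metric.closedBall s r) : 1 - η ≤ w.re ∧
      1 - c * cond q w ^ (-e) ≤ w.re ∧ w.re ≤ 2 ∧ cond q w ≤ 2 * X := by
    rw [mem_closedBall_iff_norm] at hw
    have hre := (Complex.abs_re_le_norm (w - s)).trans hw
    have him := (Complex.abs_im_le_norm (w - s)).trans hw
    rw [Complex.sub_re, abs_le] at hre
    rw [Complex.sub_im] at him
    have hcond : cond q w ≤ 2 * X := by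
      have : |w.im| ≤ |s.im| + 1 := by
        calc |w.im| = |w.im - s.im + s.im| := by ring_nf
          _ ≤ _ := abs_add_le _ _
          _ ≤ _ := by linarith
      rw [hXd]; unfold cond
      have hq : (0:ℝ) ≤ q := by positivity
      nlinarith [mul_le_mul_of_nonneg_left this hq, mul_nonneg hq (abs_nonneg s.im)]
    refine ⟨by linarith, ?_, by linarith, hcond⟩
    have h2 := two_le_cond (N := q) w
    have h3 : (2 * X) ^ (-e) ≤ cond q w ^ (-e) :=
      Real.rpow_le_rpow_of_nonpos (by linarith) hcond (by linarith)
    have h4 : (1 / 2 : ℝ) ≤ 2 ^ (-e) := by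
      calc (1 / 2 : ℝ) = 2 ^ (-1 : ℝ) := by rw [Real.rpow_neg_one]; norm_num
        _ ≤ _ := Real.rpow_le_rpow_of_exponent_le (by norm_num) (by linarith)
    rw [Real.mul_rpow (by norm_num) hX0.le] at h3
    have h5 : 0 < X ^ (-e) := by positivity
    have h6 : 1 / 2 * X ^ (-e) ≤ cond q w ^ (-e) := le_trans (by gcongr) h3
    have h7 : r ≤ c / 2 * X ^ (-e) := by rw [hr]; gcongr
    nlinarith [mul_le_mul_of_nonneg_left h6 hc.le]
  have hdiff (w : ℂ) (hwm : w ∈ Metric.closedBall s r) : DifferentiableAt ℂ (resDiffL a) w := by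
    obtain ⟨h1, h2, h3, h4⟩ := hw w hwm
    refine differentiableAt_resDiffL a ?_ fun χ => ?_
    · rintro rfl; simp at h1; linarith
    · have h5 := two_le_cond (N := q) w
      have h6 := hl q χ w h2 h3
      have : 0 < c * cond q w ^ (-e) := by positivity
      exact norm_pos_iff.1 (this.trans_le h6)
  have hbd (w : ℂ) (hwm : w ∈ Metric.sphere s r) :
      ‖resDiffL a w‖ ≤ 2 * (C / c + 2 + 2 * C) * X ^ (2 * e) := by
    obtain ⟨h1, h2, h3, h4⟩ := hw w (Metric.sphere_subset_closedBall hwm)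
    have h5 := two_le_cond (N := q) w
    refine (norm_resDiffL_le hc hC he0 hη hη8 hu hl a h1 h2 h3).trans ?_
    have : cond q w ^ (2 * e) ≤ 2 * X ^ (2 * e) := by
      calc cond q w ^ (2 * e) ≤ (2 * X) ^ (2 * e) := by gcongr
        _ = 2 ^ (2 * e) * X ^ (2 * e) := Real.mul_rpow (by norm_num) hX0.le
        _ ≤ 2 ^ (1:ℝ) * X ^ (2 * e) := by
          gcongr
          · norm_num
          · linarith
        _ = _ := by rw [Real.rpow_one]
    nlinarith
  have hcauchy := Complex.norm_iteratedDeriv_le_of_forall_mem_sphere_norm_le k hr0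
    (f := resDiffL a) (c := s) (DifferentiableOn.diffContOnCl_ball
      (U := Metric.closedBall s r) (fun w hwm => (hdiff w hwm).differentiableWithinAt)
      subset_rfl) hbd
  have heq : LSeries (resDiff a) =ᶠ[𝓝 s] resDiffL a := by
    filter_upwards [(isOpen_lt continuous_const Complex.continuous_re).mem_nhds hs1] with w hw
    exact LSeries_resDiff ha hw
  have hit := LSeries_iteratedDeriv (f := resDiff a) k (s := s)
    ((resDiff_abscissa a).trans_lt (by exact_mod_cast hs1))
  rw [heq.iteratedDeriv_eq k] at hit
  have hn : ‖LSeries (logMul^[k] (resDiff a)) s‖ = ‖iteratedDeriv k (resDiffL a) s‖ := by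
    rw [hit, norm_mul, norm_pow, norm_neg, norm_one, one_pow, one_mul]
  rw [hn]
  refine hcauchy.trans (le_of_eq ?_)
  have h1 : X ^ ε = X ^ (2 * e) * (X ^ e) ^ k := by
    rw [← Real.rpow_mul_natCast hX0.le, ← Real.rpow_add hX0]
    congr 1; rw [he]; field_simp; ring
  rw [hr, h1, Real.rpow_neg hX0.le, mul_pow, inv_pow]
  field_simp

end Vaughan

namespace Vaughan
open MeasureTheory Filter Topology Asymptotics DirichletCharacter
open ArithmeticFunction.vonMangoldt LSeries

lemma hasMellin_tent {s : ℂ} (hs : 0 < s.re) :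
    HasMellin (fun u : ℝ => ((max (1 - u) 0 : ℝ) : ℂ)) s (1 / (s * (s + 1))) := by
  have h1 := hasMellin_one_Ioc hs
  have h2 := hasMellin_cpow_Ioc 1 (s := s) (by simp; linarith)
  have h3 := hasMellin_sub h1.1 h2.1
  have hs0 : s ≠ 0 := by rintro rfl; simp at hs
  have hs1 : s + 1 ≠ 0 := by
    intro h
    have := congrArg Complex.re h
    simp at this; linarith
  have hEq : ∀ u ∈ Set.Ioi (0:ℝ), Set.indicator (Set.Ioc 0 1) (fun _ => 1 : ℝ → ℂ) u -
      Set.indicator (Set.Ioc 0 1) (fun t => (t:ℂ) ^ (1:ℂ) : ℝ → ℂ) u =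
      ((max (1 - u) 0 : ℝ) : ℂ) := by
    intro u hu
    by_cases h : u ≤ 1
    · have hm : u ∈ Set.Ioc (0:ℝ) 1 := ⟨hu, h⟩
      rw [Set.indicator_of_mem hm, Set.indicator_of_mem hm, max_eq_left (by linarith)]
      simp
    · have hm : u ∉ Set.Ioc (0:ℝ) 1 := fun h' => h h'.2
      rw [Set.indicator_of_notMem hm, Set.indicator_of_notMem hm, max_eq_right (by linarith)]
      simp
  rw [h1.2, h2.2] at h3
  constructor
  · refine (integrableOn_congr_fun (fun u hu => ?_) measurableSet_Ioi).1 h3.1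
    simp only [hEq u hu]
  · have h4 := h3.2
    rw [mellin, setIntegral_congr_fun measurableSet_Ioi (fun u hu => by
      simp only [hEq u hu]; rfl)] at h4
    rw [mellin, h4]
    field_simp
    ring

lemma one_add_sq_le {σ t : ℝ} (hσ : 1 ≤ σ) :
    1 + t ^ 2 ≤ ‖((σ + t * Complex.I : ℂ)) * (σ + t * Complex.I + 1)‖ := by
  have h (τ : ℝ) (hτ : 1 ≤ τ) : Real.sqrt (1 + t ^ 2) ≤ ‖(τ + t * Complex.I : ℂ)‖ := by
    rw [Complex.norm_add_mul_I]
    exact Real.sqrt_le_sqrt (by nlinarith)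
  rw [norm_mul, ← Real.mul_self_sqrt (by positivity : 0 ≤ 1 + t ^ 2)]
  have h2 := h (σ + 1) (by linarith)
  push_cast at h2
  rw [add_right_comm] at h2
  exact mul_le_mul (h σ hσ) h2 (by positivity) (by positivity)

lemma integrable_one_add_sq_rpow : Integrable (fun t : ℝ => (1 + t ^ 2) ^ (-(3:ℝ) / 4)) := by
  have := integrable_rpow_neg_one_add_norm_sq (E := ℝ) (μ := volume) (r := 3 / 2)
    (by norm_num [Module.finrank_self])
  refine this.congr (.of_forall fun t => ?_)
  simp only [Real.norm_eq_abs, sq_abs]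
  norm_num

lemma integrable_perron_kernel {σ : ℝ} (hσ : 1 ≤ σ) :
    Integrable (fun t : ℝ => (1 / ((σ + t * Complex.I : ℂ) * (σ + t * Complex.I + 1)))) := by
  refine integrable_one_add_sq_rpow.mono' ?_ (.of_forall fun t => ?_)
  · exact (by fun_prop : Measurable fun t : ℝ =>
      (1 / ((σ + t * Complex.I : ℂ) * (σ + t * Complex.I + 1)))).aestronglyMeasurable
  · rw [norm_div, norm_one]
    calc _ ≤ 1 / (1 + t ^ 2) := by
          gcongr
          exact one_add_sq_le hσ
      _ = (1 + t ^ 2) ^ (-1:ℝ) := by rw [Real.rpow_neg_one, one_div]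
      _ ≤ _ := Real.rpow_le_rpow_of_exponent_le (by nlinarith [sq_nonneg t]) (by norm_num)

lemma perron_kernel {σ u : ℝ} (hσ : 1 ≤ σ) (hu : 0 < u) :
    (1 / (2 * Real.pi) : ℂ) * ∫ t : ℝ, (u:ℂ) ^ (-(σ + t * Complex.I) : ℂ) *
      (1 / ((σ + t * Complex.I : ℂ) * (σ + t * Complex.I + 1))) = ((max (1 - u) 0 : ℝ) : ℂ) := by
  have hm (t : ℝ) : mellin (fun u : ℝ => ((max (1 - u) 0 : ℝ) : ℂ)) (σ + t * Complex.I) =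
      1 / ((σ + t * Complex.I : ℂ) * (σ + t * Complex.I + 1)) :=
    (hasMellin_tent (by simp; linarith)).2
  have := mellinInv_mellin_eq σ (fun u : ℝ => ((max (1 - u) 0 : ℝ) : ℂ)) hu
    (hasMellin_tent (by simp; linarith)).1
    ((integrable_perron_kernel hσ).congr (.of_forall fun t => (hm t).symm))
    (Continuous.continuousAt (by fun_prop))
  rw [mellinInv] at this
  simp only [hm, smul_eq_mul] at this
  convert this using 1
  simp [Complex.real_smul]

lemma norm_smoothed_sum_le {b : ℕ → ℂ} {x σ M ε : ℝ} (hx : 0 < x) (hσ : 1 ≤ σ) (hε : ε ≤ 1 / 2)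
    (hb : LSeriesSummable b σ) (hM0 : 0 ≤ M)
    (hM : ∀ t : ℝ, ‖LSeries b (σ + t * Complex.I)‖ ≤ M * (|t| + 2) ^ ε) :
    ‖∑ n ∈ Icc 1 ⌊x⌋₊, b n * (1 - n / x)‖ ≤
      (∫ t : ℝ, (1 + t ^ 2) ^ (-(3:ℝ) / 4)) * M * x ^ σ := by
  set F : ℕ → ℝ → ℂ := fun n t => LSeries.term b (σ + t * Complex.I) n *
    ((x:ℂ) ^ (σ + t * Complex.I : ℂ) *
      (1 / ((σ + t * Complex.I : ℂ) * (σ + t * Complex.I + 1)))) with hF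
  have hxs (t : ℝ) : ‖(x:ℂ) ^ (σ + t * Complex.I : ℂ)‖ = x ^ σ := by
    rw [Complex.norm_cpow_eq_rpow_re_of_pos hx]; simp
  have hterm (n : ℕ) (t : ℝ) : ‖LSeries.term b (σ + t * Complex.I) n‖ =
      ‖LSeries.term b σ n‖ := by
    rw [LSeries.norm_term_eq, LSeries.norm_term_eq]; simp
  have hker := integrable_perron_kernel hσ
  have hnormF (n : ℕ) (t : ℝ) : ‖F n t‖ = ‖LSeries.term b σ n‖ * x ^ σ *
      ‖1 / ((σ + t * Complex.I : ℂ) * (σ + t * Complex.I + 1))‖ := by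
    rw [hF]; simp only [norm_mul, hterm, hxs]; ring
  have hFm (n : ℕ) : Measurable (F n) := by
    refine Measurable.mul ?_ (Measurable.mul ?_ (by fun_prop))
    · rcases eq_or_ne n 0 with rfl | hn
      · simp
      · simp only [LSeries.term_of_ne_zero hn]
        fun_prop
    · fun_prop
  have hFi (n : ℕ) : Integrable (F n) := by
    refine (hker.norm.const_mul (‖LSeries.term b σ n‖ * x ^ σ)).mono'
      (hFm n).aestronglyMeasurable (.of_forall fun t => (hnormF n t).le)
  have hFs : Summable fun n => ∫ t, ‖F n t‖ := by
    simp_rw [hnormF, integral_const_mul]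
    exact (hb.norm.mul_right _).mul_right _
  have hswap := hasSum_integral_of_summable_integral_norm hFi hFs
  have hint (n : ℕ) : ∫ t, F n t = 2 * Real.pi * (if n ∈ Icc 1 ⌊x⌋₊ then b n * (1 - n / x) else 0) := by
    rcases eq_or_ne n 0 with rfl | hn
    · simp [hF]
    have hn0 : (0:ℝ) < n := by exact_mod_cast hn.bot_lt
    have h1 := perron_kernel hσ (div_pos hn0 hx)
    have hFe : F n = fun t : ℝ => b n * ((((n:ℝ) / x : ℝ) : ℂ) ^ (-(σ + t * Complex.I) : ℂ) *
        (1 / ((σ + t * Complex.I : ℂ) * (σ + t * Complex.I + 1)))) := by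
      ext t
      rw [hF]; simp only [LSeries.term_of_ne_zero hn]
      have h2 : (((n:ℝ) / x : ℝ) : ℂ) ^ (-(σ + t * Complex.I) : ℂ) =
          (x:ℂ) ^ (σ + t * Complex.I : ℂ) / (n:ℂ) ^ (σ + t * Complex.I : ℂ) := by
        rw [Complex.cpow_neg, Complex.ofReal_div, Complex.div_cpow_ofReal_nonneg hn0.le hx.le,
          inv_div, Complex.ofReal_natCast]
      rw [h2]; ring
    rw [hFe, integral_const_mul]
    have h3 : ∫ t : ℝ, (((n:ℝ) / x : ℝ) : ℂ) ^ (-(σ + t * Complex.I) : ℂ) *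
        (1 / ((σ + t * Complex.I : ℂ) * (σ + t * Complex.I + 1))) =
        2 * Real.pi * ((max (1 - (n:ℝ) / x) 0 : ℝ) : ℂ) := by
      rw [← h1]
      have : (Real.pi : ℂ) ≠ 0 := by exact_mod_cast Real.pi_ne_zero
      rw [← mul_assoc, mul_one_div_cancel (mul_ne_zero two_ne_zero this), one_mul]
    rw [h3]
    split_ifs with hm
    · rw [mem_Icc, Nat.le_floor_iff hx.le] at hm
      rw [max_eq_left (by rw [sub_nonneg, div_le_one hx]; exact hm.2)]
      push_cast; ring
    · rw [mem_Icc, not_and, Nat.le_floor_iff hx.le, not_le] at hm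
      have := hm hn.bot_lt
      rw [max_eq_right (by rw [sub_nonpos, one_le_div hx]; exact this.le)]
      simp
  simp_rw [hint] at hswap
  have hfin : HasSum (fun n : ℕ => 2 * Real.pi * (if n ∈ Icc 1 ⌊x⌋₊ then b n * (1 - n / x) else 0))
      (2 * Real.pi * ∑ n ∈ Icc 1 ⌊x⌋₊, b n * (1 - n / x) : ℂ) := by
    refine HasSum.mul_left _ ?_
    have := hasSum_sum_of_ne_finset_zero (L := .unconditional ℕ)
      (f := fun n : ℕ => (if n ∈ Icc 1 ⌊x⌋₊ then b n * (1 - n / x) else 0 : ℂ))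
      (s := Icc 1 ⌊x⌋₊) (fun n hn => if_neg hn)
    rwa [sum_congr rfl (fun n hn => if_pos hn)] at this
  have hkey := hfin.unique hswap
  have hsumF (t : ℝ) : ∑' n, F n t = LSeries b (σ + t * Complex.I) *
      ((x:ℂ) ^ (σ + t * Complex.I : ℂ) *
      (1 / ((σ + t * Complex.I : ℂ) * (σ + t * Complex.I + 1)))) := by
    rw [hF, tsum_mul_right]; rfl
  simp_rw [hsumF] at hkey
  have hbound : ‖(2 * Real.pi * ∑ n ∈ Icc 1 ⌊x⌋₊, b n * (1 - n / x) : ℂ)‖ ≤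
      ∫ t : ℝ, 2 * M * x ^ σ * (1 + t ^ 2) ^ (-(3:ℝ) / 4) := by
    rw [hkey]
    refine norm_integral_le_of_norm_le (integrable_one_add_sq_rpow.const_mul _)
      (.of_forall fun t => ?_)
    rw [norm_mul, norm_mul, hxs, norm_div, norm_one]
    have h1 : (0:ℝ) < 1 + t ^ 2 := by positivity
    have h2 : (|t| + 2) ^ ε ≤ 2 * (1 + t ^ 2) ^ (1 / 4 : ℝ) := by
      calc (|t| + 2) ^ ε ≤ (|t| + 2) ^ (1 / 2 : ℝ) :=
            Real.rpow_le_rpow_of_exponent_le (by linarith [abs_nonneg t]) hε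
        _ = ((|t| + 2) ^ 2) ^ (1 / 4 : ℝ) := by
            rw [← Real.rpow_natCast, ← Real.rpow_mul (by positivity)]; norm_num
        _ ≤ (2 ^ 4 * (1 + t ^ 2)) ^ (1 / 4 : ℝ) := by
            gcongr
            rw [← sq_abs t]
            nlinarith [abs_nonneg t, sq_nonneg (|t| - 1)]
        _ = _ := by
            rw [Real.mul_rpow (by positivity) h1.le, ← Real.rpow_natCast,
              ← Real.rpow_mul (by positivity)]
            norm_num
    calc _ ≤ M * (2 * (1 + t ^ 2) ^ (1 / 4 : ℝ)) * (x ^ σ * (1 / (1 + t ^ 2))) := by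
          gcongr
          · exact (hM t).trans (by gcongr)
          · exact one_add_sq_le hσ
      _ = 2 * M * x ^ σ * ((1 + t ^ 2) ^ (1 / 4 : ℝ) * (1 + t ^ 2) ^ (-1 : ℝ)) := by
          rw [Real.rpow_neg_one]; ring
      _ = _ := by
          rw [← Real.rpow_add h1]; norm_num
  rw [integral_const_mul, norm_mul] at hbound
  have hpi : ‖(2 * Real.pi : ℂ)‖ = 2 * Real.pi := by
    simp [abs_of_pos Real.pi_pos]
  rw [hpi] at hbound
  set I := ∫ t : ℝ, (1 + t ^ 2) ^ (-(3:ℝ) / 4)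
  have hI : 0 ≤ I := integral_nonneg fun t => by positivity
  have hp := Real.two_le_pi
  have hn := norm_nonneg (∑ n ∈ Icc 1 ⌊x⌋₊, b n * (1 - n / x) : ℂ)
  have : 2 * ‖(∑ n ∈ Icc 1 ⌊x⌋₊, b n * (1 - n / x) : ℂ)‖ ≤ 2 * M * x ^ σ * I :=
    le_trans (by nlinarith) hbound
  linarith

lemma logMul_iterate_apply (f : ℕ → ℂ) (k n : ℕ) :
    (logMul^[k] f) n = (Real.log n : ℂ) ^ k * f n := by
  induction k with
  | zero => simp
  | succ k ih =>
    rw [Function.iterate_succ_apply', logMul, ih, pow_succ, ← Complex.natCast_log]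
    ring

/-- Smoothed form of the prime number theorem in progressions. -/
theorem exists_smoothed_bound (k : ℕ) {ε : ℝ} (hε : 0 < ε) (hε1 : ε ≤ 1 / 2) :
    ∃ C : ℝ, 0 < C ∧ ∀ (q : ℕ) [NeZero q] (a : ZMod q), IsUnit a → ∀ x : ℝ, 8 ≤ x →
      |∑ n ∈ Icc 1 ⌊x⌋₊, (residueClass a n - (q.totient : ℝ)⁻¹) * Real.log n ^ k * (x - n)| ≤
        C * (q:ℝ) ^ ε * x ^ 2 := by
  obtain ⟨C, hC, h⟩ := exists_logMul_LSeries_bound k hε (by linarith)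
  set I := ∫ t : ℝ, (1 + t ^ 2) ^ (-(3:ℝ) / 4) with hI
  have hI0 : 0 ≤ I := integral_nonneg fun t => by positivity
  refine ⟨(I + 1) * C * Real.exp 1, by positivity, ?_⟩
  intro q _ a ha x hx
  have hx0 : 0 < x := by linarith
  have hlog : 2 ≤ Real.log x := by
    rw [Real.le_log_iff_exp_le hx0]
    have := Real.exp_one_lt_d9
    rw [show (2:ℝ) = 1 + 1 by norm_num, Real.exp_add]
    have := Real.exp_pos 1
    nlinarith
  set σ := 1 + (Real.log x)⁻¹ with hσ
  have hinv : (Real.log x)⁻¹ ≤ 1 / 2 := by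
    rw [inv_le_comm₀ (by linarith) (by norm_num)]; linarith
  have hinv0 : 0 < (Real.log x)⁻¹ := by positivity
  have hqpos : (0:ℝ) < q := by exact_mod_cast NeZero.pos q
  have hsm : LSeriesSummable (logMul^[k] (resDiff a)) σ := by
    refine LSeriesSummable_of_abscissaOfAbsConv_lt_re ?_
    rw [absicssaOfAbsConv_logPowMul]
    refine (resDiff_abscissa a).trans_lt ?_
    rw [Complex.ofReal_re]
    have : (1:ℝ) < σ := by linarith
    exact_mod_cast this
  have key := norm_smoothed_sum_le (M := C * (q:ℝ) ^ ε) hx0 (by linarith : 1 ≤ σ) hε1 hsm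
    (by positivity) (fun t => by
      refine (h q a ha (σ + t * Complex.I) (by simp; linarith) (by simp; linarith)).trans ?_
      rw [cond, Real.mul_rpow hqpos.le (by positivity)]
      simp [mul_assoc])
  have hxσ : x ^ σ = x * Real.exp 1 := by
    rw [hσ, Real.rpow_add hx0, Real.rpow_one, Real.rpow_def_of_pos hx0,
      mul_inv_cancel₀ (by linarith)]
  have hsum : ((∑ n ∈ Icc 1 ⌊x⌋₊, (residueClass a n - (q.totient : ℝ)⁻¹) * Real.log n ^ k *
      (x - n) : ℝ) : ℂ) = x * ∑ n ∈ Icc 1 ⌊x⌋₊, (logMul^[k] (resDiff a)) n * (1 - n / x) := by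
    rw [mul_sum]; push_cast
    refine sum_congr rfl fun n _ => ?_
    have : (x:ℂ) ≠ 0 := by exact_mod_cast hx0.ne'
    rw [logMul_iterate_apply, resDiff, Complex.natCast_log]
    field_simp
  rw [← Real.norm_eq_abs, ← Complex.norm_real, hsum, norm_mul, Complex.norm_real,
    Real.norm_of_nonneg hx0.le]
  rw [hxσ] at key
  calc _ ≤ x * (I * (C * (q:ℝ) ^ ε) * (x * Real.exp 1)) := by gcongr
    _ ≤ x * ((I + 1) * (C * (q:ℝ) ^ ε) * (x * Real.exp 1)) := by gcongr; linarith
    _ = _ := by ring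

/-- Removing a linear smoothing weight from sums of a sequence bounded below. -/
lemma abs_sum_le_of_smoothed {b : ℕ → ℝ} {N h : ℕ} {B G : ℝ} (hh : 0 < h) (hN : h ≤ N)
    (hb : ∀ n, 1 ≤ n → n ≤ N + h → -G ≤ b n)
    (h1 : |∑ n ∈ Icc 1 (N - h), b n * ((N - h : ℕ) - n : ℝ)| ≤ B)
    (h2 : |∑ n ∈ Icc 1 N, b n * (N - n : ℝ)| ≤ B)
    (h3 : |∑ n ∈ Icc 1 (N + h), b n * ((N + h : ℕ) - n : ℝ)| ≤ B) :
    |∑ n ∈ Icc 1 N, b n| ≤ 2 * B / h + h * |G| := by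
  have hh0 : (0:ℝ) < h := by exact_mod_cast hh
  have hI (j : ℕ) : Icc 1 j = Ioc 0 j := rfl
  simp only [hI] at *
  have hG := neg_abs_le G
  have hG2 := le_abs_self G
  have split (i j : ℕ) (hij : i ≤ j) (f : ℕ → ℝ) :
      ∑ n ∈ Ioc 0 j, f n = ∑ n ∈ Ioc 0 i, f n + ∑ n ∈ Ioc i j, f n :=
    (sum_Ioc_consecutive f (Nat.zero_le i) hij).symm
  rw [abs_le] at h1 h2 h3
  have hcast : ((N - h : ℕ) : ℝ) = N - h := Nat.cast_sub hN
  have hdiv : 2 * B / h + h * |G| = (2 * B + h * (h * |G|)) / h := by field_simp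
  rw [hdiv, le_div_iff₀ hh0, ← abs_of_pos hh0, ← abs_mul, abs_of_pos hh0, sum_mul, abs_le]
  constructor
  · have e : ∑ n ∈ Ioc 0 N, b n * h = ∑ n ∈ Ioc 0 N, b n * (N - n : ℝ) -
        ∑ n ∈ Ioc 0 (N - h), b n * ((N - h : ℕ) - n : ℝ) +
        ∑ n ∈ Ioc (N - h) N, b n * (n - (N - h : ℕ) : ℝ) := by
      rw [split (N - h) N (Nat.sub_le _ _), split (N - h) N (Nat.sub_le _ _),
        add_sub_right_comm, ← sum_sub_distrib, add_assoc, ← sum_add_distrib]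
      congr 1 <;> refine sum_congr rfl fun n _ => ?_ <;> rw [hcast] <;> ring
    have l : -(h * (h * |G|)) ≤ ∑ n ∈ Ioc (N - h) N, b n * (n - (N - h : ℕ) : ℝ) := by
      have hc : #(Ioc (N - h) N) = h := by rw [Nat.card_Ioc]; omega
      have := card_nsmul_le_sum (Ioc (N - h) N) (fun n => b n * (n - (N - h : ℕ) : ℝ))
        (-(h * |G|)) (fun n hn => by
          rw [mem_Ioc] at hn
          have hb' := hb n (by omega) (by omega)
          have p1 : (0:ℝ) ≤ n - (N - h : ℕ) := sub_nonneg.2 (by exact_mod_cast hn.1.le)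
          have p2 : (n:ℝ) - (N - h : ℕ) ≤ h := by
            rw [hcast]
            have : (n:ℝ) ≤ N := by exact_mod_cast hn.2
            linarith
          nlinarith [abs_nonneg G, mul_le_mul_of_nonneg_right (by linarith : -|G| ≤ b n) p1])
      rw [hc, nsmul_eq_mul] at this
      linarith
    rw [e]; linarith [h2.1, h1.2]
  · have e : ∑ n ∈ Ioc 0 N, b n * h = ∑ n ∈ Ioc 0 (N + h), b n * ((N + h : ℕ) - n : ℝ) -
        ∑ n ∈ Ioc 0 N, b n * (N - n : ℝ) -
        ∑ n ∈ Ioc N (N + h), b n * ((N + h : ℕ) - n : ℝ) := by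
      rw [split N (N + h) (Nat.le_add_right _ _), sub_right_comm, add_sub_cancel_right,
        ← sum_sub_distrib]
      refine sum_congr rfl fun n _ => ?_
      push_cast; ring
    have l : -(h * (h * |G|)) ≤ ∑ n ∈ Ioc N (N + h), b n * ((N + h : ℕ) - n : ℝ) := by
      have hc : #(Ioc N (N + h)) = h := by rw [Nat.card_Ioc]; omega
      have := card_nsmul_le_sum (Ioc N (N + h)) (fun n => b n * ((N + h : ℕ) - n : ℝ))
        (-(h * |G|)) (fun n hn => by
          rw [mem_Ioc] at hn
          have hb' := hb n (by omega) (by omega)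
          have p1 : (0:ℝ) ≤ (N + h : ℕ) - n := sub_nonneg.2 (by exact_mod_cast hn.2)
          have p2 : ((N + h : ℕ) : ℝ) - n ≤ h := by
            have : (N:ℝ) < n := by exact_mod_cast hn.1
            push_cast; linarith
          nlinarith [abs_nonneg G, mul_le_mul_of_nonneg_right (by linarith : -|G| ≤ b n) p1])
      rw [hc, nsmul_eq_mul] at this
      linarith
    rw [e]; linarith [h2.1, h3.2]

lemma sum_mul_by_parts {A : Type*} [CommRing A] {b w : ℕ → A} {M N : ℕ} (hMN : M ≤ N) :
    ∑ n ∈ Ioc M N, w n * b n = w N * ∑ n ∈ Ioc M N, b n -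
      ∑ n ∈ Ico M N, (w (n + 1) - w n) * ∑ j ∈ Ioc M n, b j := by
  induction N, hMN using Nat.le_induction with
  | base => simp
  | succ N h ih =>
    rw [sum_Ioc_succ_top (by omega), sum_Ioc_succ_top (by omega), sum_Ico_succ_top h, ih]
    ring

lemma norm_sum_mul_le {b w : ℕ → ℂ} {M N : ℕ} {B : ℝ} (hMN : M ≤ N)
    (hB : ∀ j, M ≤ j → j ≤ N → ‖∑ n ∈ Ioc M j, b n‖ ≤ B) :
    ‖∑ n ∈ Ioc M N, w n * b n‖ ≤ B * (‖w N‖ + ∑ n ∈ Ico M N, ‖w (n + 1) - w n‖) := by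
  rw [sum_mul_by_parts hMN, mul_add]
  refine (norm_sub_le _ _).trans (add_le_add ?_ ?_)
  · rw [norm_mul, mul_comm]
    exact mul_le_mul_of_nonneg_right (hB N hMN le_rfl) (norm_nonneg _)
  · rw [mul_sum]
    refine norm_sum_le_of_le _ fun n hn => ?_
    rw [mem_Ico] at hn
    rw [norm_mul, mul_comm]
    exact mul_le_mul_of_nonneg_right (hB n hn.1 hn.2.le) (norm_nonneg _)

lemma abs_sum_mul_le_of_antitone {b w : ℕ → ℝ} {M N : ℕ} {B : ℝ} (hMN : M ≤ N)
    (hw : ∀ n, M ≤ n → n < N → w (n + 1) ≤ w n) (hw0 : 0 ≤ w N)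
    (hB : ∀ j, M ≤ j → j ≤ N → |∑ n ∈ Ioc M j, b n| ≤ B) :
    |∑ n ∈ Ioc M N, w n * b n| ≤ B * w M := by
  have := norm_sum_mul_le (b := fun n => (b n : ℂ)) (w := fun n => (w n : ℂ)) hMN (B := B)
    (fun j h1 h2 => by
      have := hB j h1 h2
      rwa [← Complex.ofReal_sum, Complex.norm_real])
  have e : ∑ n ∈ Ico M N, ‖((w (n + 1) : ℝ) : ℂ) - w n‖ = w M - w N := by
    rw [← neg_sub (w N), ← sum_Ico_sub w hMN, ← sum_neg_distrib]
    refine sum_congr rfl fun n hn => ?_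
    rw [mem_Ico] at hn
    rw [← Complex.ofReal_sub, Complex.norm_real, Real.norm_of_nonpos]
    linarith [hw n hn.1 hn.2]
  rw [e, Complex.norm_real, Real.norm_of_nonneg hw0] at this
  have h2 : (∑ n ∈ Ioc M N, (w n : ℂ) * b n) = ((∑ n ∈ Ioc M N, w n * b n : ℝ) : ℂ) := by
    push_cast; rfl
  rw [h2, Complex.norm_real] at this
  simpa using this

lemma tendsto_div_log_pow (m : ℕ) :
    Tendsto (fun N : ℕ => (N:ℝ) / Real.log N ^ m) atTop atTop := by
  have h1 : (fun x : ℝ => Real.log x ^ m) =o[atTop] fun x => x := by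
    simpa using isLittleO_log_rpow_rpow_atTop (m:ℝ) (one_pos)
  have h2 := h1.tendsto_div_nhds_zero
  have h3 : ∀ᶠ x : ℝ in atTop, 0 < Real.log x ^ m / x := by
    filter_upwards [eventually_gt_atTop 1] with x hx
    have := Real.log_pos hx
    positivity
  have h4 : Tendsto (fun x : ℝ => (Real.log x ^ m / x)⁻¹) atTop atTop :=
    tendsto_inv_nhdsGT_zero.comp (tendsto_nhdsWithin_iff.2 ⟨h2, h3⟩)
  simpa [Function.comp_def] using h4.comp tendsto_natCast_atTop_atTop

lemma tendsto_log_pow {m : ℕ} (hm : m ≠ 0) :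
    Tendsto (fun N : ℕ => Real.log N ^ m) atTop atTop :=
  (tendsto_pow_atTop hm).comp (Real.tendsto_log_atTop.comp tendsto_natCast_atTop_atTop)

lemma residueClass_nonneg {q : ℕ} (a : ZMod q) (n : ℕ) : 0 ≤ residueClass a n := by
  unfold residueClass
  exact Set.indicator_nonneg (fun _ _ => ArithmeticFunction.vonMangoldt_nonneg) n

lemma residueClass_le_log {q : ℕ} (a : ZMod q) (n : ℕ) : residueClass a n ≤ Real.log n := by
  unfold residueClass
  exact Set.indicator_apply_le' (fun _ => ArithmeticFunction.vonMangoldt_le_log)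
    (fun _ => Real.log_natCast_nonneg n)

lemma abs_residueClass_sub_le {q : ℕ} [NeZero q] (a : ZMod q) (n : ℕ) :
    |residueClass a n - (q.totient : ℝ)⁻¹| ≤ Real.log n + 1 := by
  have h1 := residueClass_nonneg a n
  have h2 := residueClass_le_log a n
  have hφ : (1:ℝ) ≤ q.totient := by exact_mod_cast Nat.totient_pos.2 (NeZero.pos q)
  have h3 : (q.totient : ℝ)⁻¹ ≤ 1 := inv_le_one_of_one_le₀ hφ
  have h4 : 0 ≤ (q.totient : ℝ)⁻¹ := by positivity
  rw [abs_le]; constructor <;> linarith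

lemma exists_log_weighted_bound {m : ℕ} (hm : m ≠ 0) :
    ∃ C : ℝ, 0 < C ∧ ∃ N₀ : ℕ, ∀ (q : ℕ) [NeZero q] (a : ZMod q), IsUnit a → ∀ N : ℕ, N₀ ≤ N →
      |∑ n ∈ Icc 1 N, (residueClass a n - (q.totient : ℝ)⁻¹) * Real.log n ^ (2 * m)| ≤
        C * q * N * Real.log N ^ m := by
  obtain ⟨C, hC, h⟩ := exists_smoothed_bound (2 * m) (ε := 1 / 2) (by norm_num) le_rfl
  obtain ⟨N₀, hN₀⟩ := eventually_atTop.1 (((tendsto_div_log_pow m).eventually_ge_atTop 1).and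
    (((tendsto_log_pow hm).eventually_ge_atTop 4).and
      (((tendsto_log_pow one_ne_zero).eventually_ge_atTop 1).and (eventually_ge_atTop 16))))
  refine ⟨8 * C + 2 * 4 ^ m, by positivity, N₀, ?_⟩
  intro q _ a ha N hN
  obtain ⟨e1, e2, e3, e4⟩ := hN₀ N hN
  rw [pow_one] at e3
  set L := Real.log N with hL
  have hq1 : (1:ℝ) ≤ q := by exact_mod_cast NeZero.one_le
  have hqq : (q:ℝ) ^ (1 / 2 : ℝ) ≤ q := by
    calc (q:ℝ) ^ (1 / 2 : ℝ) ≤ (q:ℝ) ^ (1 : ℝ) := Real.rpow_le_rpow_of_exponent_le hq1 (by norm_num)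
      _ = q := Real.rpow_one _
  have hT (j : ℕ) (hj : 8 ≤ j) (hj2 : j ≤ 2 * N) : |∑ n ∈ Icc 1 j,
      ((residueClass a n - (q.totient : ℝ)⁻¹) * Real.log n ^ (2 * m)) * (j - n : ℝ)| ≤
      C * q * (4 * N ^ 2) := by
    have := h q a ha j (by exact_mod_cast hj)
    rw [Nat.floor_natCast] at this
    refine this.trans ?_
    have hj3 : (j:ℝ) ≤ 2 * N := by exact_mod_cast hj2
    have : (j:ℝ) ^ 2 ≤ 4 * N ^ 2 := by nlinarith [(Nat.cast_nonneg j : (0:ℝ) ≤ j)]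
    gcongr
  have hN0 : (0:ℝ) < N := by exact_mod_cast (by omega : 0 < N)
  have hLm : 0 < L ^ m := by positivity
  set h := ⌈(N:ℝ) / L ^ m⌉₊ with hh
  have hh1 : (N:ℝ) / L ^ m ≤ h := Nat.le_ceil _
  have hh2 : (h:ℝ) ≤ 2 * (N / L ^ m) := by
    have := Nat.ceil_lt_add_one (a := (N:ℝ) / L ^ m) (by positivity)
    linarith
  have hh3 : 2 * h ≤ N := by
    have : (N:ℝ) / L ^ m ≤ N / 4 := by gcongr
    have : 2 * (h:ℝ) ≤ N := by linarith
    exact_mod_cast this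
  have hhpos : 0 < h := by
    have : (0:ℝ) < h := by linarith
    exact_mod_cast this
  have key := abs_sum_le_of_smoothed (G := (2 * L) ^ (2 * m)) hhpos (by omega) (fun n hn1 hn2 => by
    have hn : Real.log n ≤ 2 * L := by
      rw [hL, two_mul, ← Real.log_mul hN0.ne' hN0.ne']
      refine Real.log_le_log (by exact_mod_cast hn1) ?_
      have : n ≤ N * N := by nlinarith
      exact_mod_cast this
    have hn0 : 0 ≤ Real.log n := Real.log_natCast_nonneg n
    have hp : Real.log n ^ (2 * m) ≤ (2 * L) ^ (2 * m) := by gcongr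
    have hφ : (1:ℝ) ≤ q.totient := by exact_mod_cast Nat.totient_pos.2 (NeZero.pos q)
    have h3 : (q.totient : ℝ)⁻¹ ≤ 1 := inv_le_one_of_one_le₀ hφ
    have h4 := residueClass_nonneg a n
    have h5 : 0 ≤ Real.log n ^ (2 * m) := by positivity
    nlinarith [mul_le_mul_of_nonneg_right (by linarith : -1 ≤ residueClass a n -
      (q.totient : ℝ)⁻¹) h5]) (hT (N - h) (by omega) (by omega)) (hT N (by omega) (by omega))
      (hT (N + h) (by omega) (by omega))
  refine key.trans ?_
  rw [abs_of_nonneg (by positivity)]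
  calc _ ≤ 2 * (C * q * (4 * N ^ 2)) / (N / L ^ m) + 2 * (N / L ^ m) * (2 * L) ^ (2 * m) := by
        gcongr
    _ = 8 * C * q * N * L ^ m + 2 * 4 ^ m * 1 * N * L ^ m := by
        rw [mul_pow, pow_mul, pow_mul L, pow_right_comm L, show (2:ℝ) ^ 2 = 4 by norm_num]
        field_simp
        ring
    _ ≤ 8 * C * q * N * L ^ m + 2 * 4 ^ m * q * N * L ^ m := by gcongr
    _ = _ := by ring

/-- The Siegel–Walfisz theorem. -/
theorem siegel_walfisz {m : ℕ} (hm : m ≠ 0) :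
    ∃ C : ℝ, 0 < C ∧ ∃ N₀ : ℕ, ∀ (q : ℕ) [NeZero q] (a : ZMod q), IsUnit a → ∀ N : ℕ, N₀ ≤ N →
      |∑ n ∈ Icc 1 N, (residueClass a n - (q.totient : ℝ)⁻¹)| ≤ C * q * (N / Real.log N ^ m) := by
  obtain ⟨C, hC, N₁, h⟩ := exists_log_weighted_bound hm
  have hsq : Tendsto (fun N : ℕ => Nat.sqrt N) atTop atTop :=
    tendsto_atTop.2 fun b => eventually_atTop.2 ⟨b * b, fun N hN => Nat.le_sqrt.2 hN⟩
  obtain ⟨N₂, hN₂⟩ := eventually_atTop.1 ((hsq.eventually_ge_atTop (N₁ + 2)).and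
    (((tendsto_div_log_pow (2 * m + 2)).eventually_ge_atTop 36).and
      ((tendsto_log_pow one_ne_zero).eventually_ge_atTop 1)))
  refine ⟨2 * C * 4 ^ m + 1, by positivity, N₂, ?_⟩
  intro q _ a ha N hN
  obtain ⟨e1, e2, e3⟩ := hN₂ N hN
  rw [pow_one] at e3
  set L := Real.log N with hL
  set M := Nat.sqrt N + 1 with hM
  have hMN : M ≤ N := by
    have := Nat.sqrt_le' N
    nlinarith
  have hN0 : (0:ℝ) < N := by exact_mod_cast (by omega : 0 < N)
  have hq1 : (1:ℝ) ≤ q := by exact_mod_cast NeZero.one_le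
  have hM2 : (N:ℝ) ≤ M ^ 2 := by
    have := (Nat.lt_succ_sqrt' N).le
    exact_mod_cast this
  have hM0 : (0:ℝ) < M := by positivity
  have hlogM : L / 2 ≤ Real.log M := by
    have := Real.log_le_log hN0 hM2
    rw [Real.log_pow] at this
    push_cast at this; linarith
  have hLM : Real.log M ≤ L := Real.log_le_log hM0 (by exact_mod_cast hMN)
  have hA (j : ℕ) (h1 : M ≤ j) (h2 : j ≤ N) : |∑ n ∈ Icc 1 j,
      (residueClass a n - (q.totient : ℝ)⁻¹) * Real.log n ^ (2 * m)| ≤ C * q * N * L ^ m := by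
    refine (h q a ha j (by omega)).trans ?_
    have hj : (0:ℝ) < j := by exact_mod_cast (by omega : 0 < j)
    have : Real.log j ≤ L := Real.log_le_log hj (by exact_mod_cast h2)
    have : 0 ≤ Real.log j := Real.log_natCast_nonneg j
    gcongr
  have hI (j : ℕ) : Icc 1 j = Ioc 0 j := rfl
  have hmain := abs_sum_mul_le_of_antitone (w := fun n => (Real.log n ^ (2 * m))⁻¹)
    (b := fun n => (residueClass a n - (q.totient : ℝ)⁻¹) * Real.log n ^ (2 * m))
    (B := 2 * (C * q * N * L ^ m)) hMN
    (fun n h1 h2 => by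
      have hn : (0:ℝ) < n := by exact_mod_cast (by omega : 0 < n)
      have hp : 0 < Real.log n := by
        have := Real.log_le_log hM0 (by exact_mod_cast h1 : (M:ℝ) ≤ n)
        linarith
      gcongr
      linarith)
    (by positivity)
    (fun j h1 h2 => by
      have e : ∑ n ∈ Ioc M j, (residueClass a n - (q.totient : ℝ)⁻¹) * Real.log n ^ (2 * m) =
          ∑ n ∈ Icc 1 j, (residueClass a n - (q.totient : ℝ)⁻¹) * Real.log n ^ (2 * m) -
          ∑ n ∈ Icc 1 M, (residueClass a n - (q.totient : ℝ)⁻¹) * Real.log n ^ (2 * m) := by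
        rw [hI, hI, ← sum_Ioc_consecutive _ (Nat.zero_le M) h1]; ring
      rw [e]
      refine (abs_sub _ _).trans ?_
      linarith [hA j h1 h2, hA M le_rfl hMN])
  have hcancel : ∑ n ∈ Ioc M N, (Real.log n ^ (2 * m))⁻¹ *
      ((residueClass a n - (q.totient : ℝ)⁻¹) * Real.log n ^ (2 * m)) =
      ∑ n ∈ Ioc M N, (residueClass a n - (q.totient : ℝ)⁻¹) := by
    refine sum_congr rfl fun n hn => ?_
    rw [mem_Ioc] at hn
    have hp : 0 < Real.log n := by
      have := Real.log_le_log hM0 (by exact_mod_cast hn.1.le : (M:ℝ) ≤ n)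
      linarith
    field_simp
  simp only [hcancel] at hmain
  have hw : (Real.log M ^ (2 * m))⁻¹ ≤ 4 ^ m / L ^ (2 * m) := by
    calc (Real.log M ^ (2 * m))⁻¹ ≤ ((L / 2) ^ (2 * m))⁻¹ := by gcongr
      _ = _ := by
        rw [div_pow, inv_div, pow_mul 2, show (2:ℝ) ^ 2 = 4 by norm_num]
  have hsmall : |∑ n ∈ Icc 1 M, (residueClass a n - (q.totient : ℝ)⁻¹)| ≤ N / L ^ m := by
    have t1 : |∑ n ∈ Icc 1 M, (residueClass a n - (q.totient : ℝ)⁻¹)| ≤ M * (L + 1) := by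
      refine (abs_sum_le_sum_abs _ _).trans ?_
      refine (sum_le_card_nsmul _ _ (L + 1) fun n hn => ?_).trans
        (le_of_eq (by rw [Nat.card_Icc, nsmul_eq_mul, Nat.add_sub_cancel]))
      rw [mem_Icc] at hn
      refine (abs_residueClass_sub_le a n).trans ?_
      have : Real.log n ≤ L := Real.log_le_log (by exact_mod_cast hn.1)
        (by exact_mod_cast hn.2.trans hMN)
      linarith
    refine t1.trans ?_
    have hMsq : (M:ℝ) ≤ 3 * Real.sqrt N := by
      have : (Nat.sqrt N : ℝ) ≤ Real.sqrt N := Real.nat_sqrt_le_real_sqrt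
      have h1 : 1 ≤ Real.sqrt N := by
        rw [Real.one_le_sqrt]; exact_mod_cast (by omega : 1 ≤ N)
      rw [hM]; push_cast; linarith
    have hroot : 6 * L ^ (m + 1) ≤ Real.sqrt N := by
      refine Real.le_sqrt_of_sq_le ?_
      rw [le_div_iff₀ (by positivity)] at e2
      calc (6 * L ^ (m + 1)) ^ 2 = 36 * L ^ (2 * m + 2) := by ring
        _ ≤ N := e2
    rw [le_div_iff₀ (by positivity)]
    calc M * (L + 1) * L ^ m ≤ 3 * Real.sqrt N * (L + L) * L ^ m := by gcongr
      _ = Real.sqrt N * (6 * L ^ (m + 1)) := by ring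
      _ ≤ Real.sqrt N * Real.sqrt N := by gcongr
      _ = N := Real.mul_self_sqrt hN0.le
  rw [hI, ← sum_Ioc_consecutive _ (Nat.zero_le M) hMN]
  calc _ ≤ N / L ^ m + 2 * (C * q * N * L ^ m) * (4 ^ m / L ^ (2 * m)) := by
        refine (abs_add_le _ _).trans (add_le_add hsmall (hmain.trans ?_))
        gcongr
    _ = 1 * 1 * (N / L ^ m) + 2 * C * 4 ^ m * q * (N / L ^ m) := by
        rw [two_mul m, pow_add]; field_simp
    _ ≤ 1 * q * (N / L ^ m) + 2 * C * 4 ^ m * q * (N / L ^ m) := by gcongr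
    _ = _ := by ring

end Vaughan

namespace Vaughan
open Filter Topology
open scoped ArithmeticFunction.Moebius ArithmeticFunction.zeta

lemma prod_le_card_add_one_mul (s : Finset ℕ) (hs : ∀ p ∈ s, 2 ≤ p) :
    (∏ p ∈ s, (p : ℝ)) ≤ (#s + 1) * ∏ p ∈ s, ((p : ℝ) - 1) ∧ ∀ m, (∀ p ∈ s, p < m) → 2 ≤ m →
      #s + 2 ≤ m := by
  induction s using Finset.induction_on_max with
  | empty => simp
  | insert m s hm ih =>
    have ih' := ih fun p hp => hs p (mem_insert_of_mem hp)
    have hms : m ∉ s := fun h => lt_irrefl _ (hm m h)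
    have hm2 := hs m (mem_insert_self _ _)
    have hc := ih'.2 m hm hm2
    rw [prod_insert hms, prod_insert hms, card_insert_of_notMem hms]
    refine ⟨?_, fun k hk _ => by have := hk m (mem_insert_self _ _); omega⟩
    have h1 : (0:ℝ) ≤ ∏ p ∈ s, ((p : ℝ) - 1) := prod_nonneg fun p hp => by
      have : (2:ℝ) ≤ p := by exact_mod_cast hs p (mem_insert_of_mem hp)
      linarith
    have h2 : (#s + 2 : ℝ) ≤ m := by exact_mod_cast hc
    calc (m:ℝ) * ∏ p ∈ s, (p:ℝ) ≤ m * ((#s + 1) * ∏ p ∈ s, ((p : ℝ) - 1)) := by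
          gcongr; exact ih'.1
      _ = (m * (#s + 1)) * ∏ p ∈ s, ((p : ℝ) - 1) := by ring
      _ ≤ ((#s + 2) * (m - 1)) * ∏ p ∈ s, ((p : ℝ) - 1) := by
          exact mul_le_mul_of_nonneg_right (by nlinarith) h1
      _ = _ := by push_cast; ring

lemma le_card_primeFactors_mul_totient (n : ℕ) :
    (n:ℝ) ≤ (#n.primeFactors + 1) * n.totient := by
  have h1 := (prod_le_card_add_one_mul n.primeFactors fun p hp =>
    (Nat.prime_of_mem_primeFactors hp).two_le).1
  have h2 : (n.totient : ℝ) * ∏ p ∈ n.primeFactors, (p : ℝ) =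
      n * ∏ p ∈ n.primeFactors, ((p : ℝ) - 1) := by
    have := Nat.totient_mul_prod_primeFactors n
    have h3 : ((n.totient * ∏ p ∈ n.primeFactors, p : ℕ) : ℝ) =
      ((n * ∏ p ∈ n.primeFactors, (p - 1) : ℕ) : ℝ) := by rw [this]
    push_cast at h3
    rw [h3]
    congr 1
    refine prod_congr rfl fun p hp => ?_
    rw [Nat.cast_sub (Nat.prime_of_mem_primeFactors hp).one_le, Nat.cast_one]
  have h4 : (0:ℝ) < ∏ p ∈ n.primeFactors, ((p : ℝ) - 1) := prod_pos fun p hp => by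
    have : (2:ℝ) ≤ p := by exact_mod_cast (Nat.prime_of_mem_primeFactors hp).two_le
    linarith
  refine le_of_mul_le_mul_right ?_ h4
  rw [← h2]
  calc _ ≤ (n.totient:ℝ) * ((#n.primeFactors + 1) * ∏ p ∈ n.primeFactors, ((p : ℝ) - 1)) := by
        gcongr
    _ = _ := by ring

lemma two_pow_card_primeFactors_le {n : ℕ} (hn : n ≠ 0) : 2 ^ #n.primeFactors ≤ n := by
  calc 2 ^ #n.primeFactors = ∏ p ∈ n.primeFactors, 2 := by rw [prod_const]
    _ ≤ ∏ p ∈ n.primeFactors, p := prod_le_prod' fun p hp =>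
      (Nat.prime_of_mem_primeFactors hp).two_le
    _ ≤ n := Nat.le_of_dvd hn.bot_lt (Nat.prod_primeFactors_dvd n)

lemma inv_totient_le (n : ℕ) : (n.totient : ℝ)⁻¹ ≤ 8 * (n:ℝ) ^ (-(3:ℝ) / 4) := by
  rcases Nat.eq_zero_or_pos n with rfl | hn
  · simp
  have hn0 : (0:ℝ) < n := by exact_mod_cast hn
  have hφ : (0:ℝ) < n.totient := by exact_mod_cast Nat.totient_pos.2 hn
  have h1 := le_card_primeFactors_mul_totient n
  set w := #n.primeFactors
  have h2 : (w + 1 : ℝ) ≤ 8 * (n:ℝ) ^ (1 / 4 : ℝ) := by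
    have h3 : (9 / 8 : ℝ) ≤ 2 ^ (1 / 4 : ℝ) := by
      calc (9 / 8 : ℝ) = ((9 / 8) ^ 4) ^ (1 / 4 : ℝ) := by
            rw [← Real.rpow_natCast, ← Real.rpow_mul (by norm_num)]; norm_num
        _ ≤ _ := Real.rpow_le_rpow (by norm_num) (by norm_num) (by norm_num)
    have h4 := one_add_mul_le_pow (show (-2:ℝ) ≤ 1 / 8 by norm_num) w
    have h5 : ((2:ℝ) ^ (1 / 4 : ℝ)) ^ w ≤ (n:ℝ) ^ (1 / 4 : ℝ) := by
      rw [← Real.rpow_mul_natCast (by norm_num), mul_comm, Real.rpow_natCast_mul (by norm_num)]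
      gcongr
      exact_mod_cast two_pow_card_primeFactors_le hn.ne'
    have h6 : (9 / 8 : ℝ) ^ w ≤ (2 ^ (1 / 4 : ℝ)) ^ w := by gcongr
    norm_num at h4
    linarith
  rw [inv_le_iff_one_le_mul₀ hφ]
  have h7 : (n:ℝ) ^ (-(3:ℝ) / 4) * (n:ℝ) = (n:ℝ) ^ (1 / 4 : ℝ) := by
    nth_rewrite 2 [← Real.rpow_one (n:ℝ)]
    rw [← Real.rpow_add hn0]; norm_num
  have h8 : (n:ℝ) ^ (-(3:ℝ) / 4) * (n:ℝ) ^ (1 / 4 : ℝ) * (n:ℝ) ^ (1 / 2 : ℝ) = 1 := by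
    rw [← Real.rpow_add hn0, ← Real.rpow_add hn0]; norm_num
  have h9 : (n:ℝ) ^ (1 / 4 : ℝ) * (n:ℝ) ^ (-(3:ℝ) / 4) * n = (n:ℝ) ^ (1 / 4 : ℝ) * (n:ℝ) ^ (1 / 4 : ℝ) := by
    rw [mul_assoc, h7]
  have h10 : (n:ℝ) ≤ 8 * (n:ℝ) ^ (1 / 4 : ℝ) * n.totient := h1.trans (by gcongr)
  have h11 : 0 < (n:ℝ) ^ (1 / 4 : ℝ) := by positivity
  have h12 : (n:ℝ) ^ (-(3:ℝ) / 4) * n ≤ (n:ℝ) ^ (-(3:ℝ) / 4) * (8 * (n:ℝ) ^ (1 / 4 : ℝ) * n.totient) := by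
    gcongr
  rw [h7] at h12
  have h13 : (n:ℝ) ^ (1 / 4 : ℝ) * 1 ≤
      (n:ℝ) ^ (1 / 4 : ℝ) * (8 * (n:ℝ) ^ (-(3:ℝ) / 4) * n.totient) := by linarith
  exact le_of_mul_le_mul_left h13 h11

/-- The arithmetic function `n ↦ μ(n)² n / φ(n)`. -/
noncomputable def sqfRatio : ArithmeticFunction ℝ :=
  ⟨fun n => if Squarefree n then n / n.totient else 0, by simp⟩

lemma sqfRatio_apply (n : ℕ) : sqfRatio n = if Squarefree n then (n:ℝ) / n.totient else 0 := rfl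

lemma sqfRatio_isMultiplicative : sqfRatio.IsMultiplicative := by
  rw [ArithmeticFunction.IsMultiplicative.iff_ne_zero]
  refine ⟨by simp [sqfRatio_apply], fun {m n} _ _ hmn => ?_⟩
  simp only [sqfRatio_apply, Nat.squarefree_mul hmn, Nat.totient_mul hmn]
  by_cases h1 : Squarefree m <;> by_cases h2 : Squarefree n <;> simp [h1, h2]
  field_simp

/-- The Dirichlet quotient of `sqfRatio` by the constant function. -/
noncomputable def sqfRatioDiff : ArithmeticFunction ℝ := (μ : ArithmeticFunction ℝ) * sqfRatio

lemma sqfRatioDiff_mul_zeta : sqfRatioDiff * (ζ : ArithmeticFunction ℝ) = sqfRatio := by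
  rw [sqfRatioDiff, mul_right_comm, ArithmeticFunction.coe_moebius_mul_coe_zeta, one_mul]

lemma sqfRatioDiff_isMultiplicative : sqfRatioDiff.IsMultiplicative :=
  ArithmeticFunction.isMultiplicative_moebius.intCast.mul sqfRatio_isMultiplicative

lemma sqfRatioDiff_prime_pow {p : ℕ} (hp : p.Prime) (k : ℕ) :
    sqfRatioDiff (p ^ (k + 1)) = sqfRatio (p ^ (k + 1)) - sqfRatio (p ^ k) := by
  simp_rw [← sqfRatioDiff_mul_zeta, ArithmeticFunction.coe_mul_zeta_apply,
    Nat.sum_divisors_prime_pow hp]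
  rw [sum_range_succ _ (k + 1)]; ring

lemma sqfRatio_prime {p : ℕ} (hp : p.Prime) : sqfRatio p = p / (p - 1) := by
  rw [sqfRatio_apply, if_pos hp.squarefree, Nat.totient_prime hp, Nat.cast_sub hp.one_le,
    Nat.cast_one]

lemma sqfRatio_prime_pow {p : ℕ} (hp : p.Prime) (k : ℕ) : sqfRatio (p ^ (k + 2)) = 0 := by
  rw [sqfRatio_apply, if_neg]
  intro h
  have := (Nat.squarefree_pow_iff hp.ne_one (by omega)).1 h
  omega

lemma sqfRatioDiff_prime {p : ℕ} (hp : p.Prime) : sqfRatioDiff p = 1 / (p - 1) := by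
  have := sqfRatioDiff_prime_pow hp 0
  have h2 : (2:ℝ) ≤ p := by exact_mod_cast hp.two_le
  have : (p:ℝ) - 1 ≠ 0 := by linarith
  simp only [zero_add, pow_one, pow_zero, sqfRatio_isMultiplicative.map_one,
    sqfRatio_prime hp] at *
  rw [‹sqfRatioDiff p = _›]; field_simp; ring

lemma sqfRatioDiff_prime_sq {p : ℕ} (hp : p.Prime) : sqfRatioDiff (p ^ 2) = -(p / (p - 1)) := by
  rw [sqfRatioDiff_prime_pow hp 1, sqfRatio_prime_pow hp 0, pow_one, sqfRatio_prime hp, zero_sub]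

lemma sqfRatioDiff_prime_pow_eq_zero {p : ℕ} (hp : p.Prime) (k : ℕ) :
    sqfRatioDiff (p ^ (k + 3)) = 0 := by
  rw [sqfRatioDiff_prime_pow hp (k + 2), sqfRatio_prime_pow hp, sqfRatio_prime_pow hp, sub_zero]

lemma exists_sqfRatioDiff_le {n : ℕ} (hn : n ≠ 0) : ∃ a b : ℕ, n = a * b ^ 2 ∧
    |sqfRatioDiff n| ≤ (a.totient : ℝ)⁻¹ * (b / b.totient) := by
  induction n using Nat.recOnPosPrimePosCoprime with
  | zero => exact absurd rfl hn
  | one => exact ⟨1, 1, by norm_num, by simp [sqfRatioDiff_isMultiplicative.map_one]⟩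
  | prime_pow p k hp hk =>
    have h2 : (2:ℝ) ≤ p := by exact_mod_cast hp.two_le
    match k, hk with
    | 1, _ =>
      refine ⟨p, 1, by ring, ?_⟩
      rw [pow_one, sqfRatioDiff_prime hp, Nat.totient_prime hp, Nat.cast_sub hp.one_le,
        abs_of_nonneg (by apply div_nonneg <;> linarith)]
      simp
    | 2, _ =>
      refine ⟨1, p, by ring, ?_⟩
      rw [sqfRatioDiff_prime_sq hp, Nat.totient_prime hp, Nat.cast_sub hp.one_le, abs_neg,
        abs_of_nonneg (by apply div_nonneg <;> linarith)]
      simp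
    | k + 3, _ =>
      refine ⟨p ^ (k + 3), 1, by ring, ?_⟩
      rw [sqfRatioDiff_prime_pow_eq_zero hp, abs_zero]
      positivity
  | coprime m n hm hn' hmn ihm ihn =>
    obtain ⟨a, b, h1, h2⟩ := ihm (by omega)
    obtain ⟨c, d, h3, h4⟩ := ihn (by omega)
    refine ⟨a * c, b * d, by rw [h1, h3]; ring, ?_⟩
    have hac : a.Coprime c := Nat.Coprime.coprime_dvd_left ⟨b ^ 2, h1⟩
      (Nat.Coprime.coprime_dvd_right ⟨d ^ 2, h3⟩ hmn)
    have hbd : b.Coprime d := Nat.Coprime.coprime_dvd_left ⟨a * b, by rw [h1]; ring⟩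
      (Nat.Coprime.coprime_dvd_right ⟨c * d, by rw [h3]; ring⟩ hmn)
    rw [sqfRatioDiff_isMultiplicative.map_mul_of_coprime hmn, abs_mul, Nat.totient_mul hac,
      Nat.totient_mul hbd]
    calc _ ≤ ((a.totient : ℝ)⁻¹ * (b / b.totient)) * ((c.totient : ℝ)⁻¹ * (d / d.totient)) := by
          gcongr
      _ = _ := by push_cast; field_simp

/-- The arithmetic function `n ↦ 1 / φ(n)`. -/
noncomputable def invTotient : ArithmeticFunction ℝ := ⟨fun n => (n.totient : ℝ)⁻¹, by simp⟩

lemma invTotient_apply (n : ℕ) : invTotient n = (n.totient : ℝ)⁻¹ := rfl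

lemma invTotient_isMultiplicative : invTotient.IsMultiplicative := by
  rw [ArithmeticFunction.IsMultiplicative.iff_ne_zero]
  refine ⟨by simp [invTotient_apply], fun {m n} _ _ hmn => ?_⟩
  simp [invTotient_apply, Nat.totient_mul hmn, mul_comm]

lemma div_totient_le (n : ℕ) (hn : n ≠ 0) :
    (n:ℝ) / n.totient ≤ (invTotient * (ζ : ArithmeticFunction ℝ)) n := by
  have hmul := invTotient_isMultiplicative.mul
    (ArithmeticFunction.isMultiplicative_zeta.natCast (R := ℝ))
  induction n using Nat.recOnPosPrimePosCoprime with
  | zero => exact absurd rfl hn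
  | one => simp [hmul.map_one]
  | prime_pow p k hp hk =>
    obtain ⟨k, rfl⟩ : ∃ j, k = j + 1 := ⟨k - 1, by omega⟩
    rw [ArithmeticFunction.coe_mul_zeta_apply, Nat.sum_divisors_prime_pow hp, sum_range_succ',
      sum_range_succ']
    have h2 : (2:ℝ) ≤ p := by exact_mod_cast hp.two_le
    have h3 : (0:ℝ) < p - 1 := by linarith
    have h1 : 0 ≤ ∑ x ∈ range k, invTotient (p ^ (x + 1 + 1)) :=
      sum_nonneg fun x _ => by rw [invTotient_apply]; positivity
    have h4 : invTotient (p ^ (0 + 1)) = 1 / (p - 1) := by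
      rw [zero_add, pow_one, invTotient_apply, Nat.totient_prime hp, Nat.cast_sub hp.one_le,
        Nat.cast_one, one_div]
    have h5 : ((p ^ (k + 1) : ℕ) : ℝ) / (p ^ (k + 1)).totient = p / (p - 1) := by
      rw [Nat.totient_prime_pow hp (by omega), Nat.add_sub_cancel]
      push_cast [Nat.cast_sub hp.one_le]
      have : (p:ℝ) ≠ 0 := by linarith
      field_simp
      ring
    rw [h5, h4, pow_zero, invTotient_isMultiplicative.map_one]
    have : (p:ℝ) / (p - 1) = 1 / (p - 1) + 1 := by field_simp; ring
    linarith
  | coprime m n hm hn' hmn ihm ihn =>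
    rw [hmul.map_mul_of_coprime hmn, Nat.totient_mul hmn]
    push_cast
    rw [mul_div_mul_comm]
    have := ihm (by omega)
    have := ihn (by omega)
    have h0 : 0 ≤ (m:ℝ) / m.totient := by positivity
    gcongr
    linarith

lemma summable_inv_totient_mul :
    Summable fun n : ℕ => (n.totient : ℝ)⁻¹ * (n:ℝ) ^ (-(1:ℝ) / 2) := by
  refine Summable.of_nonneg_of_le (fun n => by positivity) (fun n => ?_)
    (((Real.summable_nat_rpow (p := -(5:ℝ) / 4)).2 (by norm_num)).mul_left 8)
  rcases n.eq_zero_or_pos with rfl | hn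
  · simp
  have hn' : (0:ℝ) < n := by exact_mod_cast hn
  calc _ ≤ 8 * (n:ℝ) ^ (-(3:ℝ) / 4) * (n:ℝ) ^ (-(1:ℝ) / 2) := by gcongr; exact inv_totient_le n
    _ = 8 * (n:ℝ) ^ (-(5:ℝ) / 4) := by rw [mul_assoc, ← Real.rpow_add hn']; norm_num

lemma exists_sum_div_totient_le :
    ∃ K : ℝ, 0 < K ∧ ∀ N : ℕ, ∑ n ∈ Ioc 0 N, (n:ℝ) / n.totient ≤ K * N := by
  refine ⟨∑' n : ℕ, (n.totient : ℝ)⁻¹ * (n:ℝ) ^ (-(1:ℝ) / 2) + 1, ?_, fun N => ?_⟩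
  · have : 0 ≤ ∑' n : ℕ, (n.totient : ℝ)⁻¹ * (n:ℝ) ^ (-(1:ℝ) / 2) :=
      tsum_nonneg fun n => by positivity
    linarith
  calc _ ≤ ∑ n ∈ Ioc 0 N, (invTotient * (ζ : ArithmeticFunction ℝ)) n :=
        sum_le_sum fun n hn => div_totient_le n (by have := (mem_Ioc.1 hn).1; omega)
    _ = ∑ n ∈ Ioc 0 N, invTotient n * ↑(N / n) := ArithmeticFunction.sum_Ioc_mul_zeta_eq_sum _ N
    _ ≤ ∑ n ∈ Ioc 0 N, (n.totient : ℝ)⁻¹ * (n:ℝ) ^ (-(1:ℝ) / 2) * N := by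
        refine sum_le_sum fun n hn => ?_
        have hn1 : (1:ℝ) ≤ n := by exact_mod_cast (mem_Ioc.1 hn).1
        rw [invTotient_apply, mul_assoc]
        gcongr
        calc ((N / n : ℕ) : ℝ) ≤ N / n := Nat.cast_div_le
          _ = (n:ℝ) ^ (-(1:ℝ)) * N := by rw [Real.rpow_neg_one]; ring
          _ ≤ _ := by
            gcongr
            norm_num
    _ ≤ (∑' n : ℕ, (n.totient : ℝ)⁻¹ * (n:ℝ) ^ (-(1:ℝ) / 2)) * N := by
        rw [← sum_mul]
        gcongr
        exact summable_inv_totient_mul.sum_le_tsum _ fun n _ => by positivity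
    _ ≤ _ := by gcongr; linarith

lemma exists_sum_abs_sqfRatioDiff_le :
    ∃ K : ℝ, 0 < K ∧ ∀ N : ℕ, ∑ n ∈ Ioc 0 N, |sqfRatioDiff n| ≤ K * √N := by
  obtain ⟨K, hK, h⟩ := exists_sum_div_totient_le
  refine ⟨K * (∑' n : ℕ, (n.totient : ℝ)⁻¹ * (n:ℝ) ^ (-(1:ℝ) / 2) + 1), ?_, fun N => ?_⟩
  · have : 0 ≤ ∑' n : ℕ, (n.totient : ℝ)⁻¹ * (n:ℝ) ^ (-(1:ℝ) / 2) :=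
      tsum_nonneg fun n => by positivity
    positivity
  choose! a b hab hg using fun (n : ℕ) (hn : n ≠ 0) => exists_sqfRatioDiff_le hn
  set F : (Σ _ : ℕ, ℕ) → ℝ := fun p => (p.1.totient : ℝ)⁻¹ * (p.2 / p.2.totient) with hF
  have hF0 : ∀ p, 0 ≤ F p := fun p => by positivity
  calc ∑ n ∈ Ioc 0 N, |sqfRatioDiff n| ≤ ∑ n ∈ Ioc 0 N, F ⟨a n, b n⟩ :=
        sum_le_sum fun n hn => hg n (by have := (mem_Ioc.1 hn).1; omega)
    _ = ∑ p ∈ (Ioc 0 N).image fun n => (⟨a n, b n⟩ : Σ _ : ℕ, ℕ), F p := by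
        rw [sum_image]
        intro m hm n hn hmn
        simp only [Sigma.mk.injEq, heq_eq_eq] at hmn
        have h1 := hab m (by have := (mem_Ioc.1 hm).1; omega)
        have h2 := hab n (by have := (mem_Ioc.1 hn).1; omega)
        rw [h1, h2, hmn.1, hmn.2]
    _ ≤ ∑ p ∈ (Ioc 0 N).sigma fun a => Ioc 0 (N / a).sqrt, F p := by
        refine sum_le_sum_of_subset_of_nonneg ?_ fun p _ _ => hF0 p
        intro p hp
        obtain ⟨n, hn, rfl⟩ := mem_image.1 hp
        rw [mem_Ioc] at hn
        have h1 := hab n (by omega)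
        have ha : a n ≠ 0 := by rintro h0; rw [h0] at h1; omega
        have hb : b n ≠ 0 := by rintro h0; rw [h0] at h1; omega
        simp only [mem_sigma, mem_Ioc]
        have hb1 : 1 ≤ b n ^ 2 := Nat.one_le_pow _ _ (by omega)
        refine ⟨⟨by omega, ?_⟩, by omega, ?_⟩
        · nlinarith
        · rw [Nat.le_sqrt', Nat.le_div_iff_mul_le (by omega)]
          nlinarith
    _ = ∑ a ∈ Ioc 0 N, (a.totient : ℝ)⁻¹ * ∑ b ∈ Ioc 0 (N / a).sqrt, (b : ℝ) / b.totient := by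
        rw [sum_sigma]
        simp only [hF, mul_sum]
    _ ≤ ∑ a ∈ Ioc 0 N, (a.totient : ℝ)⁻¹ * (K * (√N * (a:ℝ) ^ (-(1:ℝ) / 2))) := by
        refine sum_le_sum fun n hn => ?_
        gcongr
        refine (h _).trans ?_
        gcongr
        have hn0 : (0:ℝ) < n := by exact_mod_cast (mem_Ioc.1 hn).1
        calc (((N / n).sqrt : ℕ) : ℝ) ≤ √((N / n : ℕ) : ℝ) := Real.nat_sqrt_le_real_sqrt
          _ ≤ √((N:ℝ) / n) := by gcongr; exact Nat.cast_div_le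
          _ = √N * (n:ℝ) ^ (-(1:ℝ) / 2) := by
            rw [Real.sqrt_div (by positivity), neg_div, Real.rpow_neg hn0.le, ← Real.sqrt_eq_rpow,
              div_eq_mul_inv]
    _ = K * (∑ a ∈ Ioc 0 N, (a.totient : ℝ)⁻¹ * (a:ℝ) ^ (-(1:ℝ) / 2)) * √N := by
        rw [mul_sum, sum_mul]
        exact sum_congr rfl fun n _ => by ring
    _ ≤ _ := by
        gcongr
        have := summable_inv_totient_mul.sum_le_tsum (Ioc 0 N) fun n _ => by positivity
        linarith

lemma abs_sum_div_le_of_sqrt {b : ℕ → ℝ} {K : ℝ} (hK : 0 ≤ K) {N M : ℕ} (hN : 1 ≤ N) (hNM : N ≤ M)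
    (hb : ∀ j, N ≤ j → |∑ n ∈ Ioc N j, b n| ≤ K * √j) :
    |∑ n ∈ Ioc N M, b n / n| ≤ 2 * K / √N := by
  have key : ∀ M, N ≤ M → K / √M + ∑ n ∈ Ico N M, K * √n / (n * (n + 1)) ≤
      2 * K / √N - K / √M := by
    intro M hM
    induction M, hM using Nat.le_induction with
    | base => simp; ring_nf; rfl
    | succ j hj ih =>
      rw [sum_Ico_succ_top hj]
      have hj0 : (0:ℝ) < j := by exact_mod_cast hN.trans hj
      have hs : 0 < √(j:ℝ) := Real.sqrt_pos.2 hj0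
      have ht : 0 < √((j:ℝ) + 1) := Real.sqrt_pos.2 (by linarith)
      have hs2 : √(j:ℝ) ^ 2 = j := Real.sq_sqrt hj0.le
      have ht2 : √((j:ℝ) + 1) ^ 2 = j + 1 := Real.sq_sqrt (by linarith)
      have hst : √(j:ℝ) ≤ √((j:ℝ) + 1) := Real.sqrt_le_sqrt (by linarith)
      have : √(j:ℝ) / (j * (j + 1)) ≤ 2 * (1 / √(j:ℝ) - 1 / √((j:ℝ) + 1)) := by
        have h1 : √(j:ℝ) / (j * (j + 1)) = 1 / (√(j:ℝ) * √((j:ℝ) + 1) ^ 2) := by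
          rw [ht2]; nth_rewrite 2 [← hs2]; field_simp
        have h2 : 2 * (1 / √(j:ℝ) - 1 / √((j:ℝ) + 1)) =
            2 / (√(j:ℝ) * √((j:ℝ) + 1) * (√(j:ℝ) + √((j:ℝ) + 1))) := by
          field_simp
          nlinarith
        rw [h1, h2, div_le_div_iff₀ (by positivity) (by positivity)]
        have : 0 ≤ √(j:ℝ) * √((j:ℝ) + 1) * (√((j:ℝ) + 1) - √(j:ℝ)) :=
          mul_nonneg (by positivity) (by linarith)
        nlinarith
      have h3 := mul_le_mul_of_nonneg_left this hK
      push_cast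
      have e1 : K * √(j:ℝ) / (j * (j + 1)) = K * (√(j:ℝ) / (j * (j + 1))) := by ring
      have e2 : K * (2 * (1 / √(j:ℝ) - 1 / √((j:ℝ) + 1))) = 2 * (K / √j) - 2 * (K / √((j:ℝ) + 1)) := by
        ring
      rw [e1]
      linarith
  have h0 := sum_mul_by_parts (b := b) (w := fun n : ℕ => ((n:ℝ))⁻¹) hNM
  have e : ∑ n ∈ Ioc N M, b n / n = ∑ n ∈ Ioc N M, ((n:ℝ))⁻¹ * b n :=
    sum_congr rfl fun n _ => by ring
  rw [e, h0]
  have hM0 : (0:ℝ) < M := by exact_mod_cast hN.trans hNM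
  refine (abs_sub _ _).trans (le_trans ?_ ((key M hNM).trans (by
    have : 0 ≤ K / √M := by positivity
    linarith)))
  gcongr
  · rw [abs_mul, abs_of_pos (inv_pos.2 hM0)]
    calc (M:ℝ)⁻¹ * _ ≤ (M:ℝ)⁻¹ * (K * √M) := by gcongr; exact hb M hNM
      _ = K / √M := by
        have := Real.mul_self_sqrt hM0.le
        have h1 : 0 < √(M:ℝ) := Real.sqrt_pos.2 hM0
        nth_rewrite 1 [← this]
        field_simp
  · refine (abs_sum_le_sum_abs _ _).trans (sum_le_sum fun n hn => ?_)
    have hn := mem_Ico.1 hn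
    have hn0 : (0:ℝ) < n := by exact_mod_cast hN.trans hn.1
    rw [abs_mul]
    have : |((n + 1 : ℕ) : ℝ)⁻¹ - (n:ℝ)⁻¹| = 1 / (n * (n + 1)) := by
      push_cast
      rw [abs_sub_comm, abs_of_nonneg]
      · field_simp; ring
      · rw [sub_nonneg]; gcongr; linarith
    rw [this]
    calc _ ≤ 1 / ((n:ℝ) * (n + 1)) * (K * √n) := by gcongr; exact hb n hn.1
      _ = _ := by ring

lemma exists_sum_abs_sqfRatioDiff_div_le :
    ∃ K : ℝ, 0 < K ∧ ∀ N M : ℕ, 1 ≤ N → N ≤ M →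
      ∑ n ∈ Ioc N M, |sqfRatioDiff n| / n ≤ K / √N := by
  obtain ⟨K, hK, h⟩ := exists_sum_abs_sqfRatioDiff_le
  refine ⟨2 * K, by positivity, fun N M hN hNM => ?_⟩
  refine (le_abs_self _).trans (abs_sum_div_le_of_sqrt hK.le hN hNM fun j hj => ?_)
  rw [abs_of_nonneg (sum_nonneg fun n _ => abs_nonneg _)]
  refine (sum_le_sum_of_subset_of_nonneg ?_ fun n _ _ => abs_nonneg _).trans (h j)
  exact Ioc_subset_Ioc_left (Nat.zero_le _)

lemma summable_norm_sqfRatioDiff_div : Summable fun n : ℕ => ‖sqfRatioDiff n / n‖ := by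
  obtain ⟨K, hK, h⟩ := exists_sum_abs_sqfRatioDiff_div_le
  refine summable_of_sum_range_le (c := |sqfRatioDiff 1| + K) (fun n => norm_nonneg _) fun n => ?_
  have hsub : range n ⊆ insert 0 (insert 1 (Ioc 1 (n + 1))) := by
    intro m hm
    have := mem_range.1 hm
    simp only [mem_insert, mem_Ioc]; omega
  refine (sum_le_sum_of_subset_of_nonneg hsub fun n _ _ => norm_nonneg _).trans ?_
  rw [sum_insert (by simp), sum_insert (by simp)]
  have := h 1 (n + 1) le_rfl (by omega)
  simp only [Nat.cast_one, Real.sqrt_one, div_one] at this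
  simp only [norm_div, Real.norm_eq_abs, Nat.abs_cast, Nat.cast_zero, div_zero, Nat.cast_one,
    div_one]
  linarith

lemma tsum_sqfRatioDiff_div : ∑' n : ℕ, sqfRatioDiff n / n = 1 := by
  have h := EulerProduct.eulerProduct_hasProd (f := fun n : ℕ => sqfRatioDiff n / n)
    (by simp [sqfRatioDiff_isMultiplicative.map_one])
    (fun {m n} hmn => by
      simp only [sqfRatioDiff_isMultiplicative.map_mul_of_coprime hmn]
      push_cast
      rw [mul_div_mul_comm])
    summable_norm_sqfRatioDiff_div (by simp)
  have h1 : ∀ p : Nat.Primes, ∑' e : ℕ, sqfRatioDiff ((p : ℕ) ^ e) / ((p ^ e : ℕ) : ℝ) = 1 := by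
    intro p
    rw [tsum_eq_sum (s := range 3)]
    · rw [sum_range_succ, sum_range_succ, sum_range_one, pow_zero, pow_one,
        sqfRatioDiff_prime p.2, sqfRatioDiff_prime_sq p.2, sqfRatioDiff_isMultiplicative.map_one]
      push_cast
      have : (2:ℝ) ≤ (p:ℕ) := by exact_mod_cast p.2.two_le
      have h2 : ((p:ℕ):ℝ) - 1 ≠ 0 := by linarith
      have h3 : ((p:ℕ):ℝ) ≠ 0 := by linarith
      field_simp
      ring
    · intro k hk
      obtain ⟨j, rfl⟩ : ∃ j, k = j + 3 := ⟨k - 3, by simp at hk; omega⟩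
      rw [sqfRatioDiff_prime_pow_eq_zero p.2, zero_div]
  simp only [h1] at h
  exact (hasProd_one.unique h).symm

lemma exists_abs_sum_sqfRatioDiff_div_sub_one_le :
    ∃ K : ℝ, 0 < K ∧ ∀ N : ℕ, 1 ≤ N → |∑ n ∈ Ioc 0 N, sqfRatioDiff n / n - 1| ≤ K / √N := by
  obtain ⟨K, hK, h⟩ := exists_sum_abs_sqfRatioDiff_div_le
  refine ⟨K, hK, fun N hN => ?_⟩
  have ht : Tendsto (fun M => ∑ n ∈ Ioc 0 M, sqfRatioDiff n / n) atTop (𝓝 1) := by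
    have h1 := (summable_norm_sqfRatioDiff_div.of_norm.hasSum.tendsto_sum_nat).comp
      (tendsto_add_atTop_nat 1)
    rw [tsum_sqfRatioDiff_div] at h1
    refine h1.congr fun M => ?_
    simp only [Function.comp]
    rw [range_eq_Ico, sum_eq_sum_Ico_succ_bot (by omega)]
    simp only [Nat.cast_zero, div_zero, zero_add]
    rfl
  have ht2 := (ht.const_sub (∑ n ∈ Ioc 0 N, sqfRatioDiff n / n)).abs
  refine le_of_tendsto ht2 ?_
  filter_upwards [eventually_ge_atTop N] with M hM
  rw [← sum_Ioc_consecutive _ (Nat.zero_le N) hM]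
  rw [sub_add_cancel_left, abs_neg]
  refine (abs_sum_le_sum_abs _ _).trans ((sum_le_sum fun n _ => ?_).trans (h N M hN hM))
  rw [abs_div, Nat.abs_cast]

lemma exists_abs_sum_sqfRatio_sub_le :
    ∃ K : ℝ, 0 < K ∧ ∀ N : ℕ, |∑ n ∈ Ioc 0 N, sqfRatio n - N| ≤ K * √N := by
  obtain ⟨K, hK, h⟩ := exists_sum_abs_sqfRatioDiff_le
  obtain ⟨L, hL, h'⟩ := exists_abs_sum_sqfRatioDiff_div_sub_one_le
  refine ⟨K + L, by positivity, fun N => ?_⟩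
  rcases N.eq_zero_or_pos with rfl | hN
  · simp
  have hN0 : (0:ℝ) < N := by exact_mod_cast hN
  rw [← sqfRatioDiff_mul_zeta, ArithmeticFunction.sum_Ioc_mul_zeta_eq_sum]
  have e : ∑ n ∈ Ioc 0 N, sqfRatioDiff n * ((N / n : ℕ) : ℝ) - N =
      ∑ n ∈ Ioc 0 N, sqfRatioDiff n * (((N / n : ℕ) : ℝ) - N / n) +
        N * (∑ n ∈ Ioc 0 N, sqfRatioDiff n / n - 1) := by
    rw [mul_sub, mul_sum, mul_one, ← add_sub_assoc, ← sum_add_distrib]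
    congr 1
    exact sum_congr rfl fun n _ => by ring
  rw [e]
  refine (abs_add_le _ _).trans ?_
  have h1 : |∑ n ∈ Ioc 0 N, sqfRatioDiff n * (((N / n : ℕ) : ℝ) - N / n)| ≤ K * √N := by
    refine (abs_sum_le_sum_abs _ _).trans ((sum_le_sum fun n hn => ?_).trans (h N))
    rw [abs_mul]
    refine mul_le_of_le_one_right (abs_nonneg _) ?_
    have h2 : ((N / n : ℕ) : ℝ) ≤ N / n := Nat.cast_div_le
    have h3 : (N:ℝ) / n < ((N / n : ℕ) : ℝ) + 1 := by
      rw [← Nat.floor_div_eq_div (K := ℝ)]; exact Nat.lt_floor_add_one _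
    rw [abs_le]; constructor <;> linarith
  have h2 : |N * (∑ n ∈ Ioc 0 N, sqfRatioDiff n / n - 1)| ≤ L * √N := by
    rw [abs_mul, Nat.abs_cast]
    calc (N:ℝ) * _ ≤ N * (L / √N) := by gcongr; exact h' N hN
      _ = L * √N := by
        have := Real.mul_self_sqrt hN0.le
        have h1 : 0 < √(N:ℝ) := Real.sqrt_pos.2 hN0
        nth_rewrite 1 [← this]
        field_simp
  linarith

lemma exists_sum_sqfRatio_sub_one_div :
    ∃ c K : ℝ, 0 < K ∧ ∀ N : ℕ, 1 ≤ N →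
      |∑ n ∈ Ioc 0 N, (sqfRatio n - 1) / n - c| ≤ K / √N := by
  obtain ⟨K, hK, h⟩ := exists_abs_sum_sqfRatio_sub_le
  have h1 : ∀ N M : ℕ, 1 ≤ N → N ≤ M →
      |∑ n ∈ Ioc 0 M, (sqfRatio n - 1) / n - ∑ n ∈ Ioc 0 N, (sqfRatio n - 1) / n| ≤
        4 * K / √N := by
    intro N M hN hNM
    rw [← sum_Ioc_consecutive _ (Nat.zero_le N) hNM, add_sub_cancel_left]
    have := abs_sum_div_le_of_sqrt (b := fun n => sqfRatio n - 1) (K := 2 * K) (by positivity)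
      hN hNM fun j hj => ?_
    · convert this using 1; ring
    · have e : ∑ n ∈ Ioc N j, (sqfRatio n - 1) =
          (∑ n ∈ Ioc 0 j, sqfRatio n - j) - (∑ n ∈ Ioc 0 N, sqfRatio n - N) := by
        rw [← sum_Ioc_consecutive _ (Nat.zero_le N) hj, sum_sub_distrib]
        simp [Nat.cast_sub hj]; ring
      rw [e]
      refine (abs_sub _ _).trans ?_
      have : √(N:ℝ) ≤ √j := by gcongr
      have := mul_le_mul_of_nonneg_left this hK.le
      linarith [h j, h N]
  have hlim : Tendsto (fun N : ℕ => 2 * (4 * K / √(N:ℝ))) atTop (𝓝 0) := by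
    have h2 : Tendsto (fun N : ℕ => √(N:ℝ)) atTop atTop :=
      Real.tendsto_sqrt_atTop.comp tendsto_natCast_atTop_atTop
    simpa using (h2.const_div_atTop (4 * K)).const_mul 2
  have hc : CauchySeq fun N : ℕ => ∑ n ∈ Ioc 0 (N + 1), (sqfRatio n - 1) / n := by
    refine cauchySeq_of_le_tendsto_0 (fun N : ℕ => 2 * (4 * K / √((N + 1 : ℕ):ℝ)))
      (fun n m N hn hm => ?_) (hlim.comp (tendsto_add_atTop_nat 1))
    refine (dist_triangle_right _ _ (∑ n ∈ Ioc 0 (N + 1), (sqfRatio n - 1) / n)).trans ?_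
    rw [Real.dist_eq, Real.dist_eq]
    linarith [h1 (N + 1) (n + 1) (by omega) (by omega), h1 (N + 1) (m + 1) (by omega) (by omega)]
  obtain ⟨c, hc⟩ := cauchySeq_tendsto_of_complete hc
  refine ⟨c, 4 * K, by positivity, fun N hN => ?_⟩
  rw [abs_sub_comm]
  refine le_of_tendsto (hc.sub_const _).abs ?_
  filter_upwards [eventually_ge_atTop N] with M hM
  exact h1 N (M + 1) hN (by omega)

lemma abs_harmonic_sub_log_sub_le {N : ℕ} (hN : 1 ≤ N) :
    |∑ n ∈ Ioc 0 N, (n:ℝ)⁻¹ - Real.log N - Real.eulerMascheroniConstant| ≤ 1 / N := by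
  have h1 := Real.eulerMascheroniSeq_lt_eulerMascheroniConstant (N - 1)
  have h2 := Real.eulerMascheroniConstant_lt_eulerMascheroniSeq' N
  have e : ((harmonic N : ℚ) : ℝ) = ∑ n ∈ Ioc 0 N, (n:ℝ)⁻¹ := by
    rw [harmonic_eq_sum_Icc]
    push_cast
    rfl
  have e2 : ((harmonic (N - 1) : ℚ) : ℝ) = ((harmonic N : ℚ) : ℝ) - 1 / N := by
    obtain ⟨M, rfl⟩ : ∃ M, N = M + 1 := ⟨N - 1, by omega⟩
    rw [Nat.add_sub_cancel, harmonic_succ]; push_cast; ring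
  rw [Real.eulerMascheroniSeq, e2, e] at h1
  rw [Real.eulerMascheroniSeq', if_neg (by omega), e] at h2
  rw [show ((N - 1 : ℕ) : ℝ) + 1 = N by rw [Nat.cast_sub hN]; simp] at h1
  rw [abs_le]; constructor <;> linarith [show (0:ℝ) ≤ 1 / N by positivity]

/-- `Σ_{r ≤ R} μ(r)² / φ(r)`. -/
noncomputable def sqfSum (R : ℝ) : ℝ :=
  ∑ r ∈ Icc 1 ⌊R⌋₊, (if Squarefree r then (r.totient : ℝ)⁻¹ else 0)

theorem exists_sqfSum_asymptotic :
    ∃ c K : ℝ, 0 < K ∧ ∀ R : ℝ, 1 ≤ R →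
      |sqfSum R - Real.log R - c| ≤ K * R ^ (-(1:ℝ) / 2) := by
  obtain ⟨c, K, hK, h⟩ := exists_sum_sqfRatio_sub_one_div
  refine ⟨c + Real.eulerMascheroniConstant, 2 * (K + 2), by positivity, fun R hR => ?_⟩
  set N := ⌊R⌋₊ with hNdef
  have hN : 1 ≤ N := Nat.le_floor (by simpa using hR)
  have hN1 : (1:ℝ) ≤ N := by exact_mod_cast hN
  have hN0 : (0:ℝ) < N := by linarith
  have hNR : (N:ℝ) ≤ R := Nat.floor_le (by linarith)
  have hRN : R < N + 1 := Nat.lt_floor_add_one R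
  have e : sqfSum R = ∑ n ∈ Ioc 0 N, (sqfRatio n - 1) / n + ∑ n ∈ Ioc 0 N, (n:ℝ)⁻¹ := by
    rw [← sum_add_distrib, sqfSum]
    refine sum_congr rfl fun n hn => ?_
    have hn0 : (n:ℝ) ≠ 0 := by have := (mem_Icc.1 hn).1; positivity
    rw [sqfRatio_apply]
    split_ifs
    · field_simp; ring
    · field_simp; ring
  have hs1 : 1 ≤ √(N:ℝ) := Real.one_le_sqrt.2 hN1
  have hNs : 1 / (N:ℝ) ≤ 1 / √N := by
    gcongr
    rw [Real.sqrt_le_left (by linarith)]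
    nlinarith
  have h3 : |Real.log N - Real.log R| ≤ 1 / N := by
    rw [abs_sub_comm, abs_of_nonneg (by rw [sub_nonneg]; gcongr),
      ← Real.log_div (by linarith) (by linarith)]
    refine (Real.log_le_sub_one_of_pos (by positivity)).trans ?_
    rw [div_sub_one (by linarith)]
    gcongr
    linarith
  have h4 : 1 / √(N:ℝ) ≤ 2 * R ^ (-(1:ℝ) / 2) := by
    rw [neg_div, Real.rpow_neg (by linarith), ← Real.sqrt_eq_rpow, ← div_eq_mul_inv,
      div_le_div_iff₀ (by linarith) (Real.sqrt_pos.2 (by linarith)), one_mul]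
    rw [Real.sqrt_le_left (by positivity), mul_pow, Real.sq_sqrt hN0.le]
    linarith
  have h1 := h N hN
  have h2 := abs_harmonic_sub_log_sub_le hN
  rw [e]
  calc |_| = |(∑ n ∈ Ioc 0 N, (sqfRatio n - 1) / n - c) +
      (∑ n ∈ Ioc 0 N, (n:ℝ)⁻¹ - Real.log N - Real.eulerMascheroniConstant) +
      (Real.log N - Real.log R)| := by congr 1; ring
    _ ≤ K / √N + 1 / N + 1 / N := by
      refine (abs_add_le _ _).trans (add_le_add ((abs_add_le _ _).trans (add_le_add h1 h2)) h3)
    _ ≤ (K + 2) * (1 / √N) := by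
      have : K / √N = K * (1 / √N) := by ring
      linarith
    _ ≤ (K + 2) * (2 * R ^ (-(1:ℝ) / 2)) := by gcongr
    _ = _ := by ring

/-- The additive character `t ↦ exp (2 * π * i * t)`. -/
noncomputable def expTurn (t : ℝ) : ℂ := Complex.exp (2 * Real.pi * t * Complex.I)

lemma expTurn_add (s t : ℝ) : expTurn (s + t) = expTurn s * expTurn t := by
  rw [expTurn, expTurn, expTurn, ← Complex.exp_add]; push_cast; ring_nf

lemma norm_expTurn (t : ℝ) : ‖expTurn t‖ = 1 := by
  rw [expTurn, show (2 * Real.pi * t * Complex.I : ℂ) = ((2 * Real.pi * t : ℝ) : ℂ) * Complex.I by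
    push_cast; ring, Complex.norm_exp_ofReal_mul_I]

lemma expTurn_intCast (n : ℤ) : expTurn n = 1 := by
  rw [expTurn, Complex.exp_eq_one_iff]; exact ⟨n, by push_cast; ring⟩

lemma expTurn_natCast (n : ℕ) : expTurn n = 1 := expTurn_intCast n

lemma expTurn_natCast_mul (n : ℕ) (t : ℝ) : expTurn (n * t) = expTurn t ^ n := by
  rw [expTurn, expTurn, ← Complex.exp_nat_mul]; push_cast; ring_nf

lemma conj_expTurn (t : ℝ) : (starRingEnd ℂ) (expTurn t) = expTurn (-t) := by
  rw [expTurn, expTurn, ← Complex.exp_conj]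
  congr 1
  simp only [map_mul, Complex.conj_ofReal, Complex.conj_I, map_ofNat, Complex.ofReal_neg]
  ring

lemma norm_expTurn_sub_one (t : ℝ) : ‖expTurn t - 1‖ = 2 * |Real.sin (Real.pi * t)| := by
  rw [expTurn, show (2 * Real.pi * t * Complex.I : ℂ) =
    Complex.I * ((2 * Real.pi * t : ℝ) : ℂ) by push_cast; ring,
    Complex.norm_exp_I_mul_ofReal_sub_one, norm_mul, Real.norm_eq_abs, Real.norm_eq_abs, abs_two]
  congr 3; ring

lemma norm_expTurn_sub_one_le (t : ℝ) : ‖expTurn t - 1‖ ≤ 2 * Real.pi * |t| := by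
  rw [norm_expTurn_sub_one]
  have h : |Real.sin (Real.pi * t)| ≤ |Real.pi * t| := Real.abs_sin_le_abs
  rw [abs_mul, abs_of_pos Real.pi_pos] at h
  linarith

lemma expTurn_emod_div (h : ℤ) {s : ℕ} (hs : s ≠ 0) :
    expTurn (((h % s : ℤ) : ℝ) / s) = expTurn (h / s) := by
  have hs' : (s:ℝ) ≠ 0 := by exact_mod_cast hs
  have e : (h:ℝ) / s = ((h % s : ℤ) : ℝ) / s + ((h / s : ℤ) : ℝ) := by
    have := Int.emod_add_mul_ediv h s
    field_simp
    exact_mod_cast this.symm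
  rw [e, expTurn_add, expTurn_intCast, mul_one]

lemma le_norm_expTurn_div_sub_one (h : ℤ) {s : ℕ} (hs : s ≠ 0) :
    4 * min ((h % s : ℤ) : ℝ) (s - (h % s : ℤ)) / s ≤ ‖expTurn (h / s) - 1‖ := by
  rw [← expTurn_emod_div h hs, norm_expTurn_sub_one]
  have hs0 : (0:ℝ) < s := by positivity
  have hv0 : (0:ℝ) ≤ (h % s : ℤ) := by exact_mod_cast Int.emod_nonneg _ (by exact_mod_cast hs)
  have hvs : ((h % s : ℤ) : ℝ) ≤ s := by
    exact_mod_cast (Int.emod_lt_of_pos h (by positivity : (0:ℤ) < s)).le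
  set v : ℝ := ((h % s : ℤ) : ℝ)
  have hπ := Real.pi_pos
  have key : ∀ w : ℝ, 0 ≤ w → w ≤ s / 2 → 2 * w / s ≤ Real.sin (Real.pi * (w / s)) := by
    intro w hw hws
    have := Real.mul_le_sin (x := Real.pi * (w / s)) (by positivity) (by
      have : w / s ≤ 1 / 2 := by rw [div_le_iff₀ hs0]; linarith
      nlinarith)
    refine le_trans (le_of_eq ?_) this
    field_simp
  rcases le_total v (s / 2) with h1 | h1
  · have := key v hv0 h1
    rw [min_eq_left (by linarith)]
    have := le_abs_self (Real.sin (Real.pi * (v / s)))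
    calc 4 * v / s = 2 * (2 * v / s) := by ring
      _ ≤ _ := by linarith
  · have := key (s - v) (by linarith) (by linarith)
    rw [min_eq_right (by linarith)]
    have e : Real.sin (Real.pi * ((s - v) / s)) = Real.sin (Real.pi * (v / s)) := by
      rw [← Real.sin_pi_sub]; congr 1; field_simp; ring
    rw [e] at this
    have := le_abs_self (Real.sin (Real.pi * (v / s)))
    calc 4 * (s - v) / s = 2 * (2 * (s - v) / s) := by ring
      _ ≤ _ := by linarith

lemma four_div_le_norm_expTurn_div_sub_one {h : ℤ} {s : ℕ} (hs : s ≠ 0) (hsh : ¬ (s : ℤ) ∣ h) :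
    4 / s ≤ ‖expTurn (h / s) - 1‖ := by
  refine le_trans ?_ (le_norm_expTurn_div_sub_one h hs)
  have h0 := Int.emod_nonneg h (by exact_mod_cast hs : (s:ℤ) ≠ 0)
  have h1 : h % s ≠ 0 := fun h => hsh (Int.dvd_of_emod_eq_zero h)
  have h2 := Int.emod_lt_of_pos h (by positivity : (0:ℤ) < s)
  have h3 : (1:ℝ) ≤ (h % s : ℤ) := by exact_mod_cast (by omega : 1 ≤ h % s)
  have h4 : (1:ℝ) ≤ s - (h % s : ℤ) := by exact_mod_cast (by omega : 1 ≤ s - h % s)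
  gcongr
  have := le_min h3 h4
  linarith

lemma sum_expTurn_mul_div (n : ℕ) {m : ℕ} (hm : m ≠ 0) :
    ∑ j ∈ Icc 1 m, expTurn (j * n / m) = if m ∣ n then (m : ℂ) else 0 := by
  have e : ∀ j : ℕ, expTurn (j * n / m) = expTurn (n / m) ^ j := fun j => by
    rw [← expTurn_natCast_mul]; congr 1; ring
  simp_rw [e]
  have hm' : (m:ℝ) ≠ 0 := by exact_mod_cast hm
  split_ifs with h
  · obtain ⟨k, rfl⟩ := h
    have : expTurn ((m * k : ℕ) / m) = 1 := by
      push_cast; rw [mul_div_cancel_left₀ _ hm', expTurn_natCast]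
    rw [this]
    simp
  · have h1 : expTurn (n / m) ≠ 1 := by
      intro h1
      have := four_div_le_norm_expTurn_div_sub_one (h := n) hm (by exact_mod_cast h)
      simp only [Int.cast_natCast, h1, sub_self, norm_zero] at this
      have h2 : (0:ℝ) < 4 / m := by positivity
      linarith
    have h2 : expTurn (n / m) ^ m = 1 := by
      rw [← expTurn_natCast_mul, mul_div_cancel₀ _ hm', expTurn_natCast]
    have h3 : ∑ j ∈ Icc 1 m, expTurn (n / m) ^ j = ∑ j ∈ range m, expTurn (n / m) ^ (j + 1) := by
      rw [range_eq_Ico, sum_Ico_add' (fun j => expTurn (n / m) ^ j) 0 m 1]; rfl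
    rw [h3]
    simp_rw [pow_succ]
    rw [← sum_mul, geom_sum_eq h1, h2]
    simp

/-- The arithmetic function equal to `d` at the divisors `d` of `n` and to `0` elsewhere. -/
noncomputable def divisorPart (n : ℕ) : ArithmeticFunction ℝ :=
  ⟨fun d => if d ∣ n then (d : ℝ) else 0, by simp⟩

lemma divisorPart_apply (n d : ℕ) : divisorPart n d = if d ∣ n then (d : ℝ) else 0 := rfl

/-- The arithmetic function `r ↦ c_r(n)` written as a Dirichlet convolution. -/
noncomputable def ramanujanArith (n : ℕ) : ArithmeticFunction ℝ :=
  (μ : ArithmeticFunction ℝ) * divisorPart n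

lemma ramanujanArith_apply (n r : ℕ) :
    ramanujanArith n r = ∑ d ∈ r.divisors, (μ d : ℝ) * if r / d ∣ n then ((r / d : ℕ) : ℝ) else 0 := by
  rw [ramanujanArith, ArithmeticFunction.mul_apply]
  exact Nat.sum_divisorsAntidiagonal fun i j => (μ i : ℝ) * if j ∣ n then (j : ℝ) else 0

lemma sum_divisors_moebius {g : ℕ} : ∑ d ∈ g.divisors, (μ d : ℂ) = if g = 1 then 1 else 0 := by
  have := congrArg (fun f : ArithmeticFunction ℤ => f g) ArithmeticFunction.moebius_mul_coe_zeta
  simp only [ArithmeticFunction.coe_mul_zeta_apply, ArithmeticFunction.one_apply] at this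
  exact_mod_cast congrArg (Int.cast : ℤ → ℂ) this

lemma sum_coprime_expTurn (r n : ℕ) :
    ∑ b ∈ (Icc 1 r).filter (fun b => Nat.gcd b r = 1), expTurn (b * n / r) =
      (ramanujanArith n r : ℝ) := by
  rcases r.eq_zero_or_pos with rfl | hr
  · simp
  have h1 : ∑ b ∈ (Icc 1 r).filter (fun b => Nat.gcd b r = 1), expTurn (b * n / r) =
      ∑ b ∈ Icc 1 r, ∑ d ∈ r.divisors, if d ∣ b then (μ d : ℂ) * expTurn (b * n / r) else 0 := by
    rw [sum_filter]
    refine sum_congr rfl fun b hb => ?_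
    have hb := mem_Icc.1 hb
    have h2 : (Nat.gcd b r).divisors = r.divisors.filter (· ∣ b) := by
      ext d
      simp only [Nat.mem_divisors, mem_filter, Nat.dvd_gcd_iff]
      have : Nat.gcd b r ≠ 0 := Nat.gcd_ne_zero_right (by omega)
      constructor
      · rintro ⟨⟨h1, h2⟩, _⟩; exact ⟨⟨h2, by omega⟩, h1⟩
      · rintro ⟨⟨h1, _⟩, h2⟩; exact ⟨⟨h2, h1⟩, this⟩
    rw [← sum_filter, ← h2, ← sum_mul, sum_divisors_moebius]
    split_ifs <;> simp
  rw [h1, sum_comm, ramanujanArith_apply]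
  push_cast
  refine sum_congr rfl fun d hd => ?_
  obtain ⟨⟨m, rfl⟩, _⟩ := Nat.mem_divisors.1 hd
  have hd0 : 0 < d := Nat.pos_of_ne_zero (by rintro rfl; simp at hr)
  have hm0 : 0 < m := Nat.pos_of_ne_zero (by rintro rfl; simp at hr)
  rw [Nat.mul_div_cancel_left _ hd0]
  have h3 : ∑ b ∈ Icc 1 (d * m), (if d ∣ b then (μ d : ℂ) * expTurn (b * n / (d * m : ℕ)) else 0) =
      ∑ j ∈ Icc 1 m, (μ d : ℂ) * expTurn (j * n / m) := by
    rw [← sum_filter]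
    symm
    refine sum_nbij' (fun j => d * j) (fun b => b / d) ?_ ?_ ?_ ?_ ?_
    · intro j hj
      have := mem_Icc.1 hj
      simp only [mem_filter, mem_Icc, dvd_mul_right, and_true]
      exact ⟨Nat.mul_pos hd0 (by omega), Nat.mul_le_mul_left _ this.2⟩
    · intro b hb
      obtain ⟨hb, k, rfl⟩ := mem_filter.1 hb
      rw [mem_Icc] at hb ⊢
      rw [Nat.mul_div_cancel_left _ hd0]
      exact ⟨Nat.pos_of_mul_pos_left (a := d) (by omega), Nat.le_of_mul_le_mul_left hb.2 hd0⟩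
    · intro j _; exact Nat.mul_div_cancel_left _ hd0
    · intro b hb; exact Nat.mul_div_cancel' (mem_filter.1 hb).2
    · intro j _
      congr 2
      push_cast
      have : (d:ℝ) ≠ 0 := by positivity
      have : (m:ℝ) ≠ 0 := by positivity
      field_simp
  rw [h3, ← mul_sum, sum_expTurn_mul_div n (by omega)]
  split_ifs <;> simp

lemma ramanujanSum_eq (r n : ℕ) : ramanujanSum r n = ramanujanArith n r := by
  have := congrArg Complex.re (sum_coprime_expTurn r n)
  rw [Complex.ofReal_re] at this
  rw [← this, ramanujanSum]
  congr 1
  refine sum_congr rfl fun b _ => ?_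
  rw [expTurn]
  push_cast
  congr 1
  ring

lemma ramanujanArith_isMultiplicative (n : ℕ) : (ramanujanArith n).IsMultiplicative := by
  refine ArithmeticFunction.isMultiplicative_moebius.intCast.mul ?_
  rw [ArithmeticFunction.IsMultiplicative.iff_ne_zero]
  refine ⟨by simp [divisorPart_apply], fun {a b} _ _ hab => ?_⟩
  have h : a * b ∣ n ↔ a ∣ n ∧ b ∣ n :=
    ⟨fun h => ⟨dvd_of_mul_right_dvd h, dvd_of_mul_left_dvd h⟩, fun h => hab.mul_dvd_of_dvd_of_dvd h.1 h.2⟩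
  simp only [divisorPart_apply, Nat.cast_mul, h]
  by_cases h1 : a ∣ n <;> by_cases h2 : b ∣ n <;> simp [h1, h2]

lemma ramanujanArith_prime (n : ℕ) {p : ℕ} (hp : p.Prime) :
    ramanujanArith n p = if p ∣ n then (p:ℝ) - 1 else -1 := by
  rw [ramanujanArith_apply, hp.divisors, sum_pair hp.one_lt.ne, Nat.div_one,
    Nat.div_self hp.pos, ArithmeticFunction.moebius_apply_prime hp, if_pos (one_dvd n)]
  split_ifs <;> simp
  ring

lemma ramanujanArith_of_coprime {n r : ℕ} (h : n.Coprime r) : ramanujanArith n r = μ r := by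
  rcases r.eq_zero_or_pos with rfl | hr
  · simp
  rw [ramanujanArith_apply, sum_eq_single r]
  · simp [Nat.div_self hr]
  · intro d hd hdr
    rw [if_neg, mul_zero]
    intro h1
    have h2 : r / d ∣ r := Nat.div_dvd_of_dvd (Nat.dvd_of_mem_divisors hd)
    have h3 := Nat.eq_one_of_dvd_coprimes h h1 h2
    have := Nat.mul_div_cancel' (Nat.dvd_of_mem_divisors hd)
    rw [h3, mul_one] at this
    exact hdr this
  · intro h1; simp [hr.ne'] at h1

lemma ramanujanArith_congr {r n n' : ℕ} (h : n ≡ n' [MOD r]) :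
    ramanujanArith n r = ramanujanArith n' r := by
  rw [ramanujanArith_apply, ramanujanArith_apply]
  refine sum_congr rfl fun d hd => ?_
  have h2 : r / d ∣ r := Nat.div_dvd_of_dvd (Nat.dvd_of_mem_divisors hd)
  simp only [(h.of_dvd h2).dvd_iff dvd_rfl]

lemma card_filter_gcd_eq_totient (r : ℕ) : #{b ∈ Icc 1 r | b.gcd r = 1} = r.totient := by
  rw [← Nat.filter_coprime_Ico_eq_totient r 1, add_comm]
  congr 1
  ext b
  simp only [mem_filter, mem_Icc, mem_Ico, Nat.coprime_comm (m := r), Nat.Coprime]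
  omega

lemma abs_ramanujanArith_le (n r : ℕ) : |ramanujanArith n r| ≤ r.totient := by
  have h := sum_coprime_expTurn r n
  rw [← Real.norm_eq_abs, ← Complex.norm_real, ← h]
  refine (norm_sum_le _ _).trans ?_
  simp only [norm_expTurn, sum_const, nsmul_eq_mul, mul_one]
  rw [card_filter_gcd_eq_totient]

lemma sum_divisors_moebius_div_totient_mul_ramanujanArith (n : ℕ) {s : ℕ} (hs : s ≠ 0) :
    ∑ r ∈ s.divisors, (μ r : ℝ) / r.totient * ramanujanArith n r =
      if n.Coprime s then (s:ℝ) / s.totient else 0 := by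
  set G : ArithmeticFunction ℝ := ((μ : ArithmeticFunction ℝ).pmul
    (invTotient.pmul (ramanujanArith n))) * (ζ : ArithmeticFunction ℝ) with hG
  have hmul : G.IsMultiplicative :=
    (ArithmeticFunction.isMultiplicative_moebius.intCast.pmul
      (invTotient_isMultiplicative.pmul (ramanujanArith_isMultiplicative n))).mul
      ArithmeticFunction.isMultiplicative_zeta.natCast
  have hGs : ∀ s, ∑ r ∈ s.divisors, (μ r : ℝ) / r.totient * ramanujanArith n r = G s := by
    intro s
    rw [hG, ArithmeticFunction.coe_mul_zeta_apply]
    refine sum_congr rfl fun r _ => ?_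
    simp only [ArithmeticFunction.pmul_apply, invTotient_apply, ArithmeticFunction.intCoe_apply]
    ring
  rw [hGs]
  induction s using Nat.recOnPosPrimePosCoprime with
  | zero => exact absurd rfl hs
  | one => simp [hmul.map_one]
  | prime_pow p k hp hk =>
    obtain ⟨k, rfl⟩ : ∃ j, k = j + 1 := ⟨k - 1, by omega⟩
    rw [← hGs, Nat.sum_divisors_prime_pow hp, sum_range_succ', sum_range_succ', sum_eq_zero]
    · have h2 : (2:ℝ) ≤ p := by exact_mod_cast hp.two_le
      have h3 : (p:ℝ) - 1 ≠ 0 := by linarith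
      have h5 : ((p ^ (k + 1) : ℕ) : ℝ) / (p ^ (k + 1)).totient = p / (p - 1) := by
        rw [Nat.totient_prime_pow hp (by omega), Nat.add_sub_cancel]
        push_cast [Nat.cast_sub hp.one_le]
        have : (p:ℝ) ≠ 0 := by linarith
        field_simp
        ring
      have h6 : n.Coprime (p ^ (k + 1)) ↔ ¬ p ∣ n := by
        rw [Nat.coprime_pow_right_iff (by omega), Nat.coprime_comm, hp.coprime_iff_not_dvd]
      simp only [h6]
      rw [h5, zero_add, zero_add, pow_one, pow_zero, ArithmeticFunction.moebius_apply_prime hp,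
        ramanujanArith_prime n hp, (ramanujanArith_isMultiplicative n).map_one,
        Nat.totient_prime hp, Nat.cast_sub hp.one_le]
      by_cases h : p ∣ n <;> simp [h] <;> field_simp <;> ring
    · intro j _
      rw [ArithmeticFunction.moebius_apply_prime_pow hp (by omega), if_neg (by omega)]
      simp
  | coprime a b ha hb hab iha ihb =>
    rw [hmul.map_mul_of_coprime hab, iha (by omega), ihb (by omega), Nat.totient_mul hab]
    push_cast
    by_cases h1 : n.Coprime a
    · by_cases h2 : n.Coprime b
      · rw [if_pos h1, if_pos h2, if_pos (Nat.coprime_mul_iff_right.2 ⟨h1, h2⟩), mul_div_mul_comm]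
      · rw [if_neg h2, if_neg fun h => h2 (Nat.coprime_mul_iff_right.1 h).2, mul_zero]
    · rw [if_neg h1, if_neg fun h => h1 (Nat.coprime_mul_iff_right.1 h).1, zero_mul]

end Vaughan

namespace Vaughan
open Filter Topology
open scoped ArithmeticFunction.Moebius ArithmeticFunction.zeta ArithmeticFunction.vonMangoldt

/-- `Ξ_R(n)` for an integral truncation parameter. -/
noncomputable def xi (M n : ℕ) : ℝ :=
  ∑ r ∈ Icc 1 M, (μ r : ℝ) / r.totient * ramanujanArith n r

lemma XiR_eq_xi (R : ℝ) (n : ℕ) : XiR R n = xi ⌊R⌋₊ n := by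
  simp only [XiR, xi, ramanujanSum_eq]

lemma abs_moebius_le_one (n : ℕ) : |(μ n : ℝ)| ≤ 1 := by
  exact_mod_cast ArithmeticFunction.abs_moebius_le_one (n := n)

lemma abs_card_filter_mod_sub_le (y c : ℕ) {s : ℕ} (hs : s ≠ 0) :
    |(#{n ∈ Icc 1 y | n % s = c % s} : ℝ) - y / s| ≤ 1 := by
  have h := Nat.Ioc_filter_modEq_card 0 y (Nat.pos_of_ne_zero hs) c
  have e : {n ∈ Icc 1 y | n % s = c % s} = {n ∈ Ioc 0 y | n ≡ c [MOD s]} := rfl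
  rw [e]
  have hs0 : (0:ℚ) < s := by positivity
  have h' : (#{n ∈ Ioc 0 y | n ≡ c [MOD s]} : ℚ) =
      max ((⌊((y:ℚ) - c) / s⌋ : ℚ) - ⌊((0:ℕ) - (c:ℚ)) / s⌋) 0 := by exact_mod_cast h
  have key : |(#{n ∈ Ioc 0 y | n ≡ c [MOD s]} : ℚ) - y / s| ≤ 1 := by
    rw [h']
    have h1 := Int.floor_le (((y:ℚ) - c) / s)
    have h2 := Int.lt_floor_add_one (((y:ℚ) - c) / s)
    have h3 := Int.floor_le (((0:ℕ) - (c:ℚ)) / s)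
    have h4 := Int.lt_floor_add_one (((0:ℕ) - (c:ℚ)) / s)
    have e : ((y:ℚ) - c) / s - ((0:ℕ) - (c:ℚ)) / s = y / s := by push_cast; ring
    have h5 : 0 ≤ (y:ℚ) / s := by positivity
    rw [abs_le]
    constructor
    · have := le_max_left ((⌊((y:ℚ) - c) / s⌋ : ℚ) - ⌊((0:ℕ) - (c:ℚ)) / s⌋) 0
      linarith
    · rw [sub_le_iff_le_add]
      apply max_le <;> linarith
  have := (Rat.cast_le (K := ℝ)).2 key
  push_cast at this
  exact this

lemma norm_sum_filter_mod_expTurn_le (y c : ℕ) {r s b : ℕ} (hr : r ≠ 0) (h : ¬ r ∣ s * b) :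
    ‖∑ n ∈ Icc 1 y with n % s = c % s, expTurn (b * n / r)‖ ≤ s * r := by
  set z := expTurn (b / r) with hz
  have ez : ∀ n : ℕ, expTurn (b * n / r) = z ^ n := fun n => by
    rw [hz, ← expTurn_natCast_mul]; congr 1; ring
  simp_rw [ez, sum_filter]
  set g : ℕ → ℂ := fun n => if n % s = c % s then z ^ n else 0 with hg
  have hzn : ‖z‖ = 1 := norm_expTurn _
  have hgn : ∀ n, ‖g n‖ ≤ 1 := fun n => by
    simp only [hg]; split_ifs <;> simp [hzn]
  have hgs : ∀ n, g (n + s) = z ^ s * g n := fun n => by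
    simp only [hg, Nat.add_mod_right]; split_ifs <;> ring
  have hz1 : 4 / (r:ℝ) ≤ ‖z ^ s - 1‖ := by
    have := four_div_le_norm_expTurn_div_sub_one (h := ((s * b : ℕ) : ℤ)) hr (by exact_mod_cast h)
    convert this using 3
    rw [hz, ← expTurn_natCast_mul]; congr 1; push_cast; ring
  have e : (z ^ s - 1) * ∑ n ∈ Icc 1 y, g n =
      ∑ n ∈ Ico (y + 1) (y + 1 + s), g n - ∑ n ∈ Ico 1 (1 + s), g n := by
    have h1 : ∑ n ∈ Ico (1 + s) (y + 1 + s), g n = z ^ s * ∑ n ∈ Ico 1 (y + 1), g n := by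
      rw [mul_sum, ← sum_Ico_add' g 1 (y + 1) s]
      exact sum_congr rfl fun n _ => hgs n
    have h2 := sum_Ico_consecutive g (show 1 ≤ 1 + s by omega) (show 1 + s ≤ y + 1 + s by omega)
    have h3 := sum_Ico_consecutive g (show 1 ≤ y + 1 by omega) (show y + 1 ≤ y + 1 + s by omega)
    have h4 : ∑ n ∈ Icc 1 y, g n = ∑ n ∈ Ico 1 (y + 1), g n := rfl
    rw [h4, sub_mul, one_mul, ← h1]
    linear_combination h2 - h3
  have hb : ∀ k, ‖∑ n ∈ Ico k (k + s), g n‖ ≤ s := fun k => by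
    refine (norm_sum_le _ _).trans ((sum_le_sum fun n _ => hgn n).trans ?_)
    simp
  have h5 : 4 / (r:ℝ) * ‖∑ n ∈ Icc 1 y, g n‖ ≤ s + s := by
    calc _ ≤ ‖z ^ s - 1‖ * ‖∑ n ∈ Icc 1 y, g n‖ := by gcongr
      _ = ‖(z ^ s - 1) * ∑ n ∈ Icc 1 y, g n‖ := (norm_mul _ _).symm
      _ ≤ _ := by rw [e]; exact (norm_sub_le _ _).trans (add_le_add (hb _) (hb _))
  have hr0 : (0:ℝ) < r := by positivity
  rw [div_mul_eq_mul_div, div_le_iff₀ hr0] at h5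
  have : (0:ℝ) ≤ s * r := by positivity
  linarith

lemma abs_sum_filter_mod_ramanujanArith_sub_le (y c : ℕ) {r s : ℕ} (hr : r ≠ 0) (hs : s ≠ 0) :
    |∑ n ∈ Icc 1 y with n % s = c % s, ramanujanArith n r -
      (if r ∣ s then ramanujanArith c r * (y / s) else 0)| ≤ r.totient * (s * r) := by
  have hs1 : (1:ℝ) ≤ s := by exact_mod_cast Nat.one_le_iff_ne_zero.2 hs
  have hr1 : (1:ℝ) ≤ r := by exact_mod_cast Nat.one_le_iff_ne_zero.2 hr
  split_ifs with h
  · have h1 : ∑ n ∈ Icc 1 y with n % s = c % s, ramanujanArith n r =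
        #{n ∈ Icc 1 y | n % s = c % s} * ramanujanArith c r := by
      rw [← nsmul_eq_mul, ← sum_const]
      refine sum_congr rfl fun n hn => ?_
      have h2 : n ≡ c [MOD s] := (mem_filter.1 hn).2
      exact ramanujanArith_congr (h2.of_dvd h)
    rw [h1, mul_comm, ← mul_sub, abs_mul]
    have h2 := abs_card_filter_mod_sub_le y c hs
    have h3 := abs_ramanujanArith_le c r
    gcongr
    nlinarith
  · rw [sub_zero, ← Real.norm_eq_abs, ← Complex.norm_real]
    push_cast
    simp_rw [← sum_coprime_expTurn]
    rw [sum_comm]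
    refine (norm_sum_le _ _).trans ?_
    calc _ ≤ ∑ b ∈ Icc 1 r with b.gcd r = 1, (s * r : ℝ) := by
          refine sum_le_sum fun b hb => norm_sum_filter_mod_expTurn_le y c hr fun h1 => h ?_
          have hb := (mem_filter.1 hb).2
          exact (Nat.Coprime.dvd_of_dvd_mul_right (Nat.coprime_comm.1 hb) h1)
      _ = _ := by rw [sum_const, card_filter_gcd_eq_totient, nsmul_eq_mul]

lemma abs_sum_filter_mod_xi_sub_le (y c : ℕ) {M s : ℕ} (hs : s ≠ 0) (hsM : s ≤ M) :
    |∑ n ∈ Icc 1 y with n % s = c % s, xi M n - (if c.Coprime s then (y:ℝ) / s.totient else 0)| ≤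
      (M:ℝ) ^ 3 := by
  have hs0 : (s:ℝ) ≠ 0 := by exact_mod_cast hs
  have h1 : (if c.Coprime s then (y:ℝ) / s.totient else 0) =
      ∑ r ∈ Icc 1 M, (μ r : ℝ) / r.totient *
        (if r ∣ s then ramanujanArith c r * (y / s) else 0) := by
    have h2 : s.divisors = {r ∈ Icc 1 M | r ∣ s} := by
      ext r
      simp only [Nat.mem_divisors, mem_filter, mem_Icc]
      constructor
      · rintro ⟨h, _⟩
        exact ⟨⟨Nat.pos_of_dvd_of_pos h (Nat.pos_of_ne_zero hs),
          (Nat.le_of_dvd (Nat.pos_of_ne_zero hs) h).trans hsM⟩, h⟩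
      · rintro ⟨_, h⟩; exact ⟨h, hs⟩
    have h3 := sum_divisors_moebius_div_totient_mul_ramanujanArith c hs
    rw [h2] at h3
    have h4 : (if c.Coprime s then (y:ℝ) / s.totient else 0) =
        (if c.Coprime s then (s:ℝ) / s.totient else 0) * (y / s) := by
      split_ifs
      · field_simp
      · simp
    rw [h4, ← h3, sum_mul, sum_filter]
    refine sum_congr rfl fun r _ => ?_
    split_ifs
    · ring
    · simp
  have h5 : ∑ n ∈ Icc 1 y with n % s = c % s, xi M n =
      ∑ r ∈ Icc 1 M, (μ r : ℝ) / r.totient *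
        ∑ n ∈ Icc 1 y with n % s = c % s, ramanujanArith n r := by
    simp only [xi]
    rw [sum_comm]
    simp_rw [mul_sum]
  rw [h1, h5, ← sum_sub_distrib]
  refine (abs_sum_le_sum_abs _ _).trans ?_
  calc _ ≤ ∑ r ∈ Icc 1 M, (M:ℝ) ^ 2 := by
        refine sum_le_sum fun r hr => ?_
        have hr := mem_Icc.1 hr
        have hφ : (0:ℝ) < r.totient := by exact_mod_cast Nat.totient_pos.2 hr.1
        rw [← mul_sub, abs_mul, abs_div, Nat.abs_cast]
        calc _ ≤ 1 / (r.totient : ℝ) * (r.totient * (s * r)) := by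
              gcongr
              · exact abs_moebius_le_one r
              · exact abs_sum_filter_mod_ramanujanArith_sub_le y c (by omega) hs
          _ = s * r := by field_simp
          _ ≤ M * M := by
              have : (r:ℝ) ≤ M := by exact_mod_cast hr.2
              gcongr
          _ = _ := by ring
    _ = _ := by simp; ring

lemma sum_vonMangoldt_filter_not_coprime_le (y c : ℕ) {s : ℕ} (hs : s ≠ 0)
    (hcs : ¬ c.Coprime s) (hy : 1 ≤ y) :
    ∑ n ∈ Icc 1 y with n % s = c % s, Λ n ≤ s * (2 * Real.log y ^ 2) := by
  have hly : 0 ≤ Real.log y := Real.log_natCast_nonneg _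
  set T := (s.primeFactors ×ˢ Icc 1 (Nat.log 2 y)).image fun p => p.1 ^ p.2 with hT
  calc _ ≤ ∑ n ∈ T.filter (fun n => n ∈ Icc 1 y), Λ n := by
        rw [← sum_filter_ne_zero]
        refine sum_le_sum_of_subset_of_nonneg ?_ fun n _ _ => ArithmeticFunction.vonMangoldt_nonneg
        intro n hn
        obtain ⟨hn, hΛ⟩ := mem_filter.1 hn
        obtain ⟨hny, hmod⟩ := mem_filter.1 hn
        rw [mem_filter]
        refine ⟨?_, hny⟩
        have hΛ' := ArithmeticFunction.vonMangoldt_ne_zero_iff.1 hΛ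
        obtain ⟨p, k, hp, hk, rfl⟩ := (isPrimePow_nat_iff _).1 hΛ'
        have h1 : (p ^ k).gcd s = c.gcd s := by
          have h2 : p ^ k ≡ c [MOD s] := hmod
          exact h2.gcd_eq
        have hps : p ∣ s := by
          by_contra hps
          have := (Nat.Prime.coprime_iff_not_dvd hp).2 hps
          exact hcs (by rw [Nat.Coprime, ← h1]; exact this.pow_left k)
        have hny := mem_Icc.1 hny
        refine mem_image.2 ⟨(p, k), ?_, rfl⟩
        rw [mem_product, mem_Icc]
        refine ⟨Nat.mem_primeFactors.2 ⟨hp, hps, hs⟩, hk, ?_⟩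
        exact Nat.le_log_of_pow_le (by norm_num)
          ((Nat.pow_le_pow_left hp.two_le k).trans hny.2)
    _ ≤ ∑ n ∈ T.filter (fun n => n ∈ Icc 1 y), Real.log y := by
        refine sum_le_sum fun n hn => ?_
        have hn := mem_Icc.1 (mem_filter.1 hn).2
        refine ArithmeticFunction.vonMangoldt_le_log.trans ?_
        have : (0:ℝ) < n := by exact_mod_cast hn.1
        gcongr
        exact hn.2
    _ = #(T.filter (fun n => n ∈ Icc 1 y)) * Real.log y := by rw [sum_const, nsmul_eq_mul]
    _ ≤ (s * (2 * Real.log y)) * Real.log y := by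
        gcongr
        have h1 : #(T.filter (fun n => n ∈ Icc 1 y)) ≤ #s.primeFactors * Nat.log 2 y := by
          refine (card_filter_le _ _).trans (card_image_le.trans ?_)
          rw [card_product, Nat.card_Icc, Nat.add_sub_cancel]
        have h2 : #s.primeFactors ≤ s := by
          refine (card_le_card (?_ : s.primeFactors ⊆ Icc 1 s)).trans (by simp)
          intro p hp
          have := Nat.mem_primeFactors.1 hp
          exact mem_Icc.2 ⟨this.1.one_le, Nat.le_of_dvd (Nat.pos_of_ne_zero hs) this.2.1⟩
        have h3 : (Nat.log 2 y : ℝ) ≤ 2 * Real.log y := by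
          have h4 : ((2:ℕ) ^ Nat.log 2 y : ℕ) ≤ y := Nat.pow_log_le_self 2 (by omega)
          have h5 : ((2:ℝ)) ^ Nat.log 2 y ≤ y := by exact_mod_cast h4
          have h6 := Real.log_le_log (by positivity) h5
          rw [Real.log_pow] at h6
          have := Real.log_two_gt_d9
          have h7 : (0:ℝ) ≤ Nat.log 2 y := by positivity
          nlinarith
        calc (#(T.filter (fun n => n ∈ Icc 1 y)) : ℝ) ≤ (#s.primeFactors : ℝ) * Nat.log 2 y := by
              exact_mod_cast h1
          _ ≤ _ := by gcongr
    _ = _ := by ring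

end Vaughan

namespace Vaughan
open Filter Topology ArithmeticFunction.vonMangoldt
open scoped ArithmeticFunction.Moebius ArithmeticFunction.zeta ArithmeticFunction.vonMangoldt

lemma eventually_log_pow_le_sqrt (m : ℕ) : ∀ᶠ X : ℕ in atTop, Real.log X ^ m ≤ √X := by
  filter_upwards [(tendsto_div_log_pow (2 * m)).eventually_ge_atTop 1, eventually_ge_atTop 2]
    with X h hX
  have hl : 0 < Real.log X := Real.log_pos (by exact_mod_cast hX)
  rw [le_div_iff₀ (by positivity), one_mul] at h
  refine Real.le_sqrt_of_sq_le ?_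
  rw [← pow_mul, mul_comm]
  exact h

lemma eventually_one_le_log : ∀ᶠ X : ℕ in atTop, 1 ≤ Real.log X := by
  simpa using (tendsto_log_pow one_ne_zero).eventually_ge_atTop 1

lemma natCast_eq_sqrt_mul_sqrt (X : ℕ) : (X:ℝ) = √X * √X := (Real.mul_self_sqrt (by positivity)).symm

lemma exists_psi_residue_bound {m : ℕ} (hm : m ≠ 0) :
    ∃ C : ℝ, 0 < C ∧ ∀ᶠ X : ℕ in atTop, ∀ y ≤ X, ∀ s ≠ 0, ∀ c : ℕ,
      |∑ n ∈ Icc 1 y with n % s = c % s, Λ n - (if c.Coprime s then (y:ℝ) / s.totient else 0)| ≤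
        C * s * (X / Real.log X ^ m) := by
  obtain ⟨C, hC, N₀, h⟩ := siegel_walfisz hm
  refine ⟨C * 2 ^ m + 1, by positivity, ?_⟩
  have hs0 : Tendsto (fun X : ℕ => √(X:ℝ)) atTop atTop :=
    Real.tendsto_sqrt_atTop.comp tendsto_natCast_atTop_atTop
  filter_upwards [(tendsto_log_pow one_ne_zero).eventually_ge_atTop 2,
    eventually_log_pow_le_sqrt (m + 3),
    hs0.eventually_ge_atTop (N₀ + 2)] with X h1 h2 h3
  intro y hy s hs c
  have hX := natCast_eq_sqrt_mul_sqrt X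
  rw [pow_one] at h1
  set L := Real.log X with hL
  have hL0 : 0 < L := by linarith
  have hs1 : (1:ℝ) ≤ s := by exact_mod_cast Nat.one_le_iff_ne_zero.2 hs
  have hyX : (y:ℝ) ≤ X := by exact_mod_cast hy
  have h2X : 2 ≤ √(X:ℝ) := by linarith [(Nat.cast_nonneg N₀ : (0:ℝ) ≤ N₀)]
  have hsX : √(X:ℝ) * 2 ≤ X := by
    calc √(X:ℝ) * 2 ≤ √X * √X := by gcongr
      _ = X := hX.symm
  have hmain : √(X:ℝ) * L ^ 3 ≤ X / L ^ m := by
    rw [le_div_iff₀ (by positivity), mul_assoc, ← pow_add, add_comm 3 m]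
    nth_rewrite 2 [hX]
    gcongr
  have hmain0 : 0 ≤ (X:ℝ) / L ^ m := by positivity
  have : NeZero s := ⟨hs⟩
  by_cases hc : c.Coprime s
  · rw [if_pos hc]
    have hu : IsUnit (c : ZMod s) := (ZMod.isUnit_iff_coprime c s).2 hc
    have e : ∑ n ∈ Icc 1 y with n % s = c % s, Λ n - (y:ℝ) / s.totient =
        ∑ n ∈ Icc 1 y, (residueClass (c : ZMod s) n - (s.totient : ℝ)⁻¹) := by
      rw [sum_sub_distrib, sum_const, Nat.card_Icc, Nat.add_sub_cancel, nsmul_eq_mul,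
        div_eq_mul_inv, sum_filter]
      congr 1
      refine sum_congr rfl fun n _ => ?_
      simp only [residueClass, Set.indicator_apply, Set.mem_ofPred_eq, ZMod.natCast_eq_natCast_iff']
    rw [e]
    rcases le_or_gt (√(X:ℝ)) y with hyy | hyy
    · have hN : N₀ ≤ y := by
        have : (N₀:ℝ) ≤ y := by linarith
        exact_mod_cast this
      have hly : L ≤ 2 * Real.log y := by
        have h4 := Real.log_le_log (by linarith) hyy
        rw [Real.log_sqrt (by positivity)] at h4
        linarith
      refine (h s c hu y hN).trans ?_
      calc C * s * (y / Real.log y ^ m) ≤ C * s * (X / (L / 2) ^ m) := by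
            gcongr
            linarith
        _ = C * 2 ^ m * s * (X / L ^ m) := by rw [div_pow]; field_simp
        _ ≤ _ := by gcongr; linarith
    · calc _ ≤ ∑ n ∈ Icc 1 y, (L + 1) := by
            refine (abs_sum_le_sum_abs _ _).trans (sum_le_sum fun n hn => ?_)
            have hn := mem_Icc.1 hn
            refine (abs_residueClass_sub_le _ n).trans ?_
            have : (0:ℝ) < n := by exact_mod_cast hn.1
            have : (n:ℝ) ≤ X := by exact_mod_cast hn.2.trans hy
            have : Real.log n ≤ L := by rw [hL]; gcongr
            linarith
        _ = y * (L + 1) := by simp; ring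
        _ ≤ √X * L ^ 3 := by
            gcongr
            nlinarith [mul_nonneg hL0.le (sub_nonneg.2 h1), mul_nonneg (mul_nonneg hL0.le hL0.le) (sub_nonneg.2 h1)]
        _ ≤ 1 * 1 * (X / L ^ m) := by linarith
        _ ≤ _ := by
            gcongr
            have : 0 ≤ C * 2 ^ m := by positivity
            linarith
  · rw [if_neg hc, sub_zero, abs_of_nonneg (sum_nonneg fun n _ =>
      ArithmeticFunction.vonMangoldt_nonneg)]
    rcases y.eq_zero_or_pos with rfl | hy0
    · simp; positivity
    have hy1 : (1:ℝ) ≤ y := by exact_mod_cast hy0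
    refine (sum_vonMangoldt_filter_not_coprime_le y c hs hc hy0).trans ?_
    have hly : Real.log y ≤ L := by rw [hL]; gcongr
    have hly0 : 0 ≤ Real.log y := Real.log_nonneg hy1
    calc (s:ℝ) * (2 * Real.log y ^ 2) ≤ s * (2 * L ^ 2) := by gcongr
      _ ≤ s * (√X * L ^ 3) := by
          gcongr
          · linarith
          · norm_num
      _ ≤ 1 * s * (X / L ^ m) := by rw [one_mul]; gcongr
      _ ≤ _ := by
          gcongr
          have : 0 ≤ C * 2 ^ m := by positivity
          linarith

/-- The difference `Λ(n) - Ξ_R(n)` between the von Mangoldt function and its approximation. -/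
noncomputable def mangoldtDiff (M n : ℕ) : ℝ := Λ n - xi M n

theorem exists_mangoldtDiff_residue_bound (a : ℕ) {m : ℕ} (hm : m ≠ 0) :
    ∃ C : ℝ, 0 < C ∧ ∀ᶠ X : ℕ in atTop, ∀ M : ℕ, (M:ℝ) ≤ Real.log X ^ a → ∀ y ≤ X,
      ∀ s ≠ 0, s ≤ M → ∀ c : ℕ,
        |∑ n ∈ Icc 1 y with n % s = c % s, mangoldtDiff M n| ≤ C * (X / Real.log X ^ m) := by
  obtain ⟨C, hC, h⟩ := exists_psi_residue_bound (m := m + a) (by omega)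
  refine ⟨C + 1, by positivity, ?_⟩
  filter_upwards [h, eventually_one_le_log, eventually_log_pow_le_sqrt (m + 3 * a),
    eventually_ge_atTop 1] with X h1 h2 h3 h4
  intro M hM y hy s hs hsM c
  have hX := natCast_eq_sqrt_mul_sqrt X
  have hX1 : 1 ≤ √(X:ℝ) := Real.one_le_sqrt.2 (by exact_mod_cast h4)
  set L := Real.log X with hL
  have hL0 : 0 < L := by linarith
  have e : ∑ n ∈ Icc 1 y with n % s = c % s, mangoldtDiff M n =
      (∑ n ∈ Icc 1 y with n % s = c % s, Λ n - (if c.Coprime s then (y:ℝ) / s.totient else 0)) -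
      (∑ n ∈ Icc 1 y with n % s = c % s, xi M n -
        (if c.Coprime s then (y:ℝ) / s.totient else 0)) := by
    simp only [mangoldtDiff, sum_sub_distrib]; ring
  rw [e]
  refine (abs_sub _ _).trans ?_
  have hsL : (s:ℝ) ≤ L ^ a := le_trans (by exact_mod_cast hsM) hM
  have k1 := h1 y hy s hs c
  have k2 := abs_sum_filter_mod_xi_sub_le y c hs hsM
  have k3 : C * s * (X / L ^ (m + a)) ≤ C * (X / L ^ m) := by
    calc C * s * (X / L ^ (m + a)) ≤ C * L ^ a * (X / L ^ (m + a)) := by gcongr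
      _ = _ := by rw [pow_add]; field_simp
  have k4 : (M:ℝ) ^ 3 ≤ X / L ^ m := by
    rw [le_div_iff₀ (by positivity)]
    calc (M:ℝ) ^ 3 * L ^ m ≤ (L ^ a) ^ 3 * L ^ m := by gcongr
      _ = L ^ (m + 3 * a) := by ring
      _ ≤ 1 * √X := by linarith
      _ ≤ √X * √X := by gcongr
      _ = X := hX.symm
  linarith

end Vaughan

namespace Vaughan
open Filter Topology
open scoped ArithmeticFunction.Moebius ArithmeticFunction.zeta ArithmeticFunction.vonMangoldt

lemma sum_log_bounds (X : ℕ) (hX : 1 ≤ X) :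
    (X:ℝ) * Real.log X - X ≤ ∑ n ∈ Icc 1 X, Real.log n ∧
      ∑ n ∈ Icc 1 X, Real.log n ≤ X * Real.log X - X + 1 + Real.log X := by
  induction X, hX using Nat.le_induction with
  | base => simp
  | succ k hk ih =>
    have hk0 : (0:ℝ) < k := by exact_mod_cast hk
    have h1 := Real.log_le_sub_one_of_pos (x := ((k:ℝ) + 1) / k) (by positivity)
    have h2 := Real.log_le_sub_one_of_pos (x := (k:ℝ) / (k + 1)) (by positivity)
    rw [Real.log_div (by positivity) (by positivity)] at h1 h2
    have e1 : k * (((k:ℝ) + 1) / k - 1) = 1 := by field_simp; ring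
    have e2 : ((k:ℝ) + 1) * ((k:ℝ) / (k + 1) - 1) = -1 := by field_simp; ring
    have h3 := mul_le_mul_of_nonneg_left h1 hk0.le
    have h4 := mul_le_mul_of_nonneg_left h2 (by positivity : (0:ℝ) ≤ k + 1)
    rw [sum_Icc_succ_top (by omega)]
    push_cast
    constructor <;> nlinarith [ih.1, ih.2]

lemma sum_vonMangoldt_mul_log_sub_le {X : ℕ} (hX : 1 ≤ X) :
    ∑ n ∈ Icc 1 X, Λ n * (Real.log n - Λ n) ≤ Real.log X * (2 * √X * Real.log X) := by
  have h := Chebyshev.psi_sub_theta_le (x := X) (by exact_mod_cast hX)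
  rw [Chebyshev.psi_sub_theta_eq_sum_not_prime, Nat.floor_natCast] at h
  refine le_trans ?_ (mul_le_mul_of_nonneg_left h (Real.log_natCast_nonneg X))
  rw [sum_filter, mul_sum]
  refine sum_le_sum fun n hn => ?_
  have hn := mem_Icc.1 hn
  have h0 : 0 ≤ Λ n := ArithmeticFunction.vonMangoldt_nonneg
  by_cases hp : n.Prime
  · rw [ArithmeticFunction.vonMangoldt_apply_prime hp]; simp [hp]
  · rw [if_pos hp]
    have : Real.log n ≤ Real.log X := by
      have : (0:ℝ) < n := by exact_mod_cast hn.1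
      have : (n:ℝ) ≤ X := by exact_mod_cast hn.2
      gcongr
    nlinarith

lemma exists_sum_sq_vonMangoldt_asymptotic (m : ℕ) :
    ∃ C : ℝ, 0 < C ∧ ∀ᶠ X : ℕ in atTop,
      |∑ n ∈ Icc 1 X, Λ n ^ 2 - (X * Real.log X - X)| ≤ C * (X / Real.log X ^ m) := by
  obtain ⟨C, hC, h⟩ := exists_psi_residue_bound (m := m + 1) (by omega)
  refine ⟨2 * C + 4, by positivity, ?_⟩
  filter_upwards [h, eventually_one_le_log, eventually_log_pow_le_sqrt (m + 2),
    eventually_ge_atTop 1] with X h1 h2 h3 hX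
  have hXX := natCast_eq_sqrt_mul_sqrt X
  have hX1 : 1 ≤ √(X:ℝ) := Real.one_le_sqrt.2 (by exact_mod_cast hX)
  have hlog := sum_log_bounds X hX
  have hpp := sum_vonMangoldt_mul_log_sub_le hX
  set L := Real.log X with hL
  set B := C * (X / L ^ (m + 1)) with hBdef
  have hB : ∀ j, 0 ≤ j → j ≤ X → |∑ n ∈ Ioc 0 j, (Λ n - 1)| ≤ B := fun j _ hj => by
    have := h1 j hj 1 one_ne_zero 0
    rw [show (Ioc 0 j : Finset ℕ) = Icc 1 j from rfl]
    simpa [Nat.mod_one, sum_sub_distrib, hBdef] using this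
  have hl : ∀ n : ℕ, 0 ≤ n → n < X → (L - Real.log ((n + 1 : ℕ):ℝ)) ≤ L - Real.log n := fun n _ _ => by
    rcases n.eq_zero_or_pos with rfl | hn
    · simp
    have : (0:ℝ) < n := by exact_mod_cast hn
    gcongr
    simp
  have h5 := abs_sum_mul_le_of_antitone (w := fun n : ℕ => L - Real.log n) (Nat.zero_le X) hl
    (by simp [hL]) hB
  have h6 := hB X (Nat.zero_le X) le_rfl
  simp only [Nat.cast_zero, Real.log_zero, sub_zero] at h5
  have e0 : (Ioc 0 X : Finset ℕ) = Icc 1 X := rfl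
  rw [e0] at h5 h6
  have e1 : ∑ n ∈ Icc 1 X, (Λ n - 1) * Real.log n =
      L * ∑ n ∈ Icc 1 X, (Λ n - 1) - ∑ n ∈ Icc 1 X, (L - Real.log n) * (Λ n - 1) := by
    rw [mul_sum, ← sum_sub_distrib]
    exact sum_congr rfl fun n _ => by ring
  have h7 : |∑ n ∈ Icc 1 X, (Λ n - 1) * Real.log n| ≤ 2 * (B * L) := by
    rw [e1]
    refine (abs_sub _ _).trans ?_
    rw [abs_mul, abs_of_nonneg (by linarith : 0 ≤ L)]
    have := mul_le_mul_of_nonneg_left h6 (by linarith : 0 ≤ L)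
    linarith
  have e2 : ∑ n ∈ Icc 1 X, Λ n ^ 2 = ∑ n ∈ Icc 1 X, (Λ n - 1) * Real.log n +
      ∑ n ∈ Icc 1 X, Real.log n - ∑ n ∈ Icc 1 X, Λ n * (Real.log n - Λ n) := by
    rw [← sum_add_distrib, ← sum_sub_distrib]
    exact sum_congr rfl fun n _ => by ring
  have hpp0 : 0 ≤ ∑ n ∈ Icc 1 X, Λ n * (Real.log n - Λ n) := sum_nonneg fun n _ =>
    mul_nonneg ArithmeticFunction.vonMangoldt_nonneg
      (sub_nonneg.2 ArithmeticFunction.vonMangoldt_le_log)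
  have hL0 : 0 < L := by linarith
  have hBL : B * L = C * (X / L ^ m) := by
    rw [hBdef, pow_succ]; field_simp
  have hq : √(X:ℝ) * L ^ 2 ≤ X / L ^ m := by
    rw [le_div_iff₀ (by positivity), mul_assoc, ← pow_add, add_comm 2 m]
    nth_rewrite 2 [hXX]
    gcongr
  have hq1 : 1 ≤ √(X:ℝ) * L ^ 2 := one_le_mul_of_one_le_of_one_le hX1 (one_le_pow₀ h2)
  have hq2 : L ≤ √(X:ℝ) * L ^ 2 := by
    nlinarith [mul_nonneg hL0.le (sub_nonneg.2 hX1), mul_nonneg hL0.le (sub_nonneg.2 h2),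
      mul_nonneg (mul_nonneg hL0.le hL0.le) (sub_nonneg.2 hX1)]
  rw [hBL] at h7
  have h8 := abs_le.1 h7
  rw [e2, abs_le]
  constructor
  · nlinarith [h8.1, hlog.1]
  · nlinarith [h8.2, hlog.2]

lemma sum_mul_xi (g : ℕ → ℝ) (M X : ℕ) :
    ∑ n ∈ Icc 1 X, g n * xi M n = ∑ r ∈ Icc 1 M, (μ r : ℝ) / r.totient *
      ∑ c ∈ range r, ramanujanArith c r * ∑ n ∈ Icc 1 X with n % r = c % r, g n := by
  simp only [xi, mul_sum]
  rw [sum_comm]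
  refine sum_congr rfl fun r hr => ?_
  have hr := mem_Icc.1 hr
  rw [← sum_fiberwise_of_maps_to (s := Icc 1 X) (t := range r) (g := fun n => n % r)
    fun n _ => mem_range.2 (Nat.mod_lt n hr.1)]
  refine sum_congr rfl fun c hc => ?_
  rw [Nat.mod_eq_of_lt (mem_range.1 hc)]
  refine sum_congr rfl fun n hn => ?_
  have hn := (mem_filter.1 hn).2
  rw [ramanujanArith_congr (n := c) (n' := n) (by rw [← hn]; exact Nat.mod_modEq n r)]
  ring

lemma abs_sum_moebius_div_totient_mul_le {M : ℕ} {E : ℝ} (hE : 0 ≤ E) {h : ℕ → ℕ → ℝ}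
    (hh : ∀ r ≠ 0, r ≤ M → ∀ c, |h r c| ≤ E) :
    |∑ r ∈ Icc 1 M, (μ r : ℝ) / r.totient * ∑ c ∈ range r, ramanujanArith c r * h r c| ≤
      M ^ 2 * E := by
  have : ∀ r ∈ Icc 1 M, |(μ r : ℝ) / r.totient * ∑ c ∈ range r, ramanujanArith c r * h r c| ≤
      M * E := fun r hr => by
    have hr := mem_Icc.1 hr
    have hφ : (0:ℝ) < r.totient := by exact_mod_cast Nat.totient_pos.2 hr.1
    have h1 : |∑ c ∈ range r, ramanujanArith c r * h r c| ≤ r * (r.totient * E) := by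
      refine (abs_sum_le_sum_abs _ _).trans ((sum_le_card_nsmul _ _ (r.totient * E)
        fun c _ => ?_).trans (by simp))
      rw [abs_mul]
      exact mul_le_mul (abs_ramanujanArith_le c r) (hh r (by omega) hr.2 c) (abs_nonneg _) hφ.le
    rw [abs_mul, abs_div, abs_of_pos hφ]
    calc _ ≤ 1 / (r.totient:ℝ) * (r * (r.totient * E)) := by
          gcongr
          exact abs_moebius_le_one r
      _ = r * E := by field_simp
      _ ≤ _ := by
          have : (r:ℝ) ≤ M := by exact_mod_cast hr.2
          gcongr
  refine (abs_sum_le_sum_abs _ _).trans ((sum_le_card_nsmul _ _ _ this).trans ?_)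
  rw [Nat.card_Icc, Nat.add_sub_cancel, nsmul_eq_mul]
  exact le_of_eq (by ring)

lemma sum_range_ramanujanArith_ite_coprime {r : ℕ} (hr : r ≠ 0) (y : ℝ) :
    ∑ c ∈ range r, ramanujanArith c r * (if c.Coprime r then y / r.totient else 0) = μ r * y := by
  have hφ : (r.totient : ℝ) ≠ 0 := by
    exact_mod_cast (Nat.totient_pos.2 (Nat.pos_of_ne_zero hr)).ne'
  have : ∀ c ∈ range r, ramanujanArith c r * (if c.Coprime r then y / r.totient else 0) =
      if r.Coprime c then (μ r : ℝ) * (y / r.totient) else 0 := fun c _ => by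
    by_cases h : c.Coprime r
    · rw [if_pos h, if_pos h.symm, ramanujanArith_of_coprime h]
    · rw [if_neg h, if_neg fun h' => h h'.symm, mul_zero]
  rw [sum_congr rfl this, ← sum_filter, sum_const, nsmul_eq_mul, ← Nat.totient_eq_card_coprime]
  field_simp

lemma abs_sum_sq_xi_sub_le (M X : ℕ) :
    |∑ n ∈ Icc 1 X, xi M n ^ 2 - X * sqfSum M| ≤ (M:ℝ) ^ 5 := by
  have e1 : X * sqfSum M = ∑ r ∈ Icc 1 M, (μ r : ℝ) / r.totient *
      ∑ c ∈ range r, ramanujanArith c r * (if c.Coprime r then (X:ℝ) / r.totient else 0) := by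
    rw [sqfSum, Nat.floor_natCast, mul_sum]
    refine sum_congr rfl fun r hr => ?_
    rw [sum_range_ramanujanArith_ite_coprime (by have := mem_Icc.1 hr; omega)]
    have : (μ r : ℝ) ^ 2 = if Squarefree r then 1 else 0 := by
      exact_mod_cast congrArg (Int.cast : ℤ → ℝ) (ArithmeticFunction.moebius_sq (n := r))
    rw [div_mul_eq_mul_div, ← mul_assoc, ← sq, this]
    split_ifs <;> ring
  simp_rw [sq (xi M _)]
  rw [sum_mul_xi, e1, ← sum_sub_distrib]
  simp_rw [← mul_sub, ← sum_sub_distrib, ← mul_sub]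
  refine (abs_sum_moebius_div_totient_mul_le (E := (M:ℝ) ^ 3) (by positivity)
    fun r hr hrM c => ?_).trans (le_of_eq (by ring))
  exact abs_sum_filter_mod_xi_sub_le X c hr hrM

theorem exists_sum_sq_mangoldtDiff_asymptotic (a : ℕ) {m : ℕ} (hm : m ≠ 0) :
    ∃ C : ℝ, 0 < C ∧ ∀ᶠ X : ℕ in atTop, ∀ M : ℕ, (M:ℝ) ≤ Real.log X ^ a →
      |∑ n ∈ Icc 1 X, mangoldtDiff M n ^ 2 - (X * Real.log X - X - X * sqfSum M)| ≤
        C * (X / Real.log X ^ m) := by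
  obtain ⟨C₁, hC₁, h₁⟩ := exists_mangoldtDiff_residue_bound a (m := m + 2 * a) (by omega)
  obtain ⟨C₂, hC₂, h₂⟩ := exists_sum_sq_vonMangoldt_asymptotic m
  refine ⟨2 * C₁ + C₂ + 1, by positivity, ?_⟩
  filter_upwards [h₁, h₂, eventually_one_le_log, eventually_log_pow_le_sqrt (m + 5 * a),
    eventually_ge_atTop 1] with X h1 h2 h3 h4 hX
  intro M hM
  have hXX := natCast_eq_sqrt_mul_sqrt X
  have hX1 : 1 ≤ √(X:ℝ) := Real.one_le_sqrt.2 (by exact_mod_cast hX)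
  set L := Real.log X with hL
  have hL0 : 0 < L := by linarith
  have k1 : |∑ n ∈ Icc 1 X, mangoldtDiff M n * xi M n| ≤ C₁ * (X / L ^ m) := by
    rw [sum_mul_xi]
    refine (abs_sum_moebius_div_totient_mul_le (E := C₁ * (X / L ^ (m + 2 * a))) (by positivity)
      fun r hr hrM c => h1 M hM X le_rfl r hr hrM c).trans ?_
    calc (M:ℝ) ^ 2 * (C₁ * (X / L ^ (m + 2 * a))) ≤
        (L ^ a) ^ 2 * (C₁ * (X / L ^ (m + 2 * a))) := by gcongr
      _ = _ := by rw [pow_add, ← pow_mul, mul_comm a 2]; field_simp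
  have k2 : (M:ℝ) ^ 5 ≤ X / L ^ m := by
    rw [le_div_iff₀ (by positivity)]
    calc (M:ℝ) ^ 5 * L ^ m ≤ (L ^ a) ^ 5 * L ^ m := by gcongr
      _ = L ^ (m + 5 * a) := by ring
      _ ≤ 1 * √X := by linarith
      _ ≤ √X * √X := by gcongr
      _ = X := hXX.symm
  have k3 := (abs_sum_sq_xi_sub_le M X).trans k2
  have e : ∑ n ∈ Icc 1 X, mangoldtDiff M n ^ 2 = ∑ n ∈ Icc 1 X, Λ n ^ 2 -
      2 * ∑ n ∈ Icc 1 X, mangoldtDiff M n * xi M n - ∑ n ∈ Icc 1 X, xi M n ^ 2 := by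
    rw [mul_sum, ← sum_sub_distrib, ← sum_sub_distrib]
    exact sum_congr rfl fun n _ => by rw [mangoldtDiff]; ring
  rw [e]
  have j1 := abs_le.1 k1
  have j2 := abs_le.1 h2
  have j3 := abs_le.1 k3
  rw [abs_le]
  constructor <;> linarith [j1.1, j1.2, j2.1, j2.2, j3.1, j3.2]

end Vaughan

namespace Vaughan

/-- The correlations of `f` on `[1, X]` with shifts that are multiples `j * q`, `q ≤ Q`. -/
noncomputable def shiftCorrelation (f : ℕ → ℝ) (X Q : ℕ) : ℝ :=
  ∑ q ∈ Icc 1 Q, ∑ j ∈ Icc 1 (X / q), ∑ m ∈ Icc 1 X, ∑ n ∈ Icc 1 X,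
    if n = m + j * q then f m * f n else 0

/-- The exponential sum of `f` on `[1, X]`. -/
noncomputable def expSum (f : ℕ → ℝ) (X : ℕ) (α : ℝ) : ℂ :=
  ∑ n ∈ Icc 1 X, (f n : ℂ) * expTurn (n * α)

/-- The exponential sum over the lattice points `q ≤ Q`, `j * q ≤ X`. -/
noncomputable def divisorKernel (X Q : ℕ) (α : ℝ) : ℂ :=
  ∑ q ∈ Icc 1 Q, ∑ j ∈ Icc 1 (X / q), expTurn ((j * q : ℕ) * α)

lemma ite_mod_eq {X q m n : ℕ} (hq : q ≠ 0) (hm : m ∈ Icc 1 X) (hn : n ∈ Icc 1 X) (t : ℝ) :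
    (if m % q = n % q then t else 0) = (if m = n then t else 0) +
      ∑ j ∈ Icc 1 (X / q), ((if n = m + j * q then t else 0) + if m = n + j * q then t else 0) := by
  have hm := mem_Icc.1 hm
  have hn := mem_Icc.1 hn
  have key : ∀ m n : ℕ, n ≤ X → ∑ j ∈ Icc 1 (X / q), (if n = m + j * q then t else 0) =
      if m < n ∧ m % q = n % q then t else 0 := fun m n hn => by
    split_ifs with h
    · obtain ⟨j, hj⟩ := (Nat.modEq_iff_dvd' h.1.le).1 h.2
      have hnj : n = m + j * q := by rw [mul_comm, ← hj]; omega
      rw [sum_eq_single j]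
      · rw [if_pos hnj]
      · intro i _ hi
        rw [if_neg]
        intro h'
        exact hi (Nat.eq_of_mul_eq_mul_right (Nat.pos_of_ne_zero hq) (by omega))
      · intro hj'
        exfalso
        apply hj'
        rw [mem_Icc]
        constructor
        · rcases j.eq_zero_or_pos with rfl | h0
          · omega
          · exact h0
        · rw [Nat.le_div_iff_mul_le (Nat.pos_of_ne_zero hq)]
          omega
    · refine sum_eq_zero fun j hj => if_neg fun h' => h ?_
      have hj := mem_Icc.1 hj
      have : 0 < j * q := Nat.mul_pos hj.1 (Nat.pos_of_ne_zero hq)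
      refine ⟨by omega, ?_⟩
      rw [h', Nat.add_mul_mod_self_right]
  rw [sum_add_distrib, key m n hn.2, key n m hm.2]
  rcases lt_trichotomy m n with h | rfl | h
  · simp [h, h.ne, h.not_gt]
  · simp
  · simp [h, h.ne', h.not_gt, eq_comm]

lemma sum_sq_residue_sums (f : ℕ → ℝ) (X : ℕ) {q : ℕ} (hq : q ≠ 0) :
    ∑ a ∈ Icc 1 q, (∑ n ∈ Icc 1 X with n % q = a % q, f n) ^ 2 =
      ∑ n ∈ Icc 1 X, f n ^ 2 + 2 * ∑ j ∈ Icc 1 (X / q), ∑ m ∈ Icc 1 X, ∑ n ∈ Icc 1 X,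
        if n = m + j * q then f m * f n else 0 := by
  have h1 : ∑ a ∈ Icc 1 q, (∑ n ∈ Icc 1 X with n % q = a % q, f n) ^ 2 =
      ∑ m ∈ Icc 1 X, ∑ n ∈ Icc 1 X, if m % q = n % q then f m * f n else 0 := by
    simp_rw [sq, sum_mul_sum, sum_filter]
    rw [sum_comm]
    refine sum_congr rfl fun m _ => ?_
    have : ∀ a ∈ Icc 1 q, (if m % q = a % q then
        ∑ j ∈ Icc 1 X, (if j % q = a % q then f m * f j else 0) else 0) =
        ∑ n ∈ Icc 1 X, if m % q = a % q then (if n % q = a % q then f m * f n else 0) else 0 :=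
      fun a _ => by split_ifs <;> simp
    rw [sum_congr rfl this, sum_comm]
    refine sum_congr rfl fun n _ => ?_
    obtain ⟨a₀, ha₀, hma⟩ : ∃ a ∈ Icc 1 q, m % q = a % q := by
      rcases Nat.eq_zero_or_pos (m % q) with h | h
      · exact ⟨q, mem_Icc.2 ⟨Nat.pos_of_ne_zero hq, le_rfl⟩, by simp [h]⟩
      · exact ⟨m % q, mem_Icc.2 ⟨h, (Nat.mod_lt m (Nat.pos_of_ne_zero hq)).le⟩, by simp⟩
    rw [sum_eq_single a₀]
    · rw [if_pos hma, hma]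
      simp only [eq_comm]
    · intro a ha hne
      rw [if_neg]
      intro h
      have e : a % q = a₀ % q := by rw [← h, hma]
      have ha := mem_Icc.1 ha
      have ha₀ := mem_Icc.1 ha₀
      rcases ha.2.lt_or_eq with h1 | h1 <;> rcases ha₀.2.lt_or_eq with h2 | h2
      · rw [Nat.mod_eq_of_lt h1, Nat.mod_eq_of_lt h2] at e; omega
      · rw [Nat.mod_eq_of_lt h1, h2, Nat.mod_self] at e; omega
      · rw [Nat.mod_eq_of_lt h2, h1, Nat.mod_self] at e; omega
      · omega
    · intro h; exact absurd ha₀ h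
  have h2 : ∑ m ∈ Icc 1 X, ∑ n ∈ Icc 1 X, (if m % q = n % q then f m * f n else 0) =
      ∑ m ∈ Icc 1 X, ∑ n ∈ Icc 1 X, ((if m = n then f m * f n else 0) +
        ∑ j ∈ Icc 1 (X / q), ((if n = m + j * q then f m * f n else 0) +
          if m = n + j * q then f m * f n else 0)) :=
    sum_congr rfl fun m hm => sum_congr rfl fun n hn => ite_mod_eq hq hm hn _
  rw [h1, h2]
  simp_rw [sum_add_distrib]
  have e1 : ∑ m ∈ Icc 1 X, ∑ n ∈ Icc 1 X, (if m = n then f m * f n else 0) =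
      ∑ n ∈ Icc 1 X, f n ^ 2 := by
    refine sum_congr rfl fun m hm => ?_
    rw [sum_ite_eq, if_pos hm, sq]
  have e2 : ∑ m ∈ Icc 1 X, ∑ n ∈ Icc 1 X, ∑ j ∈ Icc 1 (X / q),
      (if n = m + j * q then f m * f n else 0) = ∑ j ∈ Icc 1 (X / q), ∑ m ∈ Icc 1 X,
      ∑ n ∈ Icc 1 X, if n = m + j * q then f m * f n else 0 :=
    (sum_congr rfl fun m _ => sum_comm).trans sum_comm
  have e3 : ∑ m ∈ Icc 1 X, ∑ n ∈ Icc 1 X, ∑ j ∈ Icc 1 (X / q),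
      (if m = n + j * q then f m * f n else 0) = ∑ m ∈ Icc 1 X, ∑ n ∈ Icc 1 X,
      ∑ j ∈ Icc 1 (X / q), (if n = m + j * q then f m * f n else 0) := by
    rw [sum_comm]
    simp_rw [mul_comm (f _) (f _)]
  rw [e1, e3, e2, two_mul]

lemma sum_sum_sq_residue_sums (f : ℕ → ℝ) (X Q : ℕ) :
    ∑ q ∈ Icc 1 Q, ∑ a ∈ Icc 1 q, (∑ n ∈ Icc 1 X with n % q = a % q, f n) ^ 2 =
      Q * ∑ n ∈ Icc 1 X, f n ^ 2 + 2 * shiftCorrelation f X Q := by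
  rw [sum_congr rfl fun q hq => sum_sq_residue_sums f X (by have := mem_Icc.1 hq; omega),
    sum_add_distrib, sum_const, Nat.card_Icc, Nat.add_sub_cancel, nsmul_eq_mul, ← mul_sum]
  rfl

lemma sum_expTurn_mul_int_div {N : ℕ} (hN : N ≠ 0) (t : ℤ) :
    ∑ k ∈ Icc 1 N, expTurn (t * (k / N : ℝ)) = if (N : ℤ) ∣ t then (N : ℂ) else 0 := by
  have hN' : (N : ℤ) ≠ 0 := by exact_mod_cast hN
  obtain ⟨v, hv⟩ := Int.eq_ofNat_of_zero_le (Int.emod_nonneg t hN')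
  have e : ∀ k : ℕ, expTurn (t * (k / N : ℝ)) = expTurn (k * v / N) := fun k => by
    rw [show (t * (k / N : ℝ)) = k * (t / N) by ring, mul_div_assoc, expTurn_natCast_mul,
      expTurn_natCast_mul, ← expTurn_emod_div t hN, hv, Int.cast_natCast]
  rw [sum_congr rfl fun k _ => e k, sum_expTurn_mul_div v hN]
  congr 1
  rw [Int.dvd_iff_emod_eq_zero, hv, Int.natCast_eq_zero, eq_iff_iff]
  have hlt : v < N := by
    have := Int.emod_lt_of_pos t (by omega : (0:ℤ) < N)
    omega
  exact ⟨fun h => Nat.eq_zero_of_dvd_of_lt h hlt, fun h => h ▸ dvd_zero _⟩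

lemma norm_sq_expSum (f : ℕ → ℝ) (X : ℕ) (α : ℝ) :
    ((‖expSum f X α‖ ^ 2 : ℝ) : ℂ) = ∑ m ∈ Icc 1 X, ∑ n ∈ Icc 1 X,
      ((f m * f n : ℝ) : ℂ) * expTurn (((n - m : ℤ) : ℝ) * α) := by
  rw [Complex.ofReal_pow, ← Complex.conj_mul', expSum, map_sum, sum_mul_sum]
  refine sum_congr rfl fun m _ => sum_congr rfl fun n _ => ?_
  rw [map_mul, Complex.conj_ofReal, conj_expTurn, Complex.ofReal_mul,
    show ((n - m : ℤ) : ℝ) * α = -(m * α) + n * α by push_cast; ring, expTurn_add]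
  ring

lemma sum_norm_sq_expSum (f : ℕ → ℝ) (X : ℕ) {N : ℕ} (hN : N = 2 * X + 1) :
    ∑ k ∈ Icc 1 N, ‖expSum f X (k / N)‖ ^ 2 = N * ∑ n ∈ Icc 1 X, f n ^ 2 := by
  apply Complex.ofReal_injective
  rw [Complex.ofReal_sum]
  simp_rw [norm_sq_expSum]
  rw [sum_comm, mul_sum, Complex.ofReal_sum]
  refine sum_congr rfl fun m hm => ?_
  rw [sum_comm]
  simp_rw [← mul_sum, sum_expTurn_mul_int_div (by omega : N ≠ 0)]
  have hm' := mem_Icc.1 hm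
  rw [sum_eq_single m]
  · simp; ring
  · intro n hn hne
    have hn := mem_Icc.1 hn
    rw [if_neg, mul_zero]
    intro h
    have := Int.eq_zero_of_abs_lt_dvd h (by rw [abs_lt]; constructor <;> omega)
    omega
  · intro h; exact absurd hm h

lemma natCast_mul_shiftCorrelation (f : ℕ → ℝ) (X Q : ℕ) {N : ℕ} (hN : N = 2 * X + 1) :
    ((N * shiftCorrelation f X Q : ℝ) : ℂ) =
      ∑ k ∈ Icc 1 N, ((‖expSum f X (k / N)‖ ^ 2 : ℝ) : ℂ) *
        (starRingEnd ℂ) (divisorKernel X Q (k / N)) := by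
  have e : ∀ k ∈ Icc 1 N, ((‖expSum f X (k / N)‖ ^ 2 : ℝ) : ℂ) *
      (starRingEnd ℂ) (divisorKernel X Q (k / N)) = ∑ q ∈ Icc 1 Q, ∑ j ∈ Icc 1 (X / q),
      ∑ m ∈ Icc 1 X, ∑ n ∈ Icc 1 X, ((f m * f n : ℝ) : ℂ) *
        expTurn (((n - m - j * q : ℤ) : ℝ) * (k / N)) := fun k _ => by
    rw [norm_sq_expSum, divisorKernel, map_sum, mul_sum]
    refine sum_congr rfl fun q _ => ?_
    rw [map_sum, mul_sum]
    refine sum_congr rfl fun j _ => ?_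
    rw [sum_mul]
    refine sum_congr rfl fun m _ => ?_
    rw [sum_mul]
    refine sum_congr rfl fun n _ => ?_
    rw [conj_expTurn, mul_assoc, ← expTurn_add]
    congr 2
    push_cast; ring
  rw [sum_congr rfl e, Complex.ofReal_mul, shiftCorrelation, Complex.ofReal_sum, mul_sum]
  refine Eq.symm (sum_comm.trans ?_)
  refine sum_congr rfl fun q hq => ?_
  have hq := mem_Icc.1 hq
  refine sum_comm.trans ?_
  rw [Complex.ofReal_sum, mul_sum]
  refine sum_congr rfl fun j hj => ?_
  have hj := mem_Icc.1 hj
  have hjq : j * q ≤ X := (Nat.le_div_iff_mul_le (by omega)).1 hj.2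
  refine sum_comm.trans ?_
  rw [Complex.ofReal_sum, mul_sum]
  refine sum_congr rfl fun m hm => ?_
  have hm := mem_Icc.1 hm
  refine sum_comm.trans ?_
  rw [Complex.ofReal_sum, mul_sum]
  refine sum_congr rfl fun n hn => ?_
  have hn := mem_Icc.1 hn
  rw [← mul_sum, sum_expTurn_mul_int_div (by omega : N ≠ 0)]
  by_cases h : n = m + j * q
  · rw [if_pos h, if_pos (by rw [h]; push_cast; ring_nf; exact dvd_zero _)]
    push_cast; ring
  · rw [if_neg h, if_neg]
    · simp
    · intro h'
      have h1 : ((n:ℤ) - m - j * q) = ((n:ℤ) - m - (j * q : ℕ)) := by push_cast; ring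
      rw [h1] at h'
      have := Int.eq_zero_of_abs_lt_dvd h' (by rw [abs_lt]; constructor <;> omega)
      omega

lemma natCast_mul_abs_shiftCorrelation_le (f : ℕ → ℝ) (X Q : ℕ) {N : ℕ} (hN : N = 2 * X + 1) :
    N * |shiftCorrelation f X Q| ≤
      ∑ k ∈ Icc 1 N, ‖expSum f X (k / N)‖ ^ 2 * ‖divisorKernel X Q (k / N)‖ := by
  have h := congrArg norm (natCast_mul_shiftCorrelation f X Q hN)
  rw [Complex.norm_real, Real.norm_eq_abs, abs_mul, Nat.abs_cast] at h
  rw [h]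
  refine (norm_sum_le _ _).trans (le_of_eq (sum_congr rfl fun k _ => ?_))
  rw [norm_mul, RCLike.norm_conj, Complex.norm_real, Real.norm_of_nonneg (by positivity)]

lemma norm_sum_Ioc_expTurn_le (t : ℝ) (a b : ℕ) {d : ℝ} (hd : 0 < d) (h : d ≤ ‖expTurn t - 1‖) :
    ‖∑ j ∈ Ioc a b, expTurn (j * t)‖ ≤ 2 / d := by
  rcases le_total b a with hab | hab
  · rw [Ioc_eq_empty_of_le hab, sum_empty, norm_zero]; positivity
  have h1 : expTurn t ≠ 1 := fun h' => by
    rw [h', sub_self, norm_zero] at h; linarith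
  have e : Ioc a b = Ico (a + 1) (b + 1) := by ext; simp
  simp_rw [expTurn_natCast_mul]
  rw [e, geom_sum_Ico h1 (by omega), norm_div]
  refine div_le_div₀ zero_le_two ?_ hd h
  refine (norm_sub_le _ _).trans ?_
  rw [norm_pow, norm_pow, norm_expTurn]
  norm_num

lemma norm_sum_Ioc_expTurn_le_sub (g : ℕ → ℝ) (a b : ℕ) :
    ‖∑ j ∈ Ioc a b, expTurn (g j)‖ ≤ b := by
  refine (norm_sum_le _ _).trans ?_
  simp only [norm_expTurn, sum_const, Nat.card_Ioc, nsmul_eq_mul, mul_one]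
  exact_mod_cast Nat.sub_le b a

lemma norm_divisorKernel_le {X Q : ℕ} {α : ℝ} {B : ℕ → ℝ}
    (hB : ∀ h ∈ Icc 1 X.sqrt, ∀ a b : ℕ, b ≤ X / h →
      ‖∑ j ∈ Ioc a b, expTurn (j * (h * α))‖ ≤ B h) :
    ‖divisorKernel X Q α‖ ≤ 2 * ∑ h ∈ Icc 1 X.sqrt, B h := by
  have hB0 : ∀ h ∈ Icc 1 X.sqrt, 0 ≤ B h := fun h hh =>
    (norm_nonneg _).trans (hB h hh 0 0 (Nat.zero_le _))
  have h1 : ‖∑ q ∈ Icc 1 Q with q ≤ X.sqrt, ∑ j ∈ Icc 1 (X / q), expTurn ((j * q : ℕ) * α)‖ ≤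
      ∑ h ∈ Icc 1 X.sqrt, B h := by
    have hsub : {q ∈ Icc 1 Q | q ≤ X.sqrt} ⊆ Icc 1 X.sqrt := fun q hq => by
      simp only [mem_filter, mem_Icc] at hq ⊢; omega
    refine (norm_sum_le_of_le _ fun q hq => ?_).trans
      (sum_le_sum_of_subset_of_nonneg hsub fun q hq _ => hB0 q hq)
    refine le_trans (le_of_eq (congrArg norm ?_)) (hB q (hsub hq) 0 (X / q) le_rfl)
    refine sum_congr rfl fun j _ => ?_
    push_cast; rw [mul_assoc]
  have h2 : ‖∑ q ∈ Icc 1 Q with ¬ q ≤ X.sqrt, ∑ j ∈ Icc 1 (X / q), expTurn ((j * q : ℕ) * α)‖ ≤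
      ∑ h ∈ Icc 1 X.sqrt, B h := by
    have e : ∑ q ∈ Icc 1 Q with ¬ q ≤ X.sqrt, ∑ j ∈ Icc 1 (X / q), expTurn ((j * q : ℕ) * α) =
        ∑ j ∈ Icc 1 X.sqrt, ∑ q ∈ Ioc X.sqrt (min Q (X / j)), expTurn (q * (j * α)) := by
      refine (sum_comm' ?_).trans (sum_congr rfl fun j _ => sum_congr rfl fun q _ => ?_)
      · intro q j
        simp only [mem_filter, mem_Icc, mem_Ioc, le_min_iff, not_le]
        constructor
        · rintro ⟨⟨⟨hq1, hqQ⟩, hq⟩, hj1, hj⟩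
          have hjq := (Nat.le_div_iff_mul_le hq1).1 hj
          have hjX : j ≤ X.sqrt := by
            by_contra! hlt
            have := Nat.lt_succ_sqrt X
            have := Nat.mul_le_mul (Nat.succ_le_of_lt hlt) (Nat.succ_le_of_lt hq)
            omega
          exact ⟨⟨hq, hqQ, (Nat.le_div_iff_mul_le hj1).2 (by rwa [mul_comm])⟩, hj1, hjX⟩
        · rintro ⟨⟨hq, hqQ, hqj⟩, hj1, hj⟩
          have hjq := (Nat.le_div_iff_mul_le hj1).1 hqj
          exact ⟨⟨⟨by omega, hqQ⟩, hq⟩, hj1,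
            (Nat.le_div_iff_mul_le (by omega)).2 (by rwa [mul_comm])⟩
      · push_cast; congr 1; ring
    rw [e]
    exact norm_sum_le_of_le _ fun j hj => hB j hj _ _ (min_le_right _ _)
  rw [divisorKernel, ← sum_filter_add_sum_filter_not (Icc 1 Q) (fun q => q ≤ X.sqrt), two_mul]
  exact (norm_add_le _ _).trans (add_le_add h1 h2)

lemma sum_Icc_inv_le (n : ℕ) : ∑ k ∈ Icc 1 n, ((k:ℝ))⁻¹ ≤ 1 + Real.log n := by
  have := harmonic_le_one_add_log n
  rw [harmonic_eq_sum_Icc] at this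
  push_cast at this
  exact this

lemma norm_divisorKernel_le_trivial {X Q : ℕ} (hQ : Q ≤ X) (α : ℝ) :
    ‖divisorKernel X Q α‖ ≤ X * (1 + Real.log X) := by
  have h1 : ‖divisorKernel X Q α‖ ≤ ∑ q ∈ Icc 1 Q, (X:ℝ) * (q:ℝ)⁻¹ := by
    refine norm_sum_le_of_le _ fun q _ => ?_
    refine (norm_sum_Ioc_expTurn_le_sub (fun j => (j * q : ℕ) * α) 0 (X / q)).trans ?_
    rw [← div_eq_mul_inv]
    exact Nat.cast_div_le
  refine h1.trans ?_
  rw [← mul_sum]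
  refine mul_le_mul_of_nonneg_left (le_trans ?_ (sum_Icc_inv_le X)) (by positivity)
  exact sum_le_sum_of_subset_of_nonneg (Icc_subset_Icc_right hQ) fun _ _ _ => by positivity

lemma sum_filter_dvd_div_le (X Z : ℕ) {s : ℕ} (hs : s ≠ 0) :
    ∑ h ∈ Icc 1 Z with s ∣ h, (X:ℝ) / h ≤ X / s * (1 + Real.log Z) := by
  have hsub : {h ∈ Icc 1 Z | s ∣ h} ⊆ (Icc 1 Z).image (s * ·) := fun h hh => by
    obtain ⟨hh, l, rfl⟩ := mem_filter.1 hh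
    have hh := mem_Icc.1 hh
    refine mem_image.2 ⟨l, mem_Icc.2 ⟨?_, ?_⟩, rfl⟩
    · exact Nat.pos_of_mul_pos_left hh.1
    · exact (Nat.le_mul_of_pos_left l (Nat.pos_of_ne_zero hs)).trans hh.2
  refine (sum_le_sum_of_subset_of_nonneg hsub fun _ _ _ => by positivity).trans ?_
  rw [sum_image fun a _ b _ h => Nat.eq_of_mul_eq_mul_left (Nat.pos_of_ne_zero hs) h]
  refine le_trans (le_of_eq ?_) (mul_le_mul_of_nonneg_left (sum_Icc_inv_le Z) (by positivity))
  rw [mul_sum]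
  refine sum_congr rfl fun l _ => ?_
  push_cast
  rw [div_mul_eq_div_div, div_eq_mul_inv]

lemma sum_Icc_div_add_div_sub_le (s : ℕ) :
    ∑ v ∈ Icc 1 (s - 1), ((s:ℝ) / v + s / (s - v)) ≤ 2 * s * (1 + Real.log s) := by
  have e : ∑ v ∈ Icc 1 (s - 1), (s:ℝ) / (s - v) = ∑ v ∈ Icc 1 (s - 1), (s:ℝ) / v := by
    refine sum_nbij' (fun v => s - v) (fun v => s - v) ?_ ?_ ?_ ?_ ?_
    · intro v hv; simp only [mem_Icc] at hv ⊢; omega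
    · intro v hv; simp only [mem_Icc] at hv ⊢; omega
    · intro v hv; simp only [mem_Icc] at hv; omega
    · intro v hv; simp only [mem_Icc] at hv; omega
    · intro v hv
      simp only [mem_Icc] at hv
      rw [Nat.cast_sub (by omega)]
  have h : ∑ v ∈ Icc 1 (s - 1), ((v:ℝ))⁻¹ ≤ 1 + Real.log s :=
    (sum_le_sum_of_subset_of_nonneg (Icc_subset_Icc_right (Nat.sub_le s 1))
      fun _ _ _ => by positivity).trans (sum_Icc_inv_le s)
  rw [sum_add_distrib, e, ← two_mul]
  simp_rw [div_eq_mul_inv]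
  rw [← mul_sum, ← mul_assoc]
  exact mul_le_mul_of_nonneg_left h (by positivity)

lemma card_filter_mul_emod_eq_le (Z : ℕ) {s : ℕ} (hs : s ≠ 0) {b : ℤ} (hb : IsCoprime (s : ℤ) b)
    (v : ℕ) : (#((Icc 1 Z).filter fun h : ℕ => (((h : ℤ) * b) % s).toNat = v) : ℝ) ≤ Z / s + 1 := by
  have hs' : (s : ℤ) ≠ 0 := by exact_mod_cast hs
  rcases ((Icc 1 Z).filter fun h : ℕ => (((h : ℤ) * b) % s).toNat = v).eq_empty_or_nonempty with he | ⟨c, hc⟩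
  · rw [he]; simp; positivity
  · have hc := (mem_filter.1 hc).2
    have := abs_le.1 (abs_card_filter_mod_sub_le Z c hs)
    refine le_trans ?_ (by linarith [this.2] : (#{n ∈ Icc 1 Z | n % s = c % s} : ℝ) ≤ Z / s + 1)
    refine Nat.cast_le.2 (card_le_card fun h hh => ?_)
    obtain ⟨hh, hv⟩ := mem_filter.1 hh
    refine mem_filter.2 ⟨hh, ?_⟩
    have e : ((h : ℤ) * b) % s = ((c : ℤ) * b) % s := by
      have h1 := Int.emod_nonneg ((h : ℤ) * b) hs'
      have h2 := Int.emod_nonneg ((c : ℤ) * b) hs'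
      omega
    have h3 : (s : ℤ) ∣ (h - c) * b := by
      rw [sub_mul]
      exact Int.ModEq.dvd (Eq.symm e)
    have h4 := hb.dvd_of_dvd_mul_right h3
    have h5 : (c : ℤ) ≡ h [ZMOD s] := Int.modEq_iff_dvd.2 h4
    exact (Int.natCast_modEq_iff.1 h5).symm

lemma norm_divisorKernel_le_of_approx {X Q s : ℕ} {b : ℤ} {α d : ℝ} (hs : s ≠ 0)
    (hb : IsCoprime (s : ℤ) b) (hα : |α - b / s| ≤ d / s) (hd : Real.pi * √X * d ≤ 1) :
    ‖divisorKernel X Q α‖ ≤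
      2 * (X / s * (1 + Real.log X) + 2 * (√X + s) * (1 + Real.log s)) := by
  have hs0 : (0:ℝ) < s := by positivity
  have hs' : (s : ℤ) ≠ 0 := by exact_mod_cast hs
  set v : ℕ → ℕ := fun h => (((h : ℤ) * b) % s).toNat with hv
  have hvcast : ∀ h : ℕ, ((((h : ℤ) * b) % s : ℤ) : ℝ) = v h := fun h => by
    have : ((((h : ℤ) * b) % s).toNat : ℤ) = ((h : ℤ) * b) % s :=
      Int.toNat_of_nonneg (Int.emod_nonneg _ hs')
    rw [← this]; rfl
  have hvrange : ∀ h : ℕ, ¬ s ∣ h → v h ∈ Icc 1 (s - 1) := fun h hh => by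
    have h1 := Int.emod_nonneg ((h : ℤ) * b) hs'
    have h2 := Int.emod_lt_of_pos ((h : ℤ) * b) (by omega : (0:ℤ) < s)
    have h3 : ((h : ℤ) * b) % s ≠ 0 := fun h' => hh <| by
      exact_mod_cast hb.dvd_of_dvd_mul_right (Int.dvd_of_emod_eq_zero h')
    simp only [hv, mem_Icc]
    omega
  have hZ : (X.sqrt : ℝ) ≤ √X := Real.nat_sqrt_le_real_sqrt
  have hmain := norm_divisorKernel_le (X := X) (Q := Q) (α := α)
    (B := fun h => if s ∣ h then (X:ℝ) / h else (s:ℝ) / v h + s / (s - v h)) (by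
    intro h hh a c hc
    have hh := mem_Icc.1 hh
    split_ifs with hsh
    · refine (norm_sum_Ioc_expTurn_le_sub _ a c).trans ?_
      exact (Nat.cast_le.2 hc).trans Nat.cast_div_le
    · have hvr := mem_Icc.1 (hvrange h hsh)
      have hv1 : (1:ℝ) ≤ v h := by exact_mod_cast hvr.1
      have hv2 : (1:ℝ) ≤ s - v h := by
        have : v h + 1 ≤ s := by omega
        have : (v h : ℝ) + 1 ≤ s := by exact_mod_cast this
        linarith
      have h1 := le_norm_expTurn_div_sub_one ((h : ℤ) * b) hs
      rw [hvcast] at h1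
      set μ := min (v h : ℝ) (s - v h) with hμ
      have hμ1 : 1 ≤ μ := le_min hv1 hv2
      have hpert : ‖expTurn (h * α) - expTurn (((h : ℤ) * b : ℤ) / s)‖ ≤ 2 / s := by
        have e : expTurn (h * α) = expTurn (((h : ℤ) * b : ℤ) / s) *
            expTurn (h * (α - b / s)) := by
          rw [← expTurn_add]; congr 1; push_cast; ring
        rw [e, ← mul_sub_one, norm_mul, norm_expTurn, one_mul]
        refine (norm_expTurn_sub_one_le _).trans ?_
        rw [abs_mul, Nat.abs_cast]
        have hhX : (h:ℝ) ≤ √X := le_trans (by exact_mod_cast hh.2) hZ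
        calc 2 * Real.pi * (h * |α - b / s|) ≤ 2 * Real.pi * (√X * (d / s)) := by
              have := Real.pi_pos
              gcongr
          _ = 2 * (Real.pi * √X * d) / s := by ring
          _ ≤ 2 * 1 / s := by gcongr
          _ = 2 / s := by ring
      have hlow : 2 * μ / s ≤ ‖expTurn (h * α) - 1‖ := by
        have h2 : ‖expTurn (((h : ℤ) * b : ℤ) / s) - 1‖ ≤
            ‖expTurn (h * α) - 1‖ + ‖expTurn (h * α) - expTurn (((h : ℤ) * b : ℤ) / s)‖ := by
          rw [norm_sub_rev (expTurn (h * α)) (expTurn _), add_comm]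
          exact norm_sub_le_norm_sub_add_norm_sub _ _ _
        have h3 : 2 / (s:ℝ) ≤ 2 * μ / s := by gcongr; linarith
        have h4 : 4 * μ / s = 2 * μ / s + 2 * μ / s := by ring
        linarith
      refine (norm_sum_Ioc_expTurn_le (h * α) a c (by positivity) hlow).trans ?_
      have e : 2 / (2 * μ / s) = s / μ := by field_simp
      rw [e]
      rcases min_choice (v h : ℝ) (s - v h) with h5 | h5 <;> rw [hμ, h5]
      · have : 0 ≤ (s:ℝ) / (s - v h) := by positivity
        linarith
      · have : 0 ≤ (s:ℝ) / v h := by positivity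
        linarith)
  refine hmain.trans (mul_le_mul_of_nonneg_left ?_ zero_le_two)
  rw [sum_ite]
  refine add_le_add ?_ ?_
  · refine (sum_filter_dvd_div_le X X.sqrt hs).trans ?_
    rcases X.eq_zero_or_pos with rfl | hX
    · simp
    have : (0:ℝ) < X.sqrt := by exact_mod_cast Nat.sqrt_pos.2 hX
    have : (X.sqrt : ℝ) ≤ X := by exact_mod_cast Nat.sqrt_le_self X
    gcongr
  · rw [← sum_fiberwise_of_maps_to (t := Icc 1 (s - 1)) (g := v)
      fun h hh => hvrange h (mem_filter.1 hh).2]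
    have hfib : ∀ w ∈ Icc 1 (s - 1),
        ∑ h ∈ {h ∈ Icc 1 X.sqrt | ¬ s ∣ h} with v h = w, ((s:ℝ) / v h + s / (s - v h)) ≤
          (√X / s + 1) * ((s:ℝ) / w + s / (s - w)) := fun w hw => by
      have hw := mem_Icc.1 hw
      have hw2 : (0:ℝ) ≤ s - w := by
        have : w ≤ s := by omega
        have : (w : ℝ) ≤ s := by exact_mod_cast this
        linarith
      rw [sum_congr rfl fun h hh => by rw [(mem_filter.1 hh).2], sum_const, nsmul_eq_mul]
      refine mul_le_mul_of_nonneg_right ?_ (by positivity)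
      refine le_trans ?_ ((card_filter_mul_emod_eq_le X.sqrt hs hb w).trans (by gcongr))
      refine Nat.cast_le.2 (card_le_card fun h hh => ?_)
      simp only [mem_filter] at hh ⊢
      exact ⟨hh.1.1, hh.2⟩
    refine (sum_le_sum hfib).trans ?_
    rw [← mul_sum]
    calc _ ≤ (√X / s + 1) * (2 * s * (1 + Real.log s)) := by
          gcongr
          exact sum_Icc_div_add_div_sub_le s
      _ = _ := by field_simp

end Vaughan

namespace Vaughan
open Filter Topology

lemma norm_sum_mul_expTurn_div_le {f : ℕ → ℝ} {y s : ℕ} {E : ℝ} (hs : s ≠ 0) (b : ℤ)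
    (hE : ∀ c, |∑ n ∈ Icc 1 y with n % s = c % s, f n| ≤ E) :
    ‖∑ n ∈ Icc 1 y, (f n : ℂ) * expTurn (n * (b / s))‖ ≤ s * E := by
  rw [← sum_fiberwise_of_maps_to (t := range s) (g := fun n => n % s)
    fun n _ => mem_range.2 (Nat.mod_lt n (Nat.pos_of_ne_zero hs))]
  have h : ∀ c ∈ range s,
      ‖∑ n ∈ Icc 1 y with n % s = c, (f n : ℂ) * expTurn (n * (b / s))‖ ≤ E := fun c hc => by
    have hc := mem_range.1 hc
    have e : ∑ n ∈ Icc 1 y with n % s = c, (f n : ℂ) * expTurn (n * (b / s)) =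
        ((∑ n ∈ Icc 1 y with n % s = c % s, f n : ℝ) : ℂ) * expTurn (c * (b / s)) := by
      rw [Complex.ofReal_sum, sum_mul, Nat.mod_eq_of_lt hc]
      refine sum_congr rfl fun n hn => ?_
      have hn := (mem_filter.1 hn).2
      congr 1
      have h1 := expTurn_emod_div ((n : ℤ) * b) hs
      have h2 := expTurn_emod_div ((c : ℤ) * b) hs
      have h3 : ((n : ℤ) * b) % s = ((c : ℤ) * b) % s := by
        have : (n : ℤ) % s = c % s := by
          rw [← hn]; push_cast; rw [Int.emod_emod]
        rw [Int.mul_emod, this, ← Int.mul_emod]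
      rw [h3, h2] at h1
      push_cast at h1
      rw [mul_div_assoc, mul_div_assoc] at h1
      exact h1.symm
    rw [e, norm_mul, norm_expTurn, mul_one, Complex.norm_real]
    exact hE c
  exact (norm_sum_le_of_le _ h).trans (by simp)

lemma norm_expSum_le_of_approx {f : ℕ → ℝ} {X s : ℕ} {E : ℝ} (hs : s ≠ 0) (b : ℤ) (α : ℝ)
    (hE : ∀ y ≤ X, ∀ c, |∑ n ∈ Icc 1 y with n % s = c % s, f n| ≤ E) :
    ‖expSum f X α‖ ≤ s * E * (1 + X * (2 * Real.pi * |α - b / s|)) := by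
  set β := α - b / s with hβ
  have e : expSum f X α = ∑ n ∈ Ioc 0 X, expTurn (n * β) *
      ((f n : ℂ) * expTurn (n * (b / s))) := by
    rw [expSum]
    refine sum_congr rfl fun n _ => ?_
    rw [show (n : ℝ) * α = n * β + n * (b / s) by rw [hβ]; ring, expTurn_add]
    ring
  have hE0 : 0 ≤ E := (abs_nonneg _).trans (hE 0 (Nat.zero_le X) 0)
  rw [e]
  refine (norm_sum_mul_le (Nat.zero_le X) (B := s * E)
    fun j _ hj => norm_sum_mul_expTurn_div_le hs b (hE j hj)).trans ?_
  gcongr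
  · rw [norm_expTurn]
  · have h : ∀ n ∈ Ico 0 X, ‖expTurn ((n + 1 : ℕ) * β) - expTurn (n * β)‖ ≤
        2 * Real.pi * |β| := fun n _ => by
      rw [show ((n + 1 : ℕ) : ℝ) * β = n * β + β by push_cast; ring, expTurn_add, ← mul_sub_one,
        norm_mul, norm_expTurn, one_mul]
      exact norm_expTurn_sub_one_le β
    exact (sum_le_card_nsmul _ _ _ h).trans (by simp)

open Classical in
/-- The `k ≤ N` for which `k / N` lies within `δ / s` of a fraction with denominator `s ≤ M`. -/
noncomputable def majorIndices (N M : ℕ) (δ : ℝ) : Finset ℕ :=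
  {k ∈ Icc 1 N | ∃ s : ℕ, s ≠ 0 ∧ s ≤ M ∧ ∃ b : ℤ, |(k / N : ℝ) - b / s| ≤ δ / s}

lemma card_majorIndices_le {N M T : ℕ} {δ : ℝ} (hδ : δ * N ≤ T) :
    #(majorIndices N M δ) ≤ M * (2 * T + 1) * (M + 2 * T + 1) := by
  classical
  have hsub : majorIndices N M δ ⊆
      (Icc 1 M ×ˢ Icc (-(T:ℤ)) T ×ˢ Icc (-(T:ℤ)) (M + T)).image
        fun p => ((p.2.1 + p.2.2 * N) / (p.1 : ℤ)).toNat := fun k hk => by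
    obtain ⟨hk, s, hs, hsM, b, hb⟩ := mem_filter.1 hk
    have hk := mem_Icc.1 hk
    have hs0 : (0:ℝ) < s := by positivity
    have hN0 : (0:ℝ) < N := by exact_mod_cast (by omega : 0 < N)
    have h1 : |((k * s - b * N : ℤ) : ℝ)| ≤ T := by
      refine le_trans ?_ hδ
      rw [le_div_iff₀ hs0] at hb
      calc |((k * s - b * N : ℤ) : ℝ)| = |(k / N : ℝ) - b / s| * s * N := by
            rw [← abs_of_pos hs0, ← abs_of_pos hN0, ← abs_mul, ← abs_mul, abs_of_pos hs0,
              abs_of_pos hN0]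
            congr 1
            push_cast
            field_simp
        _ ≤ _ := by gcongr
    have h2 : |(k * s - b * N : ℤ)| ≤ T := by exact_mod_cast h1
    have h3 := abs_le.1 h2
    have hks : (0:ℤ) ≤ (k : ℤ) * s := by positivity
    have hksM : (k : ℤ) * s ≤ M * N := by
      have : k * s ≤ N * M := Nat.mul_le_mul hk.2 hsM
      rw [mul_comm (M : ℤ)]
      exact_mod_cast this
    have hN1 : (1:ℤ) ≤ N := by omega
    refine mem_image.2 ⟨(s, k * s - b * N, b), ?_, ?_⟩
    · simp only [mem_product, mem_Icc]
      refine ⟨⟨Nat.pos_of_ne_zero hs, hsM⟩, h3, ?_, ?_⟩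
      · by_contra! hlt
        nlinarith [h3.2]
      · by_contra! hlt
        nlinarith [h3.1]
    · simp only [sub_add_cancel]
      rw [Int.mul_ediv_cancel _ (by exact_mod_cast hs), Int.toNat_natCast]
  refine (card_le_card hsub).trans (card_image_le.trans (le_of_eq ?_))
  rw [card_product, card_product, Nat.card_Icc, Int.card_Icc, Int.card_Icc, mul_assoc]
  congr 2
  · omega
  · omega

lemma abs_shiftCorrelation_le {f : ℕ → ℝ} {X Q M : ℕ} {E : ℝ} (hQ : Q ≤ X) (hM : 1 ≤ M)
    (hMX : Real.pi * M ≤ √X) (hL : 1 ≤ Real.log X)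
    (hE : ∀ y ≤ X, ∀ s ≠ 0, s ≤ M → ∀ c, |∑ n ∈ Icc 1 y with n % s = c % s, f n| ≤ E) :
    |shiftCorrelation f X Q| ≤
      20 * (X / M * Real.log X) * ∑ n ∈ Icc 1 X, f n ^ 2 + 7168 * M ^ 7 * E ^ 2 * Real.log X := by
  set L := Real.log X with hLdef
  have hM1 : (1:ℝ) ≤ M := by exact_mod_cast hM
  have hE0 : 0 ≤ E := (abs_nonneg _).trans (hE 0 (Nat.zero_le X) 1 one_ne_zero hM 0)
  have hpi := Real.pi_gt_three
  have hpi4 := Real.pi_lt_d2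
  have hXX := natCast_eq_sqrt_mul_sqrt X
  have hMs : (M:ℝ) ≤ √X := by nlinarith
  have hX0 : (0:ℝ) < X := by rw [hXX]; nlinarith
  have hX1 : 1 ≤ X := by exact_mod_cast hX0
  have hMX' : M ≤ X := by
    have : (M:ℝ) ≤ X := by nlinarith
    exact_mod_cast this
  have hsX : √X ≤ X / M := by
    rw [le_div_iff₀ (by positivity)]
    nth_rewrite 2 [hXX]
    gcongr
  obtain ⟨N, hN⟩ : ∃ N, N = 2 * X + 1 := ⟨_, rfl⟩
  have hNX : (X:ℝ) ≤ N := by rw [hN]; push_cast; linarith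
  have hN0 : (0:ℝ) < N := hX0.trans_le hNX
  set P := majorIndices N M (M / X) with hP
  have hcard : (#P : ℝ) ≤ 56 * M ^ 3 := by
    have h := card_majorIndices_le (N := N) (M := M) (T := 3 * M) (δ := M / X) (by
      rw [hN, div_mul_eq_mul_div, div_le_iff₀ hX0]
      have : (1:ℝ) ≤ X := by exact_mod_cast hX1
      push_cast
      nlinarith)
    calc (#P : ℝ) ≤ ((M * (2 * (3 * M) + 1) * (M + 2 * (3 * M) + 1) : ℕ) : ℝ) := by
          exact_mod_cast h
      _ = M * (6 * M + 1) * (7 * M + 1) := by push_cast; ring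
      _ ≤ M * (6 * M + M) * (7 * M + M) := by gcongr
      _ = _ := by ring
  have hminor : ∀ k ∈ Icc 1 N, k ∉ P → ‖divisorKernel X Q (k / N)‖ ≤ 20 * (X / M * L) := by
    intro k hk hkP
    obtain ⟨r, hr, hrd⟩ := Real.exists_rat_abs_sub_le_and_den_le (k / N : ℝ)
      (Nat.div_pos hMX' hM)
    have hs0 : (0:ℝ) < r.den := by exact_mod_cast r.den_pos
    have hdiv : (X:ℝ) / M ≤ ((X / M : ℕ) : ℝ) + 1 := by
      rw [← Nat.floor_div_eq_div (K := ℝ)]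
      exact (Nat.lt_floor_add_one _).le
    have happ : |(k / N : ℝ) - r.num / r.den| ≤ M / X / r.den := by
      have e : ((r.num : ℝ) / r.den) = r := by exact_mod_cast Rat.cast_def (K := ℝ) r |>.symm
      rw [e]
      refine hr.trans ?_
      rw [← one_div_div (X:ℝ) M, div_div]
      have : (0:ℝ) < X / M := by positivity
      gcongr
    have hsM : M < r.den := by
      by_contra! hle
      exact hkP (by
        classical
        exact mem_filter.2 ⟨hk, r.den, r.den_nz, hle, r.num, happ⟩)
    have hsM' : (M:ℝ) < r.den := by exact_mod_cast hsM
    have hsX' : (r.den : ℝ) ≤ X / M :=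
      (Nat.cast_le.2 hrd).trans Nat.cast_div_le
    have hcop : IsCoprime (r.den : ℤ) r.num := by
      rw [isCoprime_comm]
      exact Int.isCoprime_iff_gcd_eq_one.2 r.reduced
    refine (norm_divisorKernel_le_of_approx r.den_nz hcop happ ?_).trans ?_
    · rw [mul_div_assoc', div_le_one hX0]
      nth_rewrite 2 [hXX]
      nlinarith [Real.sqrt_nonneg (X:ℝ)]
    · have hlog : Real.log r.den ≤ L := by
        rw [hLdef]
        gcongr
        exact hrd.trans (Nat.div_le_self X M)
      calc _ ≤ 2 * (X / M * (1 + L) + 2 * (X / M + X / M) * (1 + L)) := by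
            have : 0 ≤ 1 + Real.log r.den := by
              have := Real.log_natCast_nonneg r.den
              linarith
            gcongr
        _ = 10 * (X / M * (1 + L)) := by ring
        _ ≤ 10 * (X / M * (L + L)) := by gcongr
        _ = _ := by ring
  have hmajor : ∀ k ∈ P, ‖expSum f X (k / N)‖ ≤ 8 * M ^ 2 * E := by
    intro k hk
    classical
    obtain ⟨_, s, hs, hsM, b, hb⟩ := mem_filter.1 hk
    have hs1 : (1:ℝ) ≤ s := by exact_mod_cast Nat.one_le_iff_ne_zero.2 hs
    refine (norm_expSum_le_of_approx hs b _ fun y hy c => hE y hy s hs hsM c).trans ?_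
    have hsM' : (s:ℝ) ≤ M := by exact_mod_cast hsM
    calc s * E * (1 + X * (2 * Real.pi * |(k / N : ℝ) - b / s|)) ≤
        M * E * (1 + X * (2 * Real.pi * (M / X / s))) := by gcongr
      _ = M * E * (1 + 2 * Real.pi * M / s) := by field_simp
      _ ≤ M * E * (M + 7 * M / 1) := by
          gcongr
          linarith
      _ = _ := by ring
  have hS := sum_norm_sq_expSum f X hN
  have hle : N * |shiftCorrelation f X Q| ≤ N * (20 * (X / M * L) * ∑ n ∈ Icc 1 X, f n ^ 2 +
      7168 * M ^ 7 * E ^ 2 * L) := by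
    refine (natCast_mul_abs_shiftCorrelation_le f X Q hN).trans ?_
    classical
    have hPsub : P ⊆ Icc 1 N := filter_subset _ _
    rw [← sum_sdiff hPsub]
    have h1 : ∑ k ∈ Icc 1 N \ P, ‖expSum f X (k / N)‖ ^ 2 * ‖divisorKernel X Q (k / N)‖ ≤
        20 * (X / M * L) * (N * ∑ n ∈ Icc 1 X, f n ^ 2) := by
      rw [← hS, mul_sum]
      refine (sum_le_sum fun k hk => ?_).trans
        (sum_le_sum_of_subset_of_nonneg sdiff_subset fun k _ _ => by positivity)
      have hk := mem_sdiff.1 hk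
      rw [mul_comm]
      gcongr
      exact hminor k hk.1 hk.2
    have h2 : ∑ k ∈ P, ‖expSum f X (k / N)‖ ^ 2 * ‖divisorKernel X Q (k / N)‖ ≤
        56 * M ^ 3 * ((8 * M ^ 2 * E) ^ 2 * (X * (L + L))) := by
      have h : ∀ k ∈ P, ‖expSum f X (k / N)‖ ^ 2 * ‖divisorKernel X Q (k / N)‖ ≤
          (8 * M ^ 2 * E) ^ 2 * (X * (L + L)) := fun k hk => by
        gcongr
        · exact hmajor k hk
        · refine (norm_divisorKernel_le_trivial hQ _).trans ?_
          gcongr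
      refine (sum_le_card_nsmul _ _ _ h).trans ?_
      rw [nsmul_eq_mul]
      gcongr
    calc _ ≤ 20 * (X / M * L) * (N * ∑ n ∈ Icc 1 X, f n ^ 2) +
          56 * M ^ 3 * ((8 * M ^ 2 * E) ^ 2 * (X * (L + L))) := add_le_add h1 h2
      _ ≤ 20 * (X / M * L) * (N * ∑ n ∈ Icc 1 X, f n ^ 2) +
          56 * M ^ 3 * ((8 * M ^ 2 * E) ^ 2 * (N * (L + L))) := by gcongr
      _ = _ := by ring
  exact le_of_mul_le_mul_left hle hN0

lemma exists_sum_sq_mangoldtDiff_le (a : ℕ) :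
    ∃ C : ℝ, 0 < C ∧ ∀ᶠ X : ℕ in atTop, ∀ M : ℕ, (M:ℝ) ≤ Real.log X ^ a →
      ∑ n ∈ Icc 1 X, mangoldtDiff M n ^ 2 ≤ C * (X * Real.log X) := by
  obtain ⟨C, hC, h⟩ := exists_sum_sq_mangoldtDiff_asymptotic a one_ne_zero
  refine ⟨1 + C, by positivity, ?_⟩
  filter_upwards [h, eventually_one_le_log] with X h1 h2 M hM
  have h3 := (abs_le.1 (h1 M hM)).2
  have hS : 0 ≤ sqfSum M := sum_nonneg fun r _ => by split_ifs <;> positivity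
  have hX : (0:ℝ) ≤ X := by positivity
  have h4 : (X:ℝ) / Real.log X ^ 1 ≤ X * Real.log X := by
    rw [pow_one]
    exact (div_le_self hX h2).trans (le_mul_of_one_le_right hX h2)
  nlinarith [mul_nonneg hX hS, mul_le_mul_of_nonneg_left h4 hC.le]

lemma exists_shiftCorrelation_bound (a : ℕ) :
    ∃ C : ℝ, 0 < C ∧ ∀ᶠ X : ℕ in atTop, ∀ M : ℕ, 1 ≤ M → (M:ℝ) ≤ Real.log X ^ a → ∀ Q ≤ X,
      |shiftCorrelation (mangoldtDiff M) X Q| ≤ C * ((X:ℝ) ^ 2 * Real.log X ^ 2 / M) := by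
  obtain ⟨C₁, hC₁, h₁⟩ := exists_mangoldtDiff_residue_bound a (m := 4 * a + 1) (by omega)
  obtain ⟨C₂, hC₂, h₂⟩ := exists_sum_sq_mangoldtDiff_le a
  refine ⟨20 * C₂ + 7168 * C₁ ^ 2, by positivity, ?_⟩
  filter_upwards [h₁, h₂, eventually_log_pow_le_sqrt (a + 1),
    (tendsto_log_pow one_ne_zero).eventually_ge_atTop 4] with X h1 h2 h3 h4
  intro M hM hMa Q hQ
  rw [pow_one] at h4
  set L := Real.log X with hL
  have hL0 : 0 < L := by linarith
  have hM1 : (1:ℝ) ≤ M := by exact_mod_cast hM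
  have hMX : Real.pi * M ≤ √X := by
    calc Real.pi * M ≤ L * L ^ a := by
          gcongr
          linarith [Real.pi_lt_four]
      _ = L ^ (a + 1) := by ring
      _ ≤ √X := h3
  refine (abs_shiftCorrelation_le (E := C₁ * (X / L ^ (4 * a + 1))) hQ hM hMX (by linarith)
    fun y hy s hs hsM c => h1 M hMa y hy s hs hsM c).trans ?_
  have k1 : 20 * (X / M * L) * ∑ n ∈ Icc 1 X, mangoldtDiff M n ^ 2 ≤
      20 * C₂ * ((X:ℝ) ^ 2 * L ^ 2 / M) := by
    calc _ ≤ 20 * (X / M * L) * (C₂ * (X * L)) := by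
          gcongr
          exact h2 M hMa
      _ = _ := by ring
  have k2 : 7168 * (M:ℝ) ^ 7 * (C₁ * (X / L ^ (4 * a + 1))) ^ 2 * L ≤
      7168 * C₁ ^ 2 * ((X:ℝ) ^ 2 * L ^ 2 / M) := by
    have hM8 : (M:ℝ) ^ 8 ≤ (L ^ a) ^ 8 := by gcongr
    have e : 7168 * (M:ℝ) ^ 7 * (C₁ * (X / L ^ (4 * a + 1))) ^ 2 * L =
        7168 * C₁ ^ 2 * ((X:ℝ) ^ 2 * (M ^ 8 / (L ^ a) ^ 8 / L) / M) := by
      have : L ^ (4 * a + 1) = (L ^ a) ^ 4 * L := by rw [pow_succ, mul_comm 4 a, pow_mul]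
      rw [this]
      field_simp
    rw [e]
    gcongr
    calc (M:ℝ) ^ 8 / (L ^ a) ^ 8 / L ≤ 1 / 1 := by
          gcongr
          · exact div_le_one_of_le₀ hM8 (by positivity)
          · linarith
      _ ≤ L ^ 2 := by
          rw [div_one]
          exact one_le_pow₀ (by linarith)
  linarith

lemma abs_mul_log_sub_mul_log_le {x X : ℝ} (hX : 1 ≤ X) (hXx : X ≤ x) (hx : x ≤ X + 1) :
    |X * Real.log X - x * Real.log x| ≤ Real.log x + 1 := by
  have hX0 : 0 < X := by linarith
  have h1 := Real.log_le_log hX0 hXx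
  have h2 := Real.log_le_sub_one_of_pos (x := x / X) (div_pos (by linarith) hX0)
  rw [Real.log_div (by linarith) hX0.ne'] at h2
  have h3 := mul_le_mul_of_nonneg_left h2 hX0.le
  have e : X * (x / X - 1) = x - X := by field_simp
  rw [e] at h3
  have h4 := Real.log_nonneg hX
  rw [abs_le]
  constructor <;> nlinarith

lemma psi_sub_rhoR (x R : ℝ) (q a : ℕ) :
    psi x q a - rhoR x R q a =
      ∑ n ∈ Icc 1 ⌊x⌋₊ with n % q = a % q, mangoldtDiff ⌊R⌋₊ n := by
  simp only [psi, rhoR, mangoldtDiff, XiR_eq_xi, sum_sub_distrib]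

lemma sqfSum_floor (R : ℝ) : sqfSum (⌊R⌋₊ : ℕ) = sqfSum R := by
  rw [sqfSum, sqfSum, Nat.floor_natCast]

/-- Replacing `⌊x⌋` by `x` and the squarefree totient sum by its asymptotic value in the
main term of the diagonal. -/
lemma abs_diagonal_main_sub_le {x X L S r c K ε : ℝ} (hX : 1 ≤ X) (hXx : X ≤ x)
    (hx : x ≤ X + 1) (hL1 : 1 ≤ L) (hL : Real.log x ≤ 2 * L) (hr0 : 0 ≤ r) (hr : r ≤ L)
    (hS : |S - r - c| ≤ K * ε) (hε : L ≤ x * ε) :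
    |(X * Real.log X - X - X * S) - (x * (Real.log x - r) - (1 + c) * x)| ≤
      (5 + |c| + K) * (x * ε) := by
  have h1 := abs_mul_log_sub_mul_log_le hX hXx hx
  have e : (X * Real.log X - X - X * S) - (x * (Real.log x - r) - (1 + c) * x) =
      (X * Real.log X - x * Real.log x) + (x - X) * (1 + r + c) - X * (S - r - c) := by ring
  have h2 : |(x - X) * (1 + r + c)| ≤ 1 * (1 + L + |c|) := by
    rw [abs_mul]
    gcongr
    · rw [abs_of_nonneg (by linarith)]; linarith
    · refine (abs_add_le _ _).trans ?_
      rw [abs_of_nonneg (by linarith : 0 ≤ 1 + r)]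
      linarith
  have h3 : |X * (S - r - c)| ≤ x * (K * ε) := by
    rw [abs_mul, abs_of_nonneg (by linarith : 0 ≤ X)]
    gcongr
    linarith
  have h4 : |c| * 1 ≤ |c| * (x * ε) := by
    gcongr
    linarith
  rw [e]
  refine (abs_sub _ _).trans ((add_le_add_left (abs_add_le _ _) _).trans ?_)
  linarith

lemma abs_second_moment_sub_le {V Q N F D x t κ B₁ B₂ B₃ : ℝ} (hV : V = N * F + 2 * D)
    (hN : N ≤ Q) (hQN : Q ≤ N + 1) (hQ : 0 ≤ Q) (hF0 : 0 ≤ F) (hF : F ≤ B₁)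
    (hD : |D| ≤ B₂) (ht : |F - (x * t - κ * x)| ≤ B₃) :
    |V - Q * x * t + κ * Q * x| ≤ Q * B₃ + (B₁ + 2 * B₂) := by
  have e : V - Q * x * t + κ * Q * x =
      Q * (F - (x * t - κ * x)) + (2 * D - (Q - N) * F) := by rw [hV]; ring
  have h1 : |Q * (F - (x * t - κ * x))| ≤ Q * B₃ := by
    rw [abs_mul, abs_of_nonneg hQ]
    gcongr
  have h2 : |2 * D - (Q - N) * F| ≤ B₁ + 2 * B₂ := by
    have := abs_le.1 hD
    have h3 : 0 ≤ (Q - N) * F := mul_nonneg (by linarith) hF0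
    have h4 : (Q - N) * F ≤ 1 * F := by gcongr; linarith
    rw [abs_le]
    constructor <;> linarith
  rw [e]
  exact (abs_add_le _ _).trans (add_le_add h1 h2)

lemma log_rpow_le_pow {x X A : ℝ} (hA : 0 ≤ A) (hx : 1 ≤ x) (hX : 2 ≤ Real.log X)
    (hxX : Real.log x ≤ 2 * Real.log X) :
    Real.log x ^ A ≤ Real.log X ^ ⌈2 * A⌉₊ := by
  calc Real.log x ^ A ≤ (Real.log X ^ (2:ℝ)) ^ A := by
        gcongr
        · exact Real.log_nonneg hx
        · rw [Real.rpow_two]; nlinarith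
    _ = Real.log X ^ (2 * A) := by rw [← Real.rpow_mul (by linarith)]
    _ ≤ Real.log X ^ (⌈2 * A⌉₊ : ℝ) :=
        Real.rpow_le_rpow_of_exponent_le (by linarith) (Nat.le_ceil _)
    _ = _ := Real.rpow_natCast _ _

lemma log_le_two_mul_log {x X : ℝ} (hX : 2 ≤ X) (hx0 : 0 < x) (hx : x ≤ X + 1) :
    Real.log x ≤ 2 * Real.log X := by
  have : 2 * Real.log X = Real.log (X ^ 2) := by rw [Real.log_pow]; norm_num
  rw [this]
  exact Real.log_le_log hx0 (by nlinarith)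

end Vaughan

open Vaughan Filter

/-- Vaughan (2003), Corollary 4.1: the variance of ψ against the novel main
term ρ satisfies an asymptotic formula uniform in Q. -/
theorem vaughan_novel_main_term_second_moment :
    ∃ c : ℝ, ∀ A : ℝ, 0 < A → ∃ x₀ C : ℝ, 0 < C ∧
      ∀ x Q R : ℝ, x₀ < x → 1 ≤ Q → Q ≤ x → 2 ≤ R → R ≤ Real.log x ^ A →
        |(∑ q ∈ Finset.Icc 1 ⌊Q⌋₊, ∑ a ∈ Finset.Icc 1 q,
            (psi x q a - rhoR x R q a) ^ 2) -
          Q * x * Real.log (x / R) + c * Q * x| ≤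
        C * (Q * x * R ^ (-(1 : ℝ) / 2) + x ^ 2 * Real.log x ^ 2 / R) := by
  obtain ⟨c, K, hK, hS⟩ := exists_sqfSum_asymptotic
  refine ⟨1 + c, fun A hA => ?_⟩
  set a := ⌈2 * A⌉₊ with ha
  obtain ⟨C₁, hC₁, h₁⟩ := exists_sum_sq_mangoldtDiff_asymptotic a (m := a)
    (Nat.ceil_pos.2 (by linarith)).ne'
  obtain ⟨C₂, hC₂, h₂⟩ := exists_sum_sq_mangoldtDiff_le a
  obtain ⟨C₃, hC₃, h₃⟩ := exists_shiftCorrelation_bound a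
  obtain ⟨N₀, hN₀⟩ := eventually_atTop.1 (((h₁.and h₂).and h₃).and
    (((eventually_log_pow_le_sqrt (a + 1)).and
    ((tendsto_log_pow one_ne_zero).eventually_ge_atTop 2)).and (eventually_ge_atTop 2)))
  refine ⟨N₀, (C₁ + (5 + |c| + K)) + (C₂ + 2 * (2 * C₃)), by positivity, ?_⟩
  intro x Q R hx hQ hQx hR hRA
  obtain ⟨⟨⟨h1, h2⟩, h3⟩, ⟨h4, h5⟩, h6⟩ := hN₀ ⌊x⌋₊ (Nat.le_floor hx.le)
  set X := ⌊x⌋₊ with hXdef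
  set M := ⌊R⌋₊ with hMdef
  set L := Real.log X with hL
  set ε := R ^ (-(1 : ℝ) / 2) with hε
  rw [pow_one] at h5
  have hx1 : 1 ≤ x := hQ.trans hQx
  have hX2 : (2:ℝ) ≤ X := by exact_mod_cast h6
  have hXx : (X:ℝ) ≤ x := Nat.floor_le (by linarith)
  have hxX : x ≤ X + 1 := (Nat.lt_floor_add_one x).le
  have hxL : Real.log x ≤ 2 * L := log_le_two_mul_log hX2 (by linarith) hxX
  have hLx : L ≤ Real.log x := Real.log_le_log (by linarith) hXx
  have hRL : R ≤ L ^ a := hRA.trans (log_rpow_le_pow hA.le hx1 h5 hxL)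
  have hMR : (M:ℝ) ≤ R := Nat.floor_le (by linarith)
  have hRM : R ≤ M + 1 := (Nat.lt_floor_add_one R).le
  have hM1 : 1 ≤ M := Nat.le_floor (by norm_num; linarith)
  have hML : (M:ℝ) ≤ L ^ a := hMR.trans hRL
  have hM1' : (1:ℝ) ≤ M := by exact_mod_cast hM1
  have hLRX : L * R ≤ X := by
    calc L * R ≤ L * L ^ a := by gcongr
      _ = L ^ (a + 1) := by ring
      _ ≤ √X := h4
      _ ≤ X := by
        rw [Real.sqrt_le_left (by linarith)]
        nlinarith
  have hRX : R ≤ X := by nlinarith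
  have hεR : 1 ≤ R * ε := by
    rw [hε, ← Real.rpow_one_add' (by linarith) (by norm_num)]
    exact Real.one_le_rpow (by linarith) (by norm_num)
  have hε0 : 0 < ε := Real.rpow_pos_of_pos (by linarith) _
  have hlogR : Real.log R ≤ L := Real.log_le_log (by linarith) hRX
  have hLε : L ≤ x * ε := by
    calc L ≤ L * (R * ε) := le_mul_of_one_le_right (by linarith) hεR
      _ = L * R * ε := by ring
      _ ≤ x * ε := by gcongr; linarith
  have hSM : |sqfSum M - Real.log R - c| ≤ K * ε := by
    rw [sqfSum_floor]
    exact hS R (by linarith)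
  have hdiag : |∑ n ∈ Icc 1 X, mangoldtDiff M n ^ 2 - (x * Real.log (x / R) - (1 + c) * x)| ≤
      (C₁ + (5 + |c| + K)) * (x * ε) := by
    rw [Real.log_div (by linarith) (by linarith)]
    have k1 := h1 M hML
    have k2 := abs_diagonal_main_sub_le (by linarith) hXx hxX (by linarith) hxL
      (Real.log_nonneg (by linarith)) hlogR hSM hLε
    have k3 : (X:ℝ) / L ^ a ≤ x * ε := by
      rw [div_le_iff₀ (by positivity)]
      calc (X:ℝ) ≤ x * (R * ε) := hXx.trans (le_mul_of_one_le_right (by linarith) hεR)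
        _ ≤ x * (L ^ a * ε) := by gcongr
        _ = _ := by ring
    refine (abs_sub_le _ _ _).trans ((add_le_add k1 k2).trans ?_)
    linarith [mul_le_mul_of_nonneg_left k3 hC₁.le]
  have hsum : ∑ n ∈ Icc 1 X, mangoldtDiff M n ^ 2 ≤ C₂ * (x ^ 2 * Real.log x ^ 2 / R) := by
    refine (h2 M hML).trans ?_
    gcongr
    rw [le_div_iff₀ (by linarith)]
    calc X * L * R = X * (L * R) * 1 := by ring
      _ ≤ x * x * Real.log x ^ 2 := by
        gcongr
        · linarith
        · exact one_le_pow₀ (by linarith)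
      _ = _ := by ring
  have hcorr : |shiftCorrelation (mangoldtDiff M) X ⌊Q⌋₊| ≤
      2 * C₃ * (x ^ 2 * Real.log x ^ 2 / R) := by
    refine (h3 M hM1 hML _ (Nat.floor_le_floor hQx)).trans ?_
    calc C₃ * ((X:ℝ) ^ 2 * L ^ 2 / M) ≤ C₃ * (x ^ 2 * Real.log x ^ 2 / (R / 2)) := by
          gcongr
          linarith
      _ = _ := by ring
  have hV : ∑ q ∈ Icc 1 ⌊Q⌋₊, ∑ a ∈ Icc 1 q, (psi x q a - rhoR x R q a) ^ 2 =
      ⌊Q⌋₊ * ∑ n ∈ Icc 1 X, mangoldtDiff M n ^ 2 +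
        2 * shiftCorrelation (mangoldtDiff M) X ⌊Q⌋₊ := by
    simp only [psi_sub_rhoR]
    exact sum_sum_sq_residue_sums _ _ _
  have hmain := abs_second_moment_sub_le hV (Nat.floor_le (by linarith))
    (Nat.lt_floor_add_one Q).le (by linarith) (sum_nonneg fun n _ => sq_nonneg _) hsum hcorr hdiag
  refine hmain.trans ?_
  have p1 : 0 ≤ (C₁ + (5 + |c| + K)) * (x ^ 2 * Real.log x ^ 2 / R) := by positivity
  have p2 : 0 ≤ (C₂ + 2 * (2 * C₃)) * (Q * x * ε) := by positivity
  linarith
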